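/- For any positive integers k and B, there exist a constant c > 0 and a real number x_0 such that for all x ≥ x_0, the number of positive integers n ≤ x with d_k(n) = d_k(n+B) is at least c·x/(log x)^7. -/

import Mathlib

/-- `dk k n` is the number of divisors `m` of `n` with `gcd(m, k) = 1`. -/
def dk (k n : ℕ) : ℕ := (n.divisors.filter fun m => Nat.gcd m k = 1).card

/-- The elementary symmetric sum of degree `m` of `g` over `P`. -/
def symSum {ι : Type*} (P : Finset ι) (m : ℕ) (g : ι → ℝ) : ℝ :=
  ∑ T ∈ P.powersetCard m, ∏ p ∈ T, g p

/-- The inclusion-exclusion sum for `∏ (1 - g)` truncated after degree `b`. -/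
def bonferroni {ι : Type*} (P : Finset ι) (b : ℕ) (g : ι → ℝ) : ℝ :=
  ∑ m ∈ Finset.range (b + 1), (-1) ^ m * symSum P m g

section Bonferroni

variable {ι : Type*}

theorem symSum_zero (P : Finset ι) (g : ι → ℝ) : symSum P 0 g = 1 := by
  simp [symSum]

theorem symSum_insert_succ [DecidableEq ι] {P : Finset ι} {p : ι} (hp : p ∉ P) (g : ι → ℝ) (m : ℕ) :
    symSum (insert p P) (m + 1) g = symSum P (m + 1) g + g p * symSum P m g := by
  unfold symSum
  rw [Finset.powersetCard_succ_insert hp, Finset.sum_union, Finset.sum_image, Finset.mul_sum]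
  · congr 1
    refine Finset.sum_congr rfl fun T hT => ?_
    rw [Finset.prod_insert fun h => hp ((Finset.mem_powersetCard.1 hT).1 h)]
  · intro S hS T hT h
    have h1 : p ∉ S := fun h => hp ((Finset.mem_powersetCard.1 hS).1 h)
    have h2 : p ∉ T := fun h => hp ((Finset.mem_powersetCard.1 hT).1 h)
    rw [← Finset.erase_insert h1, ← Finset.erase_insert h2, h]
  · rw [Finset.disjoint_left]
    intro T hT hT'
    obtain ⟨S, -, rfl⟩ := Finset.mem_image.1 hT'
    exact hp ((Finset.mem_powersetCard.1 hT).1 (Finset.mem_insert_self _ _))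

theorem bonferroni_succ (P : Finset ι) (b : ℕ) (g : ι → ℝ) :
    bonferroni P (b + 1) g = bonferroni P b g + (-1) ^ (b + 1) * symSum P (b + 1) g := by
  simp [bonferroni, Finset.sum_range_succ _ (b + 1)]

theorem bonferroni_zero (P : Finset ι) (g : ι → ℝ) : bonferroni P 0 g = 1 := by
  simp [bonferroni, symSum_zero]

theorem bonferroni_insert_succ [DecidableEq ι] {P : Finset ι} {p : ι} (hp : p ∉ P)
    (g : ι → ℝ) (b : ℕ) :
    bonferroni (insert p P) (b + 1) g = bonferroni P (b + 1) g - g p * bonferroni P b g := by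
  induction b with
  | zero =>
    simp only [bonferroni_succ, bonferroni_zero, symSum_insert_succ hp, symSum_zero]
    ring
  | succ b ih =>
    rw [bonferroni_succ, ih, bonferroni_succ P (b + 1), symSum_insert_succ hp,
      bonferroni_succ P b]
    ring

theorem bonferroni_sign {P : Finset ι} {g : ι → ℝ} (h0 : ∀ p ∈ P, 0 ≤ g p)
    (h1 : ∀ p ∈ P, g p ≤ 1) (b : ℕ) :
    0 ≤ (-1) ^ b * (bonferroni P b g - ∏ p ∈ P, (1 - g p)) := by
  classical
  induction P using Finset.induction_on generalizing b with
  | empty =>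
    have h : ∀ b, bonferroni (∅ : Finset ι) b g = 1 := by
      intro b
      induction b with
      | zero => exact bonferroni_zero _ _
      | succ b ih =>
        rw [bonferroni_succ, ih, symSum, Finset.powersetCard_eq_empty.2 (by simp)]
        simp
    simp [h]
  | insert p P hp ih =>
    have ih' := ih (fun q hq => h0 q (Finset.mem_insert_of_mem hq))
      (fun q hq => h1 q (Finset.mem_insert_of_mem hq))
    have hp0 := h0 p (Finset.mem_insert_self _ _)
    have hp1 := h1 p (Finset.mem_insert_self _ _)
    rw [Finset.prod_insert hp]
    cases b with
    | zero =>
      have := ih' 0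
      simp only [bonferroni_zero, pow_zero, one_mul] at this ⊢
      have h3 : 0 ≤ ∏ p ∈ P, (1 - g p) := Finset.prod_nonneg fun q hq => by
        linarith [h1 q (Finset.mem_insert_of_mem hq)]
      nlinarith
    | succ b =>
      rw [bonferroni_insert_succ hp]
      have e1 := ih' (b + 1)
      have e2 := mul_nonneg hp0 (ih' b)
      have : (-1 : ℝ) ^ (b + 1) * (bonferroni P (b + 1) g - g p * bonferroni P b g -
          (1 - g p) * ∏ p ∈ P, (1 - g p)) =
          (-1) ^ (b + 1) * (bonferroni P (b + 1) g - ∏ p ∈ P, (1 - g p)) +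
          g p * ((-1) ^ b * (bonferroni P b g - ∏ p ∈ P, (1 - g p))) := by
        ring
      rw [this]
      exact add_nonneg e1 e2

theorem prod_le_bonferroni {P : Finset ι} {g : ι → ℝ} (h0 : ∀ p ∈ P, 0 ≤ g p)
    (h1 : ∀ p ∈ P, g p ≤ 1) {b : ℕ} (hb : Even b) :
    ∏ p ∈ P, (1 - g p) ≤ bonferroni P b g := by
  have := bonferroni_sign h0 h1 b
  rw [hb.neg_one_pow] at this
  linarith

theorem bonferroni_le_prod_add {P : Finset ι} {g : ι → ℝ} (h0 : ∀ p ∈ P, 0 ≤ g p)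
    (h1 : ∀ p ∈ P, g p ≤ 1) {b : ℕ} (hb : Even b) :
    bonferroni P b g ≤ ∏ p ∈ P, (1 - g p) + symSum P (b + 1) g := by
  have := bonferroni_sign h0 h1 (b + 1)
  rw [hb.add_one.neg_one_pow, bonferroni_succ, hb.add_one.neg_one_pow] at this
  linarith

theorem pow_mul_symSum_le {P : Finset ι} {g : ι → ℝ} (h0 : ∀ p ∈ P, 0 ≤ g p) {t : ℝ}
    (ht : 0 ≤ t) (m : ℕ) : t ^ m * symSum P m g ≤ Real.exp (t * ∑ p ∈ P, g p) := by
  have h1 : ∏ p ∈ P, (1 + t * g p) ≤ Real.exp (t * ∑ p ∈ P, g p) := by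
    rw [Finset.mul_sum, Real.exp_sum]
    refine Finset.prod_le_prod (fun p hp => ?_) fun p hp => ?_
    · have := mul_nonneg ht (h0 p hp); linarith
    · linarith [Real.add_one_le_exp (t * g p)]
  refine le_trans ?_ h1
  rw [Finset.prod_one_add, symSum, Finset.mul_sum]
  have : ∑ T ∈ P.powersetCard m, t ^ m * ∏ p ∈ T, g p
      = ∑ T ∈ P.powersetCard m, ∏ p ∈ T, (t * g p) := by
    refine Finset.sum_congr rfl fun T hT => ?_
    rw [Finset.prod_mul_distrib, Finset.prod_const, (Finset.mem_powersetCard.1 hT).2]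
  rw [this]
  refine Finset.sum_le_sum_of_subset_of_nonneg (fun T hT => ?_) fun T hT _ => ?_
  · exact Finset.mem_powerset.2 (Finset.mem_powersetCard.1 hT).1
  · exact Finset.prod_nonneg fun p hp => mul_nonneg ht (h0 p (Finset.mem_powerset.1 hT hp))

theorem prod_sub_prod_le [DecidableEq ι] {J : Finset ι} {U V : ι → ℝ} (hV : ∀ j ∈ J, 0 ≤ V j)
    (hUV : ∀ j ∈ J, V j ≤ U j) :
    ∏ j ∈ J, U j - ∏ j ∈ J, V j ≤ ∑ j ∈ J, (U j - V j) * ∏ i ∈ J.erase j, U i := by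
  induction J using Finset.induction_on with
  | empty => simp
  | insert a J ha ih =>
    have ih' := ih (fun q hq => hV q (Finset.mem_insert_of_mem hq))
      (fun q hq => hUV q (Finset.mem_insert_of_mem hq))
    have a0 := hV a (Finset.mem_insert_self _ _)
    have a1 := hUV a (Finset.mem_insert_self _ _)
    rw [Finset.prod_insert ha, Finset.prod_insert ha, Finset.sum_insert ha,
      Finset.erase_insert ha]
    have h1 : ∑ j ∈ J, (U j - V j) * ∏ i ∈ (insert a J).erase j, U i =
        U a * ∑ j ∈ J, (U j - V j) * ∏ i ∈ J.erase j, U i := by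
      rw [Finset.mul_sum]
      refine Finset.sum_congr rfl fun j hj => ?_
      have hja : a ≠ j := fun h => ha (h ▸ hj)
      rw [Finset.erase_insert_of_ne hja, Finset.prod_insert fun h => ha (Finset.mem_of_mem_erase h)]
      ring
    rw [h1]
    have h2 : ∏ j ∈ J, V j ≤ ∏ j ∈ J, U j := Finset.prod_le_prod
      (fun j hj => hV j (Finset.mem_insert_of_mem hj))
      fun j hj => hUV j (Finset.mem_insert_of_mem hj)
    nlinarith [mul_le_mul_of_nonneg_left ih' (a0.trans a1),
      mul_le_mul_of_nonneg_right a1 (sub_nonneg.2 h2)]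

end Bonferroni

/-- `F` is a linear combination of monomials `∏ p ∈ T, h p` with `T ⊆ Q` whose weighted
coefficient sum is at most `R`. -/
def IsSieveSum (Q : Finset ℕ) (N R : ℝ) (F : (ℕ → ℝ) → ℝ) : Prop :=
  ∃ (κ : Type) (I : Finset κ) (w : κ → ℝ) (T : κ → Finset ℕ),
    (∀ k ∈ I, T k ⊆ Q) ∧ (∀ h, F h = ∑ k ∈ I, w k * ∏ p ∈ T k, h p) ∧
      ∑ k ∈ I, |w k| * N ^ (T k).card ≤ R

section SieveSum

theorem IsSieveSum.one (N : ℝ) : IsSieveSum ∅ N 1 fun _ => 1 :=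
  ⟨Unit, {()}, fun _ => 1, fun _ => ∅, by simp, by simp, by simp⟩

theorem IsSieveSum.mul {Q₁ Q₂ : Finset ℕ} {N R₁ R₂ : ℝ} {F₁ F₂ : (ℕ → ℝ) → ℝ} (hN : 0 ≤ N)
    (h₁ : IsSieveSum Q₁ N R₁ F₁) (h₂ : IsSieveSum Q₂ N R₂ F₂) (hQ : Disjoint Q₁ Q₂) :
    IsSieveSum (Q₁ ∪ Q₂) N (R₁ * R₂) fun h => F₁ h * F₂ h := by
  obtain ⟨κ₁, I₁, w₁, T₁, hT₁, hF₁, hR₁⟩ := h₁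
  obtain ⟨κ₂, I₂, w₂, T₂, hT₂, hF₂, hR₂⟩ := h₂
  have hd : ∀ k ∈ I₁ ×ˢ I₂, Disjoint (T₁ k.1) (T₂ k.2) := fun k hk =>
    Finset.disjoint_of_subset_left (hT₁ _ (Finset.mem_product.1 hk).1)
      (Finset.disjoint_of_subset_right (hT₂ _ (Finset.mem_product.1 hk).2) hQ)
  refine ⟨κ₁ × κ₂, I₁ ×ˢ I₂, fun k => w₁ k.1 * w₂ k.2, fun k => T₁ k.1 ∪ T₂ k.2, ?_, ?_, ?_⟩
  · intro k hk
    obtain ⟨hk1, hk2⟩ := Finset.mem_product.1 hk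
    exact Finset.union_subset_union (hT₁ _ hk1) (hT₂ _ hk2)
  · intro h
    change F₁ h * F₂ h = ∑ k ∈ I₁ ×ˢ I₂, (w₁ k.1 * w₂ k.2) * ∏ p ∈ T₁ k.1 ∪ T₂ k.2, h p
    rw [hF₁, hF₂, Finset.sum_mul_sum, ← Finset.sum_product']
    refine Finset.sum_congr rfl fun k hk => ?_
    rw [Finset.prod_union (hd k hk)]
    ring
  · have : ∑ k ∈ I₁ ×ˢ I₂, |w₁ k.1 * w₂ k.2| * N ^ (T₁ k.1 ∪ T₂ k.2).card =
        (∑ k ∈ I₁, |w₁ k| * N ^ (T₁ k).card) * ∑ k ∈ I₂, |w₂ k| * N ^ (T₂ k).card := by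
      rw [Finset.sum_mul_sum, ← Finset.sum_product']
      refine Finset.sum_congr rfl fun k hk => ?_
      rw [Finset.card_union_of_disjoint (hd k hk), abs_mul, pow_add]
      ring
    rw [this]
    have h0 : ∀ (κ : Type) (I : Finset κ) (w : κ → ℝ) (T : κ → Finset ℕ),
        0 ≤ ∑ k ∈ I, |w k| * N ^ (T k).card := fun κ I w T => by positivity
    exact mul_le_mul hR₁ hR₂ (h0 _ _ _ _) ((h0 _ _ _ _).trans hR₁)

theorem IsSieveSum.prod {N : ℝ} (hN : 0 ≤ N) {J : Finset ℕ} {Q : ℕ → Finset ℕ} {R : ℕ → ℝ}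
    {F : ℕ → (ℕ → ℝ) → ℝ} (h : ∀ j ∈ J, IsSieveSum (Q j) N (R j) (F j))
    (hQ : ∀ i ∈ J, ∀ j ∈ J, i ≠ j → Disjoint (Q i) (Q j)) :
    IsSieveSum (J.biUnion Q) N (∏ j ∈ J, R j) fun h => ∏ j ∈ J, F j h := by
  induction J using Finset.induction_on with
  | empty => simpa using IsSieveSum.one N
  | insert a J ha ih =>
    have := (h a (Finset.mem_insert_self _ _)).mul hN
      (ih (fun j hj => h j (Finset.mem_insert_of_mem hj)) fun i hi j hj =>
        hQ i (Finset.mem_insert_of_mem hi) j (Finset.mem_insert_of_mem hj)) (by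
        rw [Finset.disjoint_biUnion_right]
        exact fun j hj => hQ a (Finset.mem_insert_self _ _) j (Finset.mem_insert_of_mem hj)
          fun h => ha (h ▸ hj))
    simpa only [Finset.prod_insert ha, Finset.biUnion_insert] using this

theorem IsSieveSum.mono {Q Q' : Finset ℕ} {N R R' : ℝ} {F : (ℕ → ℝ) → ℝ}
    (h : IsSieveSum Q N R F) (hQ : Q ⊆ Q') (hR : R ≤ R') : IsSieveSum Q' N R' F := by
  obtain ⟨κ, I, w, T, hT, hF, hR₁⟩ := h
  exact ⟨κ, I, w, T, fun k hk => (hT k hk).trans hQ, hF, hR₁.trans hR⟩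

theorem isSieveSum_symSum (P : Finset ℕ) (N : ℝ) (m : ℕ) :
    IsSieveSum P N (P.card.choose m * N ^ m) (symSum P m) := by
  refine ⟨Finset ℕ, P.powersetCard m, fun _ => 1, fun T => T,
    fun T hT => (Finset.mem_powersetCard.1 hT).1, fun h => by simp [symSum], ?_⟩
  rw [Finset.sum_congr rfl fun T hT => by rw [(Finset.mem_powersetCard.1 hT).2]]
  simp

theorem isSieveSum_bonferroni (P : Finset ℕ) (N : ℝ) (b : ℕ) :
    IsSieveSum P N (∑ m ∈ Finset.range (b + 1), P.card.choose m * N ^ m) (bonferroni P b) := by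
  refine ⟨Σ _ : ℕ, Finset ℕ, (Finset.range (b + 1)).sigma fun m => P.powersetCard m,
    fun k => (-1) ^ k.1, fun k => k.2, fun k hk => ?_, fun h => ?_, ?_⟩
  · exact (Finset.mem_powersetCard.1 (Finset.mem_sigma.1 hk).2).1
  · rw [Finset.sum_sigma]
    simp [bonferroni, symSum, Finset.mul_sum]
  · rw [Finset.sum_sigma]
    refine Finset.sum_le_sum fun m hm => ?_
    rw [Finset.sum_congr rfl fun T hT => by rw [(Finset.mem_powersetCard.1 hT).2]]
    simp

theorem sum_choose_mul_pow_le {N : ℝ} (hN : 0 ≤ N) (n b : ℕ) :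
    ∑ m ∈ Finset.range (b + 1), (n.choose m : ℝ) * N ^ m ≤ (n * N + 1) ^ b := by
  rw [add_pow]
  refine Finset.sum_le_sum fun m hm => ?_
  have h1 : (n.choose m : ℝ) ≤ n ^ m := by exact_mod_cast Nat.choose_le_pow n m
  have h2 : (1 : ℝ) ≤ b.choose m := by
    exact_mod_cast Nat.choose_pos (Nat.lt_succ_iff.1 (Finset.mem_range.1 hm))
  calc (n.choose m : ℝ) * N ^ m ≤ n ^ m * N ^ m := by gcongr
    _ = (n * N) ^ m * 1 := by rw [mul_pow, mul_one]
    _ ≤ (n * N) ^ m * b.choose m := by gcongr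
    _ = _ := by simp

theorem choose_mul_pow_le {N : ℝ} (hN : 0 ≤ N) (n b : ℕ) :
    (n.choose b : ℝ) * N ^ b ≤ (n * N + 1) ^ b :=
  (Finset.single_le_sum (f := fun m => (n.choose m : ℝ) * N ^ m) (fun _ _ => by positivity)
    (Finset.self_mem_range_succ b)).trans (sum_choose_mul_pow_le hN n b)

theorem IsSieveSum.abs_sum_sub_le {σ : Type*} {S : Finset σ} {bad : ℕ → σ → Prop}
    [∀ p s, Decidable (bad p s)] {P : Finset ℕ} {g : ℕ → ℝ} {Y N R : ℝ}
    (hcount : ∀ T ⊆ P, |((S.filter fun s => ∀ p ∈ T, bad p s).card : ℝ) - Y * ∏ p ∈ T, g p|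
      ≤ N ^ T.card) {F : (ℕ → ℝ) → ℝ} (hF : IsSieveSum P N R F) :
    |∑ s ∈ S, F (fun p => if bad p s then 1 else 0) - Y * F g| ≤ R := by
  obtain ⟨κ, I, w, T, hT, hF, hR⟩ := hF
  refine le_trans ?_ hR
  have h1 : ∑ s ∈ S, F (fun p => if bad p s then 1 else 0) - Y * F g =
      ∑ k ∈ I, w k * (((S.filter fun s => ∀ p ∈ T k, bad p s).card : ℝ) -
        Y * ∏ p ∈ T k, g p) := by
    simp only [hF]
    rw [Finset.sum_comm, Finset.mul_sum, ← Finset.sum_sub_distrib]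
    refine Finset.sum_congr rfl fun k _ => ?_
    rw [← Finset.mul_sum, mul_sub, Finset.card_filter, Nat.cast_sum]
    congr 1
    · congr 1
      refine Finset.sum_congr rfl fun s _ => ?_
      rw [Finset.prod_ite_zero]
      simp
    · ring
  rw [h1]
  refine (Finset.abs_sum_le_sum_abs _ _).trans (Finset.sum_le_sum fun k hk => ?_)
  rw [abs_mul]
  exact mul_le_mul_of_nonneg_left (hcount _ (hT k hk)) (abs_nonneg _)

end SieveSum

section BrunHooley

theorem prod_filter_levels {P : Finset ℕ} {lev : ℕ → ℕ} {J : ℕ} (hlev : ∀ p ∈ P, lev p < J)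
    (f : ℕ → ℝ) :
    ∏ j ∈ Finset.range J, ∏ p ∈ P.filter (fun p => lev p = j), f p = ∏ p ∈ P, f p :=
  Finset.prod_fiberwise_of_maps_to (fun p hp => Finset.mem_range.2 (hlev p hp)) f

theorem brun_hooley {σ : Type*} {S : Finset σ} {bad : ℕ → σ → Prop}
    [∀ p s, Decidable (bad p s)] {P : Finset ℕ} {g : ℕ → ℝ} {Y N : ℝ} (hY : 0 ≤ Y) (hN : 0 ≤ N)
    (h0 : ∀ p ∈ P, 0 ≤ g p) (h1 : ∀ p ∈ P, g p ≤ 1)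
    (hcount : ∀ T ⊆ P, |((S.filter fun s => ∀ p ∈ T, bad p s).card : ℝ) - Y * ∏ p ∈ T, g p|
      ≤ N ^ T.card)
    {lev : ℕ → ℕ} {J : ℕ} (hlev : ∀ p ∈ P, lev p < J) {b : ℕ → ℕ} (hb : ∀ j, Even (b j))
    {δ : ℕ → ℝ} (hδ0 : ∀ j, 0 ≤ δ j)
    (hδ : ∀ j < J, symSum (P.filter fun p => lev p = j) (b j + 1) g ≤
      δ j * ∏ p ∈ P.filter (fun p => lev p = j), (1 - g p))
    (hδ1 : ∑ j ∈ Finset.range J, δ j ≤ 1 / 4) :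
    3 / 4 * (Y * ∏ p ∈ P, (1 - g p)) - (J + 1) * ∏ j ∈ Finset.range J,
        (((P.filter fun p => lev p = j).card : ℝ) * N + 1) ^ (b j + 1) ≤
      ((S.filter fun s => ∀ p ∈ P, ¬ bad p s).card : ℝ) ∧
    ((S.filter fun s => ∀ p ∈ P, ¬ bad p s).card : ℝ) ≤
      2 * (Y * ∏ p ∈ P, (1 - g p)) + ∏ j ∈ Finset.range J,
        (((P.filter fun p => lev p = j).card : ℝ) * N + 1) ^ (b j + 1) := by
  set Q : ℕ → Finset ℕ := fun j => P.filter fun p => lev p = j with hQ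
  set R : ℕ → ℝ := fun j => (((Q j).card : ℝ) * N + 1) ^ (b j + 1) with hR
  set x : σ → ℕ → ℝ := fun s p => if bad p s then 1 else 0 with hx
  have hQP : ∀ j, Q j ⊆ P := fun j => Finset.filter_subset _ _
  have hQd : ∀ i ∈ Finset.range J, ∀ j ∈ Finset.range J, i ≠ j → Disjoint (Q i) (Q j) := by
    intro i _ j _ hij
    rw [Finset.disjoint_left]
    intro p hp hp'
    exact hij ((Finset.mem_filter.1 hp).2.symm.trans (Finset.mem_filter.1 hp').2)
  have hbU : (Finset.range J).biUnion Q ⊆ P := Finset.biUnion_subset.2 fun j _ => hQP j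
  have hx0 : ∀ s, ∀ p, 0 ≤ x s p := fun s p => by simp only [hx]; split_ifs <;> norm_num
  have hx1 : ∀ s, ∀ p, x s p ≤ 1 := fun s p => by simp only [hx]; split_ifs <;> norm_num
  have hone : ∀ j, (1 : ℝ) ≤ (Q j).card * N + 1 := fun j => by
    have : 0 ≤ ((Q j).card : ℝ) * N := by positivity
    linarith
  have hU : ∀ j, IsSieveSum (Q j) N (R j) (bonferroni (Q j) (b j)) := fun j =>
    (isSieveSum_bonferroni (Q j) N (b j)).mono (Finset.Subset.refl _)
      ((sum_choose_mul_pow_le hN _ _).trans (pow_le_pow_right₀ (hone j) (Nat.le_succ _)))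
  have hE : ∀ j, IsSieveSum (Q j) N (R j) (symSum (Q j) (b j + 1)) := fun j =>
    (isSieveSum_symSum (Q j) N (b j + 1)).mono (Finset.Subset.refl _)
      (choose_mul_pow_le hN _ _)
  have hUp := ((IsSieveSum.prod hN (fun j _ => hU j) hQd).mono hbU le_rfl).abs_sum_sub_le hcount
  have hEp : ∀ j ∈ Finset.range J, IsSieveSum P N (∏ j ∈ Finset.range J, R j)
      fun h => symSum (Q j) (b j + 1) h *
        ∏ i ∈ (Finset.range J).erase j, bonferroni (Q i) (b i) h := by
    intro j hj
    have := (hE j).mul hN (IsSieveSum.prod (J := (Finset.range J).erase j) hN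
      (fun i _ => hU i) fun i hi k hk =>
        hQd i (Finset.mem_of_mem_erase hi) k (Finset.mem_of_mem_erase hk)) (by
      rw [Finset.disjoint_biUnion_right]
      exact fun i hi => hQd j hj i (Finset.mem_of_mem_erase hi) (Finset.ne_of_mem_erase hi).symm)
    refine this.mono (Finset.union_subset (hQP j) (Finset.biUnion_subset.2 fun j _ => hQP j)) ?_
    rw [Finset.mul_prod_erase _ _ hj]
  have hEs := fun j hj => (hEp j hj).abs_sum_sub_le hcount
  -- the indicator of the sifted set
  have hind : ((S.filter fun s => ∀ p ∈ P, ¬ bad p s).card : ℝ) =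
      ∑ s ∈ S, ∏ j ∈ Finset.range J, ∏ p ∈ Q j, (1 - x s p) := by
    rw [Finset.card_filter, Nat.cast_sum]
    refine Finset.sum_congr rfl fun s _ => ?_
    rw [prod_filter_levels hlev]
    have : ∀ p, 1 - x s p = if ¬ bad p s then 1 else 0 := fun p => by
      simp only [hx]; split_ifs <;> simp
    simp only [this]
    rw [Finset.prod_ite_zero]
    simp
  have hVx : ∀ s j, 0 ≤ ∏ p ∈ Q j, (1 - x s p) := fun s j =>
    Finset.prod_nonneg fun p _ => sub_nonneg.2 (hx1 s p)
  have hUx : ∀ s j, ∏ p ∈ Q j, (1 - x s p) ≤ bonferroni (Q j) (b j) (x s) := fun s j =>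
    prod_le_bonferroni (fun p _ => hx0 s p) (fun p _ => hx1 s p) (hb j)
  have hUx' : ∀ s j, bonferroni (Q j) (b j) (x s) - ∏ p ∈ Q j, (1 - x s p) ≤
      symSum (Q j) (b j + 1) (x s) := fun s j => by
    linarith [bonferroni_le_prod_add (fun p (_ : p ∈ Q j) => hx0 s p)
      (fun p _ => hx1 s p) (hb j)]
  -- the main terms
  set u : ℕ → ℝ := fun j => bonferroni (Q j) (b j) g with hu
  set v : ℕ → ℝ := fun j => ∏ p ∈ Q j, (1 - g p) with hv
  have hv0 : ∀ j, 0 ≤ v j := fun j =>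
    Finset.prod_nonneg fun p hp => sub_nonneg.2 (h1 p (hQP j hp))
  have huv : ∀ j, v j ≤ u j := fun j =>
    prod_le_bonferroni (fun p hp => h0 p (hQP j hp)) (fun p hp => h1 p (hQP j hp)) (hb j)
  have huv' : ∀ j ∈ Finset.range J, u j ≤ (1 + δ j) * v j := fun j hj => by
    have := bonferroni_le_prod_add (fun p hp => h0 p (hQP j hp))
      (fun p hp => h1 p (hQP j hp)) (hb j)
    have := hδ j (Finset.mem_range.1 hj)
    simp only [hu, hv]
    linarith
  have hV : ∏ j ∈ Finset.range J, v j = ∏ p ∈ P, (1 - g p) := prod_filter_levels hlev _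
  have hV0 : 0 ≤ ∏ p ∈ P, (1 - g p) := hV ▸ Finset.prod_nonneg fun j _ => hv0 j
  have hUV : ∏ p ∈ P, (1 - g p) ≤ ∏ j ∈ Finset.range J, u j :=
    hV ▸ Finset.prod_le_prod (fun j _ => hv0 j) fun j _ => huv j
  have hUV2 : ∏ j ∈ Finset.range J, u j ≤ 2 * ∏ p ∈ P, (1 - g p) := by
    have e1 : ∏ j ∈ Finset.range J, u j ≤ ∏ j ∈ Finset.range J, ((1 + δ j) * v j) :=
      Finset.prod_le_prod (fun j _ => (hv0 j).trans (huv j)) huv'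
    have e2 : ∏ j ∈ Finset.range J, (1 + δ j) ≤ 2 := by
      have : ∏ j ∈ Finset.range J, (1 + δ j) ≤ Real.exp (∑ j ∈ Finset.range J, δ j) := by
        rw [Real.exp_sum]
        exact Finset.prod_le_prod (fun j _ => by linarith [hδ0 j])
          fun j _ => by linarith [Real.add_one_le_exp (δ j)]
      refine this.trans ((Real.exp_le_exp.2 hδ1).trans ?_)
      have h3 := Real.exp_one_lt_d9
      have h4 : Real.exp (1 / 4) ^ 4 = Real.exp 1 := by
        rw [← Real.exp_nat_mul]; norm_num
      by_contra! h5
      have : (2 : ℝ) ^ 4 ≤ Real.exp (1 / 4) ^ 4 := pow_le_pow_left₀ (by norm_num) h5.le 4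
      rw [h4] at this
      linarith
    rw [Finset.prod_mul_distrib, hV] at e1
    exact e1.trans (mul_le_mul_of_nonneg_right e2 hV0)
  have hsum : ∑ j ∈ Finset.range J, symSum (Q j) (b j + 1) g *
      ∏ i ∈ (Finset.range J).erase j, u i ≤ 1 / 4 * ∏ j ∈ Finset.range J, u j := by
    have hP0 : 0 ≤ ∏ j ∈ Finset.range J, u j := hV0.trans hUV
    refine le_trans ?_ (mul_le_mul_of_nonneg_right hδ1 hP0)
    rw [Finset.sum_mul]
    refine Finset.sum_le_sum fun j hj => ?_
    have h5 : 0 ≤ ∏ i ∈ (Finset.range J).erase j, u i :=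
      Finset.prod_nonneg fun i _ => (hv0 i).trans (huv i)
    rw [← Finset.mul_prod_erase _ _ hj, ← mul_assoc]
    refine mul_le_mul_of_nonneg_right ?_ h5
    exact (hδ j (Finset.mem_range.1 hj)).trans (mul_le_mul_of_nonneg_left (huv j) (hδ0 j))
  constructor
  · have h6 : ∑ s ∈ S, ∏ j ∈ Finset.range J, bonferroni (Q j) (b j) (x s) -
        ∑ j ∈ Finset.range J, ∑ s ∈ S, symSum (Q j) (b j + 1) (x s) *
          ∏ i ∈ (Finset.range J).erase j, bonferroni (Q i) (b i) (x s) ≤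
        ((S.filter fun s => ∀ p ∈ P, ¬ bad p s).card : ℝ) := by
      rw [hind, Finset.sum_comm, ← Finset.sum_sub_distrib]
      refine Finset.sum_le_sum fun s _ => ?_
      have := prod_sub_prod_le (J := Finset.range J) (fun j _ => hVx s j) (fun j _ => hUx s j)
      have h7 : ∑ j ∈ Finset.range J, (bonferroni (Q j) (b j) (x s) - ∏ p ∈ Q j, (1 - x s p)) *
          ∏ i ∈ (Finset.range J).erase j, bonferroni (Q i) (b i) (x s) ≤
          ∑ j ∈ Finset.range J, symSum (Q j) (b j + 1) (x s) *
          ∏ i ∈ (Finset.range J).erase j, bonferroni (Q i) (b i) (x s) :=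
        Finset.sum_le_sum fun j _ => mul_le_mul_of_nonneg_right (hUx' s j)
          (Finset.prod_nonneg fun i _ => (hVx s i).trans (hUx s i))
      linarith
    have h8 : ∑ j ∈ Finset.range J, ∑ s ∈ S, symSum (Q j) (b j + 1) (x s) *
          ∏ i ∈ (Finset.range J).erase j, bonferroni (Q i) (b i) (x s) ≤
        Y * ∑ j ∈ Finset.range J, symSum (Q j) (b j + 1) g *
          ∏ i ∈ (Finset.range J).erase j, u i + J * ∏ j ∈ Finset.range J, R j := by
      have : (J : ℝ) * ∏ j ∈ Finset.range J, R j =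
          ∑ _j ∈ Finset.range J, ∏ j ∈ Finset.range J, R j := by simp
      rw [this, Finset.mul_sum, ← Finset.sum_add_distrib]
      refine Finset.sum_le_sum fun j hj => ?_
      have := (abs_le.1 (hEs j hj)).2
      simp only [hu]
      linarith
    have h9 := (abs_le.1 hUp).1
    have h10 := mul_le_mul_of_nonneg_left hsum hY
    have h11 := mul_le_mul_of_nonneg_left hUV hY
    simp only [hu] at h8 h10 h11
    linarith
  · have h6 : ((S.filter fun s => ∀ p ∈ P, ¬ bad p s).card : ℝ) ≤
        ∑ s ∈ S, ∏ j ∈ Finset.range J, bonferroni (Q j) (b j) (x s) := by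
      rw [hind]
      exact Finset.sum_le_sum fun s _ => Finset.prod_le_prod (fun j _ => hVx s j)
        fun j _ => hUx s j
    have h9 := (abs_le.1 hUp).2
    have h11 := mul_le_mul_of_nonneg_left hUV2 hY
    simp only [hu] at h11
    linarith

end BrunHooley

section PeriodicCount

open Classical in
/-- The number of `τ < X` satisfying `P`, as a real number. -/
noncomputable def cnt (X : ℕ) (P : ℕ → Prop) : ℝ := ((Finset.range X).filter P).card

theorem cnt_nonneg (X : ℕ) (P : ℕ → Prop) : 0 ≤ cnt X P := Nat.cast_nonneg _

theorem cnt_mono {X : ℕ} {P Q : ℕ → Prop} (h : ∀ τ < X, P τ → Q τ) : cnt X P ≤ cnt X Q := by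
  classical
  unfold cnt
  refine Nat.cast_le.2 (Finset.card_le_card fun τ hτ => ?_)
  rw [Finset.mem_filter, Finset.mem_range] at hτ ⊢
  exact ⟨hτ.1, h τ hτ.1 hτ.2⟩

theorem cnt_congr {X : ℕ} {P Q : ℕ → Prop} (h : ∀ τ < X, P τ ↔ Q τ) : cnt X P = cnt X Q :=
  le_antisymm (cnt_mono fun τ hτ => (h τ hτ).1) (cnt_mono fun τ hτ => (h τ hτ).2)

theorem cnt_le_of_le {X X' : ℕ} (h : X ≤ X') (P : ℕ → Prop) : cnt X P ≤ cnt X' P := by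
  classical
  unfold cnt
  exact Nat.cast_le.2 (Finset.card_le_card (Finset.filter_subset_filter _
    (Finset.range_subset_range.2 h)))

theorem cnt_add_period {M : ℕ} {P : ℕ → Prop} (hP : ∀ τ, P (M + τ) ↔ P τ) (Y : ℕ) :
    cnt (M + Y) P = cnt M P + cnt Y P := by
  classical
  simp only [cnt, ← Nat.count_eq_card_filter_range]
  rw [Nat.count_add]
  push_cast
  congr 2
  simp only [hP]

theorem cnt_mul_period_add {M : ℕ} {P : ℕ → Prop} (hP : ∀ τ, P (M + τ) ↔ P τ) (q Y : ℕ) :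
    cnt (M * q + Y) P = q * cnt M P + cnt Y P := by
  induction q with
  | zero => simp
  | succ q ih =>
    rw [show M * (q + 1) + Y = M + (M * q + Y) by ring, cnt_add_period hP, ih]
    push_cast
    ring

theorem abs_cnt_sub_le {M : ℕ} (hM : 0 < M) {P : ℕ → Prop} (hP : ∀ τ, P (M + τ) ↔ P τ) (X : ℕ) :
    |cnt X P - X * (cnt M P / M)| ≤ cnt M P := by
  have h := cnt_mul_period_add hP (X / M) (X % M)
  rw [Nat.div_add_mod] at h
  have hr := Nat.mod_lt X hM
  have h1 := cnt_le_of_le hr.le P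
  have h2 := cnt_nonneg (X % M) P
  have h3 := cnt_nonneg M P
  have hM' : (0 : ℝ) < M := by exact_mod_cast hM
  have h4 : (X : ℝ) = M * (X / M : ℕ) + (X % M : ℕ) := by exact_mod_cast (Nat.div_add_mod X M).symm
  have h5 : (X : ℝ) * (cnt M P / M) = (X / M : ℕ) * cnt M P + (X % M : ℕ) / M * cnt M P := by
    rw [h4]
    field_simp
  have h6 : ((X % M : ℕ) : ℝ) / M ≤ 1 := by
    rw [div_le_one hM']
    exact_mod_cast hr.le
  have h7 : 0 ≤ ((X % M : ℕ) : ℝ) / M := by positivity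
  rw [h, h5, abs_le]
  constructor <;> nlinarith

theorem cnt_and_mul {m n : ℕ} (hm : 0 < m) (hn : 0 < n) (hmn : m.Coprime n) {P Q : ℕ → Prop}
    (hP : ∀ τ, P (τ % m) ↔ P τ) (hQ : ∀ τ, Q (τ % n) ↔ Q τ) :
    cnt (m * n) (fun τ => P τ ∧ Q τ) = cnt m P * cnt n Q := by
  classical
  unfold cnt
  rw [← Nat.cast_mul, ← Finset.card_product, Nat.cast_inj]
  refine Finset.card_bij (fun τ _ => (τ % m, τ % n)) ?_ ?_ ?_
  · intro τ hτ
    simp only [Finset.mem_filter, Finset.mem_range, Finset.mem_product] at hτ ⊢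
    exact ⟨⟨Nat.mod_lt _ hm, (hP τ).2 hτ.2.1⟩, Nat.mod_lt _ hn, (hQ τ).2 hτ.2.2⟩
  · intro a ha b hb h
    simp only [Finset.mem_filter, Finset.mem_range] at ha hb
    rw [Prod.mk.injEq] at h
    have := (Nat.modEq_and_modEq_iff_modEq_mul hmn).1 ⟨h.1, h.2⟩
    exact this.eq_of_lt_of_lt ha.1 hb.1
  · rintro ⟨u, v⟩ huv
    simp only [Finset.mem_filter, Finset.mem_range, Finset.mem_product] at huv
    obtain ⟨⟨hu, hPu⟩, hv, hQv⟩ := huv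
    let k := Nat.chineseRemainder hmn u v
    have h1 : (k : ℕ) % m = u := by rw [k.2.1, Nat.mod_eq_of_lt hu]
    have h2 : (k : ℕ) % n = v := by rw [k.2.2, Nat.mod_eq_of_lt hv]
    refine ⟨k, ?_, by rw [h1, h2]⟩
    simp only [Finset.mem_filter, Finset.mem_range]
    refine ⟨Nat.chineseRemainder_lt_mul hmn u v hm.ne' hn.ne', ?_, ?_⟩
    · rwa [← hP, h1]
    · rwa [← hQ, h2]

theorem cnt_forall_prod {ι : Type*} {I : Finset ι} {m : ι → ℕ} {C : ι → ℕ → Prop}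
    (hm : ∀ i ∈ I, 0 < m i) (hco : ∀ i ∈ I, ∀ j ∈ I, i ≠ j → (m i).Coprime (m j))
    (hC : ∀ i ∈ I, ∀ τ, C i (m i + τ) ↔ C i τ) :
    (∀ τ, (∀ i ∈ I, C i ((∏ i ∈ I, m i) + τ)) ↔ ∀ i ∈ I, C i τ) ∧
      cnt (∏ i ∈ I, m i) (fun τ => ∀ i ∈ I, C i τ) = ∏ i ∈ I, cnt (m i) (C i) := by
  classical
  have hmul : ∀ {m : ℕ} {P : ℕ → Prop}, (∀ τ, P (m + τ) ↔ P τ) →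
      ∀ q τ, P (m * q + τ) ↔ P τ := by
    intro m P h q τ
    induction q with
    | zero => simp
    | succ q ih => rw [show m * (q + 1) + τ = m + (m * q + τ) by ring, h, ih]
  have hmod : ∀ {m : ℕ} {P : ℕ → Prop}, (∀ τ, P (m + τ) ↔ P τ) → ∀ τ, P (τ % m) ↔ P τ := by
    intro m P h τ
    conv_rhs => rw [← Nat.div_add_mod τ m]
    exact (hmul h _ _).symm
  induction I using Finset.induction_on with
  | empty => simp [cnt]
  | insert a I ha ih =>
    obtain ⟨ih1, ih2⟩ := ih (fun i hi => hm i (Finset.mem_insert_of_mem hi))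
      (fun i hi j hj => hco i (Finset.mem_insert_of_mem hi) j (Finset.mem_insert_of_mem hj))
      fun i hi => hC i (Finset.mem_insert_of_mem hi)
    have hCa := hC a (Finset.mem_insert_self _ _)
    have hcop : (m a).Coprime (∏ i ∈ I, m i) := Nat.Coprime.prod_right fun i hi =>
      hco a (Finset.mem_insert_self _ _) i (Finset.mem_insert_of_mem hi) fun h => ha (h ▸ hi)
    simp only [Finset.prod_insert ha, Finset.forall_mem_insert]
    constructor
    · intro τ
      refine and_congr (hmul hCa _ _) ?_
      have := hmul (P := fun τ => ∀ i ∈ I, C i τ) ih1 (m a) τ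
      rwa [mul_comm] at this
    · rw [cnt_and_mul (hm a (Finset.mem_insert_self _ _))
        (Finset.prod_pos fun i hi => hm i (Finset.mem_insert_of_mem hi)) hcop (hmod hCa)
        (hmod (P := fun τ => ∀ i ∈ I, C i τ) ih1), ih2]

theorem abs_cnt_forall_sub_le {ι : Type*} {I : Finset ι} {m : ι → ℕ} {C : ι → ℕ → Prop}
    (hm : ∀ i ∈ I, 0 < m i) (hco : ∀ i ∈ I, ∀ j ∈ I, i ≠ j → (m i).Coprime (m j))
    (hC : ∀ i ∈ I, ∀ τ, C i (m i + τ) ↔ C i τ) (X : ℕ) :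
    |cnt X (fun τ => ∀ i ∈ I, C i τ) - X * ∏ i ∈ I, (cnt (m i) (C i) / m i)| ≤
      ∏ i ∈ I, cnt (m i) (C i) := by
  obtain ⟨h1, h2⟩ := cnt_forall_prod hm hco hC
  have := abs_cnt_sub_le (P := fun τ => ∀ i ∈ I, C i τ) (Finset.prod_pos hm) h1 X
  rwa [h2, Nat.cast_prod, ← Finset.prod_div_distrib] at this

theorem cnt_dvd_linear {m a : ℕ} (hm : 0 < m) (ha : a.Coprime m) (b : ℕ) :
    cnt m (fun τ => m ∣ a * τ + b) = 1 := by
  classical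
  unfold cnt
  rw [← Nat.cast_one, Nat.cast_inj, Finset.card_eq_one]
  have : NeZero m := ⟨hm.ne'⟩
  obtain ⟨u, hu⟩ : ∃ u : ZMod m, (a : ZMod m) * u = 1 :=
    ⟨(a : ZMod m)⁻¹, ZMod.coe_mul_inv_eq_one a ha⟩
  refine ⟨(-(b : ZMod m) * u).val, Finset.ext fun τ => ?_⟩
  simp only [Finset.mem_filter, Finset.mem_range, Finset.mem_singleton, ← ZMod.natCast_eq_zero_iff]
  push_cast
  constructor
  · rintro ⟨h1, h2⟩
    have : (τ : ZMod m) = -(b : ZMod m) * u := by linear_combination u * h2 - τ * hu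
    rw [← this, ZMod.val_natCast, Nat.mod_eq_of_lt h1]
  · rintro rfl
    refine ⟨ZMod.val_lt _, ?_⟩
    rw [ZMod.natCast_zmod_val]
    linear_combination (-(b : ZMod m)) * hu

theorem dvd_linear_add_period (m a b τ : ℕ) : m ∣ a * (m + τ) + b ↔ m ∣ a * τ + b := by
  rw [show a * (m + τ) + b = m * a + (a * τ + b) by ring]
  exact (Nat.dvd_add_right (Dvd.intro _ rfl))

end PeriodicCount

section PrimeSums

/-- The doubly logarithmic scale of a prime: `2 ^ 2 ^ l ≤ p < 2 ^ 2 ^ (l + 1)`. -/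
def level (p : ℕ) : ℕ := Nat.log 2 (Nat.log 2 p)

theorem lt_two_pow_two_pow_level_succ (p : ℕ) : p < 2 ^ 2 ^ (level p + 1) :=
  (Nat.lt_pow_succ_log_self one_lt_two p).trans_le
    (Nat.pow_le_pow_right two_pos (Nat.lt_pow_succ_log_self one_lt_two _))

theorem two_pow_two_pow_level_le {p : ℕ} (hp : 2 ≤ p) : 2 ^ 2 ^ level p ≤ p :=
  (Nat.pow_le_pow_right two_pos (Nat.pow_log_le_self 2
    (Nat.log_pos one_lt_two hp).ne')).trans (Nat.pow_log_le_self 2 (by omega))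

theorem level_lt_iff {p J : ℕ} (hp : 2 ≤ p) : level p < J ↔ p < 2 ^ 2 ^ J := by
  unfold level
  rw [Nat.log_lt_iff_lt_pow one_lt_two (Nat.log_pos one_lt_two hp).ne',
    Nat.log_lt_iff_lt_pow one_lt_two (by omega)]

theorem card_primes_dyadic_mul_le {P : Finset ℕ} {i : ℕ}
    (hP : ∀ p ∈ P, p.Prime ∧ Nat.log 2 p = i) : P.card * i ≤ 4 * 2 ^ i := by
  have h1 : ∏ p ∈ P, p ≤ 4 ^ (2 ^ (i + 1)) := by
    refine le_trans ?_ (primorial_le_four_pow _)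
    unfold primorial
    refine Finset.prod_le_prod_of_subset_of_one_le' (fun p hp => ?_) fun p hp _ =>
      (Finset.mem_filter.1 hp).2.one_lt.le
    rw [Finset.mem_filter, Finset.mem_range, Nat.lt_succ_iff]
    refine ⟨?_, (hP p hp).1⟩
    have := Nat.lt_pow_succ_log_self one_lt_two p
    rw [(hP p hp).2] at this
    exact this.le
  have h2 : (2 ^ i) ^ P.card ≤ ∏ p ∈ P, p := Finset.pow_card_le_prod _ _ _ fun p hp => by
    have := Nat.pow_log_le_self 2 (hP p hp).1.ne_zero
    rwa [(hP p hp).2] at this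
  have h3 : 2 ^ (i * P.card) ≤ 2 ^ (2 * 2 ^ (i + 1)) := by
    rw [pow_mul, pow_mul]
    exact h2.trans h1
  have := (Nat.pow_le_pow_iff_right one_lt_two).1 h3
  rw [pow_succ] at this
  linarith

theorem sum_inv_dyadic_le {P : Finset ℕ} {i : ℕ} (hi : 0 < i)
    (hP : ∀ p ∈ P, p.Prime ∧ Nat.log 2 p = i) : ∑ p ∈ P, (1 / p : ℝ) ≤ 4 / i := by
  have h1 : ∑ p ∈ P, (1 / p : ℝ) ≤ P.card • (1 / 2 ^ i : ℝ) := by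
    refine Finset.sum_le_card_nsmul _ _ _ fun p hp => ?_
    have := Nat.pow_log_le_self 2 (hP p hp).1.ne_zero
    rw [(hP p hp).2] at this
    have : ((2 ^ i : ℕ) : ℝ) ≤ p := by exact_mod_cast this
    push_cast at this
    gcongr
  refine h1.trans ?_
  have h2 : ((P.card * i : ℕ) : ℝ) ≤ (4 * 2 ^ i : ℕ) := by
    exact_mod_cast card_primes_dyadic_mul_le hP
  push_cast at h2
  have : (0 : ℝ) < i := by exact_mod_cast hi
  rw [nsmul_eq_mul, mul_one_div, div_le_div_iff₀ (by positivity) this]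
  exact h2

theorem sum_inv_level_le {P : Finset ℕ} {l : ℕ} (hP : ∀ p ∈ P, p.Prime ∧ level p = l) :
    ∑ p ∈ P, (1 / p : ℝ) ≤ 4 := by
  have hmap : ∀ p ∈ P, Nat.log 2 p ∈ Finset.Ico (2 ^ l) (2 ^ (l + 1)) := by
    intro p hp
    obtain ⟨h1, rfl⟩ := hP p hp
    rw [Finset.mem_Ico]
    exact ⟨Nat.pow_log_le_self 2 (Nat.log_pos one_lt_two h1.two_le).ne',
      Nat.lt_pow_succ_log_self one_lt_two _⟩
  rw [← Finset.sum_fiberwise_of_maps_to hmap]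
  have h1 : ∀ i ∈ Finset.Ico (2 ^ l) (2 ^ (l + 1)),
      ∑ p ∈ P with Nat.log 2 p = i, (1 / p : ℝ) ≤ 4 / 2 ^ l := by
    intro i hi
    rw [Finset.mem_Ico] at hi
    have h0 : 0 < i := lt_of_lt_of_le (by positivity) hi.1
    refine (sum_inv_dyadic_le h0 fun p hp => ?_).trans ?_
    · rw [Finset.mem_filter] at hp
      exact ⟨(hP p hp.1).1, hp.2⟩
    · have : ((2 ^ l : ℕ) : ℝ) ≤ i := by exact_mod_cast hi.1
      push_cast at this
      gcongr
  refine (Finset.sum_le_card_nsmul _ _ _ h1).trans ?_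
  rw [Nat.card_Ico, pow_succ, show 2 ^ l * 2 - 2 ^ l = 2 ^ l by omega, nsmul_eq_mul]
  push_cast
  field_simp
  norm_num

theorem sum_inv_le_of_level_lt {P : Finset ℕ} {J : ℕ} (hP : ∀ p ∈ P, p.Prime ∧ level p < J) :
    ∑ p ∈ P, (1 / p : ℝ) ≤ 4 * J := by
  rw [← Finset.sum_fiberwise_of_maps_to (t := Finset.range J) (g := level)
    fun p hp => Finset.mem_range.2 (hP p hp).2]
  refine (Finset.sum_le_card_nsmul _ _ 4 fun l _ =>
    sum_inv_level_le (l := l) fun p hp => ?_).trans ?_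
  · rw [Finset.mem_filter] at hp
    exact ⟨(hP p hp.1).1, hp.2⟩
  · simp [mul_comm]

theorem sum_inv_le_of_level_Ico {P : Finset ℕ} {J K : ℕ}
    (hP : ∀ p ∈ P, p.Prime ∧ J ≤ level p ∧ level p < J + K) :
    ∑ p ∈ P, (1 / p : ℝ) ≤ 4 * K := by
  rw [← Finset.sum_fiberwise_of_maps_to (t := Finset.Ico J (J + K)) (g := level)
    fun p hp => Finset.mem_Ico.2 (hP p hp).2]
  refine (Finset.sum_le_card_nsmul _ _ 4 fun l _ =>
    sum_inv_level_le (l := l) fun p hp => ?_).trans ?_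
  · rw [Finset.mem_filter] at hp
    exact ⟨(hP p hp.1).1, hp.2⟩
  · simp [mul_comm]

theorem sum_log_div_le_of_level_lt {P : Finset ℕ} {J : ℕ}
    (hP : ∀ p ∈ P, p.Prime ∧ level p < J) :
    ∑ p ∈ P, Real.log p / p ≤ 8 * Real.log (2 ^ 2 ^ J) := by
  rw [← Finset.sum_fiberwise_of_maps_to (t := Finset.range J) (g := level)
    fun p hp => Finset.mem_range.2 (hP p hp).2]
  have h1 : ∀ l ∈ Finset.range J, ∑ p ∈ P with level p = l, Real.log p / p ≤
      8 * Real.log 2 * 2 ^ l := by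
    intro l _
    have h2 : ∑ p ∈ P with level p = l, Real.log p / p ≤
        ∑ p ∈ P with level p = l, (2 * Real.log 2 * 2 ^ l) * (1 / p) := by
      refine Finset.sum_le_sum fun p hp => ?_
      obtain ⟨hpP, rfl⟩ := Finset.mem_filter.1 hp
      have h3 : (p : ℝ) ≤ 2 ^ 2 ^ (level p + 1) := by
        exact_mod_cast (lt_two_pow_two_pow_level_succ p).le
      have h4 := Real.log_le_log (by exact_mod_cast (hP p hpP).1.pos) h3
      rw [Real.log_pow, pow_succ] at h4
      push_cast at h4
      rw [mul_one_div]
      gcongr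
      linarith
    refine h2.trans ?_
    rw [← Finset.mul_sum]
    have := sum_inv_level_le (P := P.filter fun p => level p = l) (l := l) fun p hp => by
      rw [Finset.mem_filter] at hp
      exact ⟨(hP p hp.1).1, hp.2⟩
    have h5 : 0 ≤ 2 * Real.log 2 * 2 ^ l := by positivity
    nlinarith
  refine (Finset.sum_le_sum h1).trans ?_
  rw [← Finset.mul_sum, geom_sum_eq (by norm_num), Real.log_pow]
  push_cast
  have := Real.log_nonneg (x := 2) (by norm_num)
  norm_num
  nlinarith

theorem sum_inv_sq_le {P : Finset ℕ} {z : ℕ} (hz : 0 < z) (hP : ∀ p ∈ P, z < p) :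
    ∑ p ∈ P, (1 / (p : ℝ) ^ 2) ≤ 1 / (z : ℝ) := by
  obtain ⟨n, hn⟩ := P.exists_nat_subset_range
  have hsub : P ⊆ Finset.Ioc z (max z n) := fun p hp => by
    rw [Finset.mem_Ioc]
    exact ⟨hP p hp, (Finset.mem_range.1 (hn hp)).le.trans (le_max_right _ _)⟩
  have h1 := sum_Ioc_inv_sq_le_sub (α := ℝ) hz.ne' (le_max_left z n)
  have h2 : (0 : ℝ) ≤ ((max z n : ℕ) : ℝ)⁻¹ := by positivity
  refine (Finset.sum_le_sum_of_subset_of_nonneg hsub fun _ _ _ => by positivity).trans ?_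
  simp only [one_div]
  linarith

end PrimeSums

section Forms

/-- Linear forms `a i * τ + b i` whose values are free of primes dividing `A` and pairwise
share no prime, where `A` is divisible by every prime up to `4 * N ^ 2`. -/
structure AdmissibleForms (N A : ℕ) (a b : Fin N → ℕ) : Prop where
  pos : 0 < A
  not_dvd : ∀ p, p.Prime → p ∣ A → ∀ i τ, ¬ p ∣ a i * τ + b i
  coeff : ∀ p, p.Prime → ¬ p ∣ A → ∀ i, ¬ p ∣ a i
  disjoint : ∀ p, p.Prime → ¬ p ∣ A → ∀ i j τ, i ≠ j → p ∣ a i * τ + b i → ¬ p ∣ a j * τ + b j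
  small : ∀ p, p.Prime → p ≤ 4 * N ^ 2 → p ∣ A

/-- The primes below `2 ^ 2 ^ J` not dividing `A`. -/
def sievePrimes (A J : ℕ) : Finset ℕ :=
  (Finset.range (2 ^ 2 ^ J)).filter fun p => p.Prime ∧ ¬ p ∣ A

theorem mem_sievePrimes {A J p : ℕ} :
    p ∈ sievePrimes A J ↔ p.Prime ∧ level p < J ∧ ¬ p ∣ A := by
  rw [sievePrimes, Finset.mem_filter, Finset.mem_range]
  constructor
  · rintro ⟨h1, h2, h3⟩
    exact ⟨h2, (level_lt_iff h2.two_le).2 h1, h3⟩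
  · rintro ⟨h1, h2, h3⟩
    exact ⟨(level_lt_iff h1.two_le).1 h2, h1, h3⟩

variable {N A : ℕ} {a b : Fin N → ℕ}

/-- The event excluded at the prime `p`, given the prescribed divisors `D`. -/
def Bad (a b : Fin N → ℕ) (D : Finset ℕ) (β : ℕ → Fin N) (p τ : ℕ) : Prop :=
  if p ∈ D then p ^ 2 ∣ a (β p) * τ + b (β p) else ∃ i, p ∣ a i * τ + b i

/-- Every `q ∈ D` divides its prescribed form, and no excluded event occurs at `p ∈ P`. -/
def Sifted (a b : Fin N → ℕ) (D : Finset ℕ) (β : ℕ → Fin N) (P : Finset ℕ) (τ : ℕ) : Prop :=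
  (∀ q ∈ D, q ∣ a (β q) * τ + b (β q)) ∧ ∀ p ∈ P, ¬ Bad a b D β p τ

/-- The density of the excluded event at `p`. -/
noncomputable def badDensity (N : ℕ) (D : Finset ℕ) (p : ℕ) : ℝ :=
  if p ∈ D then 1 / p else N / p

theorem AdmissibleForms.lt_of_mem (h : AdmissibleForms N A a b) {p : ℕ} (hp : p.Prime)
    (hpA : ¬ p ∣ A) : 4 * N ^ 2 < p := by
  by_contra! h1
  exact hpA (h.small p hp h1)

theorem AdmissibleForms.cnt_exists_dvd (h : AdmissibleForms N A a b) {p : ℕ} (hp : p.Prime)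
    (hpA : ¬ p ∣ A) : cnt p (fun τ => ∃ i, p ∣ a i * τ + b i) = N := by
  classical
  have h1 : ∀ i, cnt p (fun τ => p ∣ a i * τ + b i) = 1 := fun i =>
    cnt_dvd_linear hp.pos ((Nat.Prime.coprime_iff_not_dvd hp).2 (h.coeff p hp hpA i)).symm _
  unfold cnt at h1 ⊢
  have h2 : (Finset.range p).filter (fun τ => ∃ i, p ∣ a i * τ + b i) =
      Finset.univ.biUnion fun i => (Finset.range p).filter fun τ => p ∣ a i * τ + b i := by
    ext τ; simp
  have h3 := Finset.card_biUnion (s := (Finset.univ : Finset (Fin N)))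
    (t := fun i => (Finset.range p).filter fun τ => p ∣ a i * τ + b i) (by
      intro i _ j _ hij
      rw [Function.onFun, Finset.disjoint_left]
      intro τ hτ hτ'
      exact h.disjoint p hp hpA i j τ hij (Finset.mem_filter.1 hτ).2 (Finset.mem_filter.1 hτ').2)
  rw [← h2] at h3
  have h4 : (((Finset.range p).filter (fun τ => ∃ i, p ∣ a i * τ + b i)).card : ℝ) =
      ∑ i : Fin N, (((Finset.range p).filter fun τ => p ∣ a i * τ + b i).card : ℝ) := by
    exact_mod_cast h3
  convert h4
  rw [Finset.sum_congr rfl fun i _ => ?_, Finset.sum_const, Finset.card_univ, Fintype.card_fin,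
    nsmul_eq_mul, mul_one]
  convert h1 i

theorem AdmissibleForms.abs_cnt_sub_le (h : AdmissibleForms N A a b) (hN : 1 ≤ N)
    {D T : Finset ℕ} (β : ℕ → Fin N) (hD : ∀ p ∈ D, p.Prime ∧ ¬ p ∣ A)
    (hT : ∀ p ∈ T, p.Prime ∧ ¬ p ∣ A) (X : ℕ) :
    |cnt X (fun τ => (∀ q ∈ D, q ∣ a (β q) * τ + b (β q)) ∧ ∀ p ∈ T, Bad a b D β p τ) -
      X / (∏ q ∈ D, (q : ℝ)) * ∏ p ∈ T, badDensity N D p| ≤ (N : ℝ) ^ T.card := by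
  have hN' : (1 : ℝ) ≤ N := by exact_mod_cast hN
  have hI : ∀ p ∈ D ∪ T, p.Prime ∧ ¬ p ∣ A := fun p hp =>
    (Finset.mem_union.1 hp).elim (hD p) (hT p)
  set m : ℕ → ℕ := fun q => if q ∈ D ∧ q ∈ T then q ^ 2 else q with hm
  set C : ℕ → ℕ → Prop := fun q τ =>
    if q ∈ D then m q ∣ a (β q) * τ + b (β q) else ∃ i, q ∣ a i * τ + b i with hC
  have hm0 : ∀ p ∈ D ∪ T, 0 < m p := fun p hp => by
    have := (hI p hp).1.pos
    simp only [hm]; split_ifs <;> positivity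
  have hcnt : ∀ p ∈ D ∪ T, cnt (m p) (C p) = if p ∈ D then 1 else (N : ℝ) := by
    intro p hp
    by_cases hpD : p ∈ D
    · simp only [hC, hpD, if_true]
      refine cnt_dvd_linear (hm0 p hp) ?_ _
      have := ((Nat.Prime.coprime_iff_not_dvd (hI p hp).1).2
        (h.coeff p (hI p hp).1 (hI p hp).2 (β p))).symm
      simp only [hm]; split_ifs
      · exact this.pow_right 2
      · exact this
    · simp only [hC, hm, hpD, if_false, false_and]
      exact h.cnt_exists_dvd (hI p hp).1 (hI p hp).2
  have key := abs_cnt_forall_sub_le (I := D ∪ T) (m := m) (C := C) hm0 ?_ ?_ X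
  · rw [Finset.prod_congr rfl hcnt] at key
    refine le_trans (le_of_eq ?_) (key.trans ?_)
    · congr 2
      · refine cnt_congr fun τ _ => ⟨fun ⟨h1, h2⟩ q hq => ?_,
          fun h1 => ⟨fun q hq => ?_, fun p hp => ?_⟩⟩
        · simp only [hC, hm]
          by_cases hqD : q ∈ D
          · by_cases hqT : q ∈ T
            · have := h2 q hqT
              simp only [Bad, hqD, if_true] at this
              simpa [hqD, hqT] using this
            · simpa [hqD, hqT] using h1 q hqD
          · have := h2 q ((Finset.mem_union.1 hq).resolve_left hqD)
            simpa [Bad, hqD] using this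
        · have := h1 q (Finset.mem_union_left _ hq)
          simp only [hC, hm, hq, if_true, true_and] at this
          split_ifs at this
          · exact (dvd_pow_self q two_ne_zero).trans this
          · exact this
        · have := h1 p (Finset.mem_union_right _ hp)
          simp only [hC, hm, hp, and_true] at this
          unfold Bad
          split_ifs with hpD <;> simpa [hpD] using this
      · have h3 : ∏ p ∈ D ∪ T, (cnt (m p) (C p) / m p) =
            ∏ p ∈ D ∪ T, ((if p ∈ D then (1 / p : ℝ) else 1) *
              if p ∈ T then badDensity N D p else 1) := by
          refine Finset.prod_congr rfl fun p hp => ?_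
          rw [hcnt p hp]
          simp only [hm, badDensity]
          by_cases hpD : p ∈ D
          · by_cases hpT : p ∈ T
            · simp only [hpD, hpT, if_true, and_true]
              push_cast
              ring
            · simp [hpD, hpT]
          · have hpT := (Finset.mem_union.1 hp).resolve_left hpD
            simp [hpD, hpT]
        rw [h3, Finset.prod_mul_distrib, Finset.prod_ite_mem, Finset.prod_ite_mem,
          Finset.inter_eq_right.2 Finset.subset_union_left,
          Finset.inter_eq_right.2 Finset.subset_union_right, Finset.prod_div_distrib]
        simp only [Finset.prod_const_one]
        ring
    · have h4 : ∏ p ∈ D ∪ T, (if p ∈ D then 1 else (N : ℝ)) ≤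
          ∏ p ∈ D ∪ T, (if p ∈ T then (N : ℝ) else 1) := by
        refine Finset.prod_le_prod (fun p _ => by split_ifs <;> linarith) fun p hp => ?_
        rcases Finset.mem_union.1 hp with hp | hp
        · simp only [hp, if_true]; split_ifs <;> linarith
        · simp only [hp, if_true]; split_ifs <;> linarith
      refine h4.trans (le_of_eq ?_)
      rw [Finset.prod_ite_mem, Finset.inter_eq_right.2 Finset.subset_union_right,
        Finset.prod_const]
  · intro p hp q hq hpq
    have := (Nat.coprime_primes (hI p hp).1 (hI q hq).1).2 hpq
    simp only [hm]
    split_ifs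
    · exact this.pow 2 2
    · exact this.pow_left 2
    · exact this.pow_right 2
    · exact this
  · intro p hp τ
    by_cases hpD : p ∈ D
    · simp only [hC, hpD, if_true]
      exact dvd_linear_add_period _ _ _ _
    · simp only [hC, hpD, if_false, hm, false_and]
      exact exists_congr fun i => dvd_linear_add_period _ _ _ _

end Forms

section SiftedBounds

variable {N A : ℕ} {a b : Fin N → ℕ}

theorem exp_neg_le_one_sub {x : ℝ} (h0 : 0 ≤ x) (h1 : x ≤ 1 / 2) :
    Real.exp (-(x + 2 * x ^ 2)) ≤ 1 - x := by
  have h2 : 0 < 1 - x := by linarith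
  rw [← Real.le_log_iff_exp_le h2]
  refine le_trans ?_ (Real.one_sub_inv_le_log_of_pos h2)
  have h3 : (1 - x)⁻¹ ≤ 1 + x + 2 * x ^ 2 := by
    rw [inv_le_iff_one_le_mul₀ h2]
    nlinarith [mul_nonneg h0 h0, mul_nonneg (mul_nonneg h0 h0) (by linarith : 0 ≤ 1 - 2 * x)]
  linarith

theorem sum_level_exponent_le (c J : ℕ) :
    ∑ j ∈ Finset.range J, 2 ^ (j + 2) * (c + 2 * (J - j)) ≤ 2 ^ J * (4 * c + 16) := by
  induction J with
  | zero => simp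
  | succ J ih =>
    have h1 : ∑ j ∈ Finset.range J, 2 ^ (j + 2) * (c + 2 * (J + 1 - j)) =
        ∑ j ∈ Finset.range J, 2 ^ (j + 2) * (c + 2 * (J - j)) +
          8 * ∑ j ∈ Finset.range J, 2 ^ j := by
      rw [Finset.mul_sum, ← Finset.sum_add_distrib]
      refine Finset.sum_congr rfl fun j hj => ?_
      have := Finset.mem_range.1 hj
      rw [show J + 1 - j = J - j + 1 by omega]
      ring
    have h2 : ∑ j ∈ Finset.range J, 2 ^ j ≤ 2 ^ J := by
      have := Nat.geomSum_lt (m := 2) (n := J) (s := Finset.range J) le_rfl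
        fun k hk => Finset.mem_range.1 hk
      exact this.le
    rw [Finset.sum_range_succ, h1, Nat.add_sub_cancel_left]
    calc _ ≤ 2 ^ J * (4 * c + 16) + 8 * 2 ^ J + 2 ^ (J + 2) * (c + 2 * 1) := by gcongr
      _ = _ := by ring

theorem exp_twentyfour_le : Real.exp 24 ≤ 4 ^ 20 := by
  have h : Real.exp 24 = Real.exp 1 ^ 24 := by rw [← Real.exp_nat_mul]; norm_num
  rw [h]
  calc Real.exp 1 ^ 24 ≤ (2.7182818286 : ℝ) ^ 24 := by
        gcongr
        exact Real.exp_one_lt_d9.le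
    _ ≤ 4 ^ 20 := by norm_num

theorem AdmissibleForms.badDensity_bounds (h : AdmissibleForms N A a b) (hN : 1 ≤ N)
    (D : Finset ℕ) {p : ℕ} (hp : p.Prime) (hpA : ¬ p ∣ A) :
    0 ≤ badDensity N D p ∧ badDensity N D p ≤ N / p ∧ (N : ℝ) / p ≤ 1 / 2 := by
  have h1 := h.lt_of_mem hp hpA
  have hp0 : (0 : ℝ) < p := by exact_mod_cast hp.pos
  have hN' : (1 : ℝ) ≤ N := by exact_mod_cast hN
  have h2 : (2 * N : ℝ) ≤ p := by
    have : 2 * N ≤ p := by nlinarith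
    exact_mod_cast this
  refine ⟨?_, ?_, ?_⟩
  · unfold badDensity; split_ifs <;> positivity
  · unfold badDensity; split_ifs
    · gcongr
    · exact le_rfl
  · rw [div_le_div_iff₀ hp0 two_pos]; linarith

theorem AdmissibleForms.sifted_bounds (h : AdmissibleForms N A a b) (hN : 1 ≤ N)
    {D : Finset ℕ} (β : ℕ → Fin N) (hD : ∀ p ∈ D, p.Prime ∧ ¬ p ∣ A) (J X : ℕ) :
    3 / 4 * (X / (∏ q ∈ D, (q : ℝ)) * ∏ p ∈ sievePrimes A J, (1 - badDensity N D p)) -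
        (J + 1) * (2 ^ 2 ^ J) ^ (100 * N) ≤ cnt X (Sifted a b D β (sievePrimes A J)) ∧
    cnt X (Sifted a b D β (sievePrimes A J)) ≤
      2 * (X / (∏ q ∈ D, (q : ℝ)) * ∏ p ∈ sievePrimes A J, (1 - badDensity N D p)) +
        (2 ^ 2 ^ J) ^ (100 * N) := by
  classical
  set P := sievePrimes A J with hP
  set g := badDensity N D with hg
  have hPm : ∀ p ∈ P, p.Prime ∧ level p < J ∧ ¬ p ∣ A := fun p hp => mem_sievePrimes.1 hp
  have hgb : ∀ p ∈ P, 0 ≤ g p ∧ g p ≤ N / p ∧ (N : ℝ) / p ≤ 1 / 2 := fun p hp =>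
    h.badDensity_bounds hN D (hPm p hp).1 (hPm p hp).2.2
  set S := (Finset.range X).filter fun τ => ∀ q ∈ D, q ∣ a (β q) * τ + b (β q) with hS
  set B : ℕ → ℕ := fun j => 20 * N + 2 * (J - j) with hB
  set δ : ℕ → ℝ := fun j => 1 / 4 ^ (2 * (J - j) + 1) with hδ
  set Q : ℕ → Finset ℕ := fun j => P.filter fun p => level p = j with hQ
  have hcnt : ∀ T ⊆ P, |((S.filter fun τ => ∀ p ∈ T, Bad a b D β p τ).card : ℝ) -
      X / (∏ q ∈ D, (q : ℝ)) * ∏ p ∈ T, g p| ≤ (N : ℝ) ^ T.card := by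
    intro T hT
    have := h.abs_cnt_sub_le hN β hD
      (fun p hp => ⟨(hPm p (hT hp)).1, (hPm p (hT hp)).2.2⟩) (T := T) X
    unfold cnt at this
    rw [hS, Finset.filter_filter]
    convert this
  have hcard : ((S.filter fun τ => ∀ p ∈ P, ¬ Bad a b D β p τ).card : ℝ) =
      cnt X (Sifted a b D β P) := by
    unfold cnt Sifted
    rw [hS, Finset.filter_filter]
    congr
  have hsumg : ∀ j, ∑ p ∈ Q j, g p ≤ 4 * N := by
    intro j
    have h1 := sum_inv_level_le (P := Q j) (l := j) fun p hp => by
      rw [hQ, Finset.mem_filter] at hp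
      exact ⟨(hPm p hp.1).1, hp.2⟩
    calc ∑ p ∈ Q j, g p ≤ ∑ p ∈ Q j, (N : ℝ) * (1 / p) := Finset.sum_le_sum fun p hp => by
          rw [mul_one_div]; exact (hgb p (Finset.mem_filter.1 hp).1).2.1
      _ = N * ∑ p ∈ Q j, (1 / p : ℝ) := by rw [Finset.mul_sum]
      _ ≤ N * 4 := by gcongr
      _ = 4 * N := by ring
  have hδle : ∀ j < J, symSum (P.filter fun p => level p = j) (B j + 1) g ≤
      δ j * ∏ p ∈ P.filter (fun p => level p = j), (1 - g p) := by
    intro j _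
    change symSum (Q j) (B j + 1) g ≤ δ j * ∏ p ∈ Q j, (1 - g p)
    have hQP : ∀ p ∈ Q j, p ∈ P := fun p hp => (Finset.mem_filter.1 hp).1
    have h1 := pow_mul_symSum_le (P := Q j) (g := g) (fun p hp => (hgb p (hQP p hp)).1)
      (t := 4) (by norm_num) (B j + 1)
    have h2 : Real.exp (-(8 * N)) ≤ ∏ p ∈ Q j, (1 - g p) := by
      calc Real.exp (-(8 * N)) ≤ Real.exp (∑ p ∈ Q j, -(2 * g p)) := by
            rw [Real.exp_le_exp, Finset.sum_neg_distrib, ← Finset.mul_sum]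
            linarith [hsumg j]
        _ = ∏ p ∈ Q j, Real.exp (-(2 * g p)) := Real.exp_sum _ _
        _ ≤ _ := by
          refine Finset.prod_le_prod (fun p _ => (Real.exp_pos _).le) fun p hp => ?_
          obtain ⟨e1, e2, e3⟩ := hgb p (hQP p hp)
          refine le_trans (Real.exp_le_exp.2 ?_) (exp_neg_le_one_sub e1 (e2.trans e3))
          nlinarith
    have h3 : Real.exp (4 * ∑ p ∈ Q j, g p) ≤ 4 ^ (20 * N) * Real.exp (-(8 * N)) := by
      have : Real.exp (24 * N) ≤ 4 ^ (20 * N) := by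
        rw [mul_comm, Real.exp_nat_mul, pow_mul]
        exact pow_le_pow_left₀ (Real.exp_pos _).le exp_twentyfour_le N
      calc Real.exp (4 * ∑ p ∈ Q j, g p) ≤ Real.exp (24 * N + -(8 * N)) :=
            Real.exp_le_exp.2 (by linarith [hsumg j])
        _ ≤ _ := by rw [Real.exp_add]; gcongr
    have h4 : (4 : ℝ) ^ (B j + 1) = 4 ^ (20 * N) * 4 ^ (2 * (J - j) + 1) := by
      rw [← pow_add]; simp only [hB]; ring_nf
    rw [h4] at h1
    have h5 : (0 : ℝ) < 4 ^ (20 * N) := by positivity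
    have h6 : (0 : ℝ) < 4 ^ (2 * (J - j) + 1) := by positivity
    have h7 := h1.trans (h3.trans (mul_le_mul_of_nonneg_left h2 h5.le))
    rw [mul_assoc, mul_le_mul_iff_right₀ h5] at h7
    simp only [hδ]
    rw [div_mul_eq_mul_div, one_mul, le_div_iff₀ h6]
    linarith
  have hδsum : ∑ j ∈ Finset.range J, δ j ≤ 1 / 4 := by
    have h1 : ∀ J : ℕ, ∑ j ∈ Finset.range J, (1 / 4 ^ (2 * (J - j) + 1) : ℝ) ≤
        1 / 4 * (1 - 1 / 4 ^ (2 * J)) / 15 := by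
      intro J
      induction J with
      | zero => simp
      | succ J ih =>
        rw [Finset.sum_range_succ]
        have h2 : ∑ j ∈ Finset.range J, (1 / 4 ^ (2 * (J + 1 - j) + 1) : ℝ) =
            1 / 16 * ∑ j ∈ Finset.range J, (1 / 4 ^ (2 * (J - j) + 1) : ℝ) := by
          rw [Finset.mul_sum]
          refine Finset.sum_congr rfl fun j hj => ?_
          have := Finset.mem_range.1 hj
          rw [show 2 * (J + 1 - j) + 1 = 2 * (J - j) + 1 + 2 by omega, pow_add]
          norm_num
        have h3 : (1 : ℝ) / 4 ^ (2 * (J + 1)) = 1 / 16 * (1 / 4 ^ (2 * J)) := by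
          rw [show 2 * (J + 1) = 2 * J + 2 by ring, pow_add]
          norm_num
        rw [h2, h3, Nat.add_sub_cancel_left]
        norm_num at ih ⊢
        linarith
    refine (h1 J).trans ?_
    have : (0 : ℝ) ≤ 1 / 4 ^ (2 * J) := by positivity
    linarith
  have hR : ∏ j ∈ Finset.range J, (((P.filter fun p => level p = j).card : ℝ) * N + 1) ^ (B j + 1)
      ≤ (2 ^ 2 ^ J) ^ (100 * N) := by
    have h1 : ∀ j ∈ Finset.range J, (((Q j).card : ℝ) * N + 1) ^ (B j + 1) ≤
        2 ^ (2 ^ (j + 2) * (20 * N + 1 + 2 * (J - j))) := by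
      intro j _
      have h2 : (Q j).card * N + 1 ≤ (2 ^ 2 ^ (j + 1)) ^ 2 := by
        rcases (Q j).eq_empty_or_nonempty with h0 | ⟨p, hp⟩
        · rw [h0]; simp [Nat.one_le_pow]
        · have hlt : ∀ p ∈ Q j, p < 2 ^ 2 ^ (j + 1) := fun p hp => by
            have := lt_two_pow_two_pow_level_succ p
            rwa [(Finset.mem_filter.1 hp).2] at this
          have hc : (Q j).card ≤ 2 ^ 2 ^ (j + 1) - 1 := by
            have : Q j ⊆ Finset.Ico 1 (2 ^ 2 ^ (j + 1)) := fun p hp =>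
              Finset.mem_Ico.2 ⟨(hPm p (Finset.mem_filter.1 hp).1).1.one_lt.le, hlt p hp⟩
            simpa using Finset.card_le_card this
          have hN1 : N ≤ 2 ^ 2 ^ (j + 1) - 1 := by
            have hpm := hPm p (Finset.mem_filter.1 hp).1
            have h3 := h.lt_of_mem hpm.1 hpm.2.2
            have h4 := hlt p hp
            have : N ≤ 4 * N ^ 2 := by nlinarith
            omega
          generalize 2 ^ 2 ^ (j + 1) = y at hc hN1
          have hy : 1 ≤ y - 1 := hN.trans hN1
          obtain ⟨u, rfl⟩ : ∃ u, y = u + 1 := ⟨y - 1, by omega⟩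
          rw [Nat.add_sub_cancel] at hc hN1 hy
          have := Nat.mul_le_mul hc hN1
          nlinarith
      have h3 : ((Q j).card : ℝ) * N + 1 ≤ (2 ^ 2 ^ (j + 1)) ^ 2 := by exact_mod_cast h2
      refine (pow_le_pow_left₀ (by positivity) h3 _).trans (le_of_eq ?_)
      rw [← pow_mul, ← pow_mul]
      congr 1
      simp only [hB]
      ring
    have h4 : ∏ j ∈ Finset.range J, (((Q j).card : ℝ) * N + 1) ^ (B j + 1) ≤
        2 ^ ∑ j ∈ Finset.range J, 2 ^ (j + 2) * (20 * N + 1 + 2 * (J - j)) := by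
      rw [← Finset.prod_pow_eq_pow_sum]
      exact Finset.prod_le_prod (fun j _ => by positivity) h1
    refine h4.trans ?_
    rw [← pow_mul]
    refine pow_le_pow_right₀ one_le_two ((sum_level_exponent_le _ _).trans ?_)
    gcongr
    omega
  obtain ⟨h1, h2⟩ := brun_hooley (S := S) (bad := Bad a b D β) (P := P) (g := g)
    (Y := X / ∏ q ∈ D, (q : ℝ)) (N := N) (by positivity) (by positivity)
    (fun p hp => (hgb p hp).1) (fun p hp => by have := hgb p hp; linarith) hcnt
    (lev := level) (J := J) (fun p hp => (hPm p hp).2.1) (b := B)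
    (fun j => ⟨10 * N + (J - j), by simp only [hB]; ring⟩) (δ := δ)
    (fun j => by simp only [hδ]; positivity) hδle hδsum
  rw [hcard] at h1 h2
  constructor
  · refine le_trans ?_ h1
    gcongr
  · exact h2.trans (by gcongr)

theorem AdmissibleForms.prod_one_sub_ge (h : AdmissibleForms N A a b) (hN : 1 ≤ N)
    (D : Finset ℕ) (J : ℕ) :
    Real.exp (-(N * ∑ p ∈ sievePrimes A J, (1 / p : ℝ) + 1)) ≤
      ∏ p ∈ sievePrimes A J, (1 - badDensity N D p) := by
  have hPm : ∀ p ∈ sievePrimes A J, p.Prime ∧ level p < J ∧ ¬ p ∣ A := fun p hp =>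
    mem_sievePrimes.1 hp
  have hgb := fun p hp => h.badDensity_bounds hN D (hPm p hp).1 (hPm p hp).2.2
  have hsq := sum_inv_sq_le (P := sievePrimes A J) (z := 4 * N ^ 2) (by positivity)
    fun p hp => h.lt_of_mem (hPm p hp).1 (hPm p hp).2.2
  have hN0 : (0 : ℝ) < N := by exact_mod_cast hN
  push_cast at hsq
  calc _ ≤ Real.exp (∑ p ∈ sievePrimes A J, -((N : ℝ) / p + 2 * (N / p) ^ 2)) := by
        rw [Real.exp_le_exp, Finset.sum_neg_distrib, Finset.sum_add_distrib, neg_le_neg_iff]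
        have h1 : ∑ p ∈ sievePrimes A J, (N : ℝ) / p = N * ∑ p ∈ sievePrimes A J, (1 / p : ℝ) := by
          rw [Finset.mul_sum]; exact Finset.sum_congr rfl fun p _ => by ring
        have h2 : ∑ p ∈ sievePrimes A J, 2 * ((N : ℝ) / p) ^ 2 =
            2 * (N : ℝ) ^ 2 * ∑ p ∈ sievePrimes A J, (1 / (p : ℝ) ^ 2) := by
          rw [Finset.mul_sum]; exact Finset.sum_congr rfl fun p _ => by ring
        have h3 : 2 * (N : ℝ) ^ 2 * ∑ p ∈ sievePrimes A J, (1 / (p : ℝ) ^ 2) ≤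
            2 * (N : ℝ) ^ 2 * (1 / (4 * N ^ 2)) := by gcongr
        have h4 : 2 * (N : ℝ) ^ 2 * (1 / (4 * N ^ 2)) = 1 / 2 := by field_simp; norm_num
        rw [h1, h2]
        linarith
    _ = ∏ p ∈ sievePrimes A J, Real.exp (-((N : ℝ) / p + 2 * (N / p) ^ 2)) := Real.exp_sum _ _
    _ ≤ _ := by
      refine Finset.prod_le_prod (fun p _ => (Real.exp_pos _).le) fun p hp => ?_
      obtain ⟨e1, e2, e3⟩ := hgb p hp
      refine (exp_neg_le_one_sub (e1.trans e2) e3).trans ?_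
      linarith

end SiftedBounds

section Collisions

variable {N A : ℕ} {a b : Fin N → ℕ}

/-- Two of the forms have equally many prime divisors at `τ`. -/
def Collision (a b : Fin N → ℕ) (τ : ℕ) : Prop :=
  ∃ i j, i ≠ j ∧ (a i * τ + b i).primeFactors.card = (a j * τ + b j).primeFactors.card

theorem AdmissibleForms.ne_zero (h : AdmissibleForms N A a b) (hN : 1 ≤ N) (i : Fin N) (τ : ℕ) :
    a i * τ + b i ≠ 0 := by
  intro h0
  refine h.not_dvd 2 Nat.prime_two (h.small 2 Nat.prime_two ?_) i τ (h0 ▸ dvd_zero 2)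
  nlinarith

theorem AdmissibleForms.not_dvd_of_dvd_value (h : AdmissibleForms N A a b) {p : ℕ}
    (hp : p.Prime) {i : Fin N} {τ : ℕ} (hd : p ∣ a i * τ + b i) : ¬ p ∣ A :=
  fun hpA => h.not_dvd p hp hpA i τ hd

theorem Sifted.dvd_iff (h : AdmissibleForms N A a b) {D P : Finset ℕ} {β : ℕ → Fin N} {τ : ℕ}
    (hP : ∀ p ∈ P, p.Prime ∧ ¬ p ∣ A) (hs : Sifted a b D β P τ) (i : Fin N) {p : ℕ}
    (hp : p ∈ P) : p ∣ a i * τ + b i ↔ p ∈ D ∧ β p = i := by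
  constructor
  · intro hd
    by_cases hpD : p ∈ D
    · refine ⟨hpD, ?_⟩
      by_contra hne
      exact h.disjoint p (hP p hp).1 (hP p hp).2 (β p) i τ hne (hs.1 p hpD) hd
    · exact absurd (by rw [Bad, if_neg hpD]; exact ⟨i, hd⟩) (hs.2 p hp)
  · rintro ⟨hpD, rfl⟩
    exact hs.1 p hpD

theorem Sifted.not_sq_dvd (h : AdmissibleForms N A a b) {D P : Finset ℕ} {β : ℕ → Fin N} {τ : ℕ}
    (hP : ∀ p ∈ P, p.Prime ∧ ¬ p ∣ A) (hs : Sifted a b D β P τ) (i : Fin N) {p : ℕ}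
    (hp : p ∈ P) : ¬ p ^ 2 ∣ a i * τ + b i := by
  intro hd
  obtain ⟨hpD, rfl⟩ := (hs.dvd_iff h hP i hp).1 ((dvd_pow_self p two_ne_zero).trans hd)
  exact hs.2 p hp (by rwa [Bad, if_pos hpD])

theorem card_primeFactors_ge_le {n q k : ℕ} (hn : n ≠ 0) (hq : 1 < q) (h : n < q ^ (k + 1)) :
    (n.primeFactors.filter fun p => q ≤ p).card ≤ k := by
  by_contra! hk
  have h1 : q ^ (k + 1) ≤ ∏ p ∈ n.primeFactors.filter (fun p => q ≤ p), p :=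
    (Nat.pow_le_pow_right (by omega) hk).trans
      (Finset.pow_card_le_prod _ _ _ fun p hp => (Finset.mem_filter.1 hp).2)
  have h2 : ∏ p ∈ n.primeFactors.filter (fun p => q ≤ p), p ≤ n :=
    Nat.le_of_dvd (Nat.pos_of_ne_zero hn)
      ((Finset.prod_dvd_prod_of_subset _ _ _ (Finset.filter_subset _ _)).trans
        (Nat.prod_primeFactors_dvd n))
  omega

theorem sum_range_card_le_sum_of_injective {N : ℕ} {f : Fin N → ℕ} (hf : Function.Injective f) :
    ∑ k ∈ Finset.range N, k ≤ ∑ i, f i := by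
  have h1 : (Finset.univ.image f).card = N := by
    rw [Finset.card_image_of_injective _ hf, Finset.card_univ, Fintype.card_fin]
  have h2 : ∀ s : Finset ℕ, ∑ k ∈ Finset.range s.card, k ≤ ∑ k ∈ s, k := by
    intro s
    induction s using Finset.induction_on_max with
    | empty => simp
    | insert m s hm ih =>
      have hms : m ∉ s := fun h => (hm m h).false
      have : s.card ≤ m := by
        simpa using Finset.card_le_card fun k hk => Finset.mem_range.2 (hm k hk)
      rw [Finset.card_insert_of_notMem hms, Finset.sum_range_succ, Finset.sum_insert hms]
      omega
  have h3 := h2 (Finset.univ.image f)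
  rwa [h1, Finset.sum_image fun x _ y _ h => hf h] at h3

theorem Sifted.insert {D P : Finset ℕ} {β : ℕ → Fin N} {τ p : ℕ}
    (hDP : D ⊆ P) (hpP : p ∉ P) (hs : Sifted a b D β P τ) (i : Fin N)
    (hd : p ∣ a i * τ + b i) :
    Sifted a b (insert p D) (Function.update β p i) P τ := by
  have hpD : p ∉ D := fun h => hpP (hDP h)
  constructor
  · intro q hq
    rcases Finset.mem_insert.1 hq with rfl | hq
    · simpa using hd
    · have hqp : q ≠ p := fun h => hpD (h ▸ hq)
      rw [Function.update_of_ne hqp]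
      exact hs.1 q hq
  · intro q hq hbad
    have hqp : q ≠ p := fun h => hpP (h ▸ hq)
    refine hs.2 q hq ?_
    simpa [Bad, Finset.mem_insert, hqp, Function.update_of_ne hqp] using hbad

theorem AdmissibleForms.sum_cnt_dvd_le (h : AdmissibleForms N A a b) (hN : 1 ≤ N)
    {D : Finset ℕ} (β : ℕ → Fin N) {J K X : ℕ} (hD : D ⊆ sievePrimes A J) (hJK : J ≤ K) :
    ∑ i, ∑ p ∈ sievePrimes A K \ sievePrimes A J,
      cnt X (fun τ => Sifted a b D β (sievePrimes A J) τ ∧ p ∣ a i * τ + b i) ≤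
    N * (8 * (K - J : ℕ) * (X / (∏ q ∈ D, (q : ℝ)) *
      ∏ p ∈ sievePrimes A J, (1 - badDensity N D p)) + 2 ^ 2 ^ K * (2 ^ 2 ^ J) ^ (100 * N)) := by
  set P := sievePrimes A J with hP
  set V := ∏ p ∈ P, (1 - badDensity N D p) with hV
  have hDm : ∀ p ∈ D, p.Prime ∧ ¬ p ∣ A := fun p hp =>
    ⟨(mem_sievePrimes.1 (hD hp)).1, (mem_sievePrimes.1 (hD hp)).2.2⟩
  have hΔ : (0 : ℝ) < ∏ q ∈ D, (q : ℝ) :=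
    Finset.prod_pos fun q hq => by exact_mod_cast (hDm q hq).1.pos
  have hV0 : 0 ≤ V := Finset.prod_nonneg fun p hp => by
    have := mem_sievePrimes.1 hp
    have := h.badDensity_bounds hN D this.1 this.2.2
    linarith
  have h1 : ∀ i, ∀ p ∈ sievePrimes A K \ P,
      cnt X (fun τ => Sifted a b D β P τ ∧ p ∣ a i * τ + b i) ≤
        2 * (X / (∏ q ∈ D, (q : ℝ)) * V) * (1 / p) + (2 ^ 2 ^ J) ^ (100 * N) := by
    intro i p hp
    obtain ⟨hpK, hpP⟩ := Finset.mem_sdiff.1 hp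
    have hpm := mem_sievePrimes.1 hpK
    have hpD : p ∉ D := fun h => hpP (hD h)
    have h2 := (h.sifted_bounds hN (D := insert p D) (Function.update β p i) (by
      intro q hq
      rcases Finset.mem_insert.1 hq with rfl | hq
      · exact ⟨hpm.1, hpm.2.2⟩
      · exact hDm q hq) J X).2
    have h3 : ∏ q ∈ P, (1 - badDensity N (insert p D) q) = V := by
      refine Finset.prod_congr rfl fun q hq => ?_
      have hqp : q ≠ p := fun h => hpP (h ▸ hq)
      simp [badDensity, Finset.mem_insert, hqp]
    rw [← hP, h3, Finset.prod_insert hpD] at h2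
    refine (cnt_mono fun τ _ hτ => hτ.1.insert hD hpP i hτ.2).trans (h2.trans (le_of_eq ?_))
    have : (p : ℝ) ≠ 0 := by exact_mod_cast hpm.1.ne_zero
    field_simp
  have h4 : ∀ i : Fin N, ∑ p ∈ sievePrimes A K \ P,
      cnt X (fun τ => Sifted a b D β P τ ∧ p ∣ a i * τ + b i) ≤
      8 * (K - J : ℕ) * (X / (∏ q ∈ D, (q : ℝ)) * V) + 2 ^ 2 ^ K * (2 ^ 2 ^ J) ^ (100 * N) := by
    intro i
    refine (Finset.sum_le_sum (h1 i)).trans ?_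
    rw [Finset.sum_add_distrib, ← Finset.mul_sum, Finset.sum_const, nsmul_eq_mul]
    have h5 : ∑ p ∈ sievePrimes A K \ P, (1 / p : ℝ) ≤ 4 * (K - J : ℕ) := by
      refine sum_inv_le_of_level_Ico (J := J) fun p hp => ?_
      obtain ⟨hpK, hpP⟩ := Finset.mem_sdiff.1 hp
      have hpm := mem_sievePrimes.1 hpK
      rw [hP, mem_sievePrimes] at hpP
      refine ⟨hpm.1, ?_, ?_⟩
      · by_contra! hlt
        exact hpP ⟨hpm.1, hlt, hpm.2.2⟩
      · have := hpm.2.1; omega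
    have h6 : ((sievePrimes A K \ P).card : ℝ) ≤ 2 ^ 2 ^ K := by
      have : (sievePrimes A K \ P).card ≤ 2 ^ 2 ^ K := by
        refine (Finset.card_le_card Finset.sdiff_subset).trans ?_
        exact (Finset.card_filter_le _ _).trans (by simp)
      exact_mod_cast this
    have h7 : 0 ≤ 2 * (X / (∏ q ∈ D, (q : ℝ)) * V) := by positivity
    have h8 := mul_le_mul_of_nonneg_left h5 h7
    have h9 : (0 : ℝ) ≤ (2 ^ 2 ^ J) ^ (100 * N) := by positivity
    have h10 := mul_le_mul_of_nonneg_right h6 h9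
    linarith
  refine (Finset.sum_le_card_nsmul _ _ _ fun i _ => h4 i).trans (le_of_eq ?_)
  rw [Finset.card_univ, Fintype.card_fin, nsmul_eq_mul]

theorem card_primeFactors_split (h : AdmissibleForms N A a b) (hN : 1 ≤ N) {D : Finset ℕ}
    {β : ℕ → Fin N} {J K τ : ℕ} (hs : Sifted a b D β (sievePrimes A J) τ)
    (hD : D ⊆ sievePrimes A J) (i : Fin N) :
    (D.filter fun q => β q = i).card ≤ (a i * τ + b i).primeFactors.card ∧
    (a i * τ + b i).primeFactors.card ≤ (D.filter fun q => β q = i).card +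
      ((sievePrimes A K \ sievePrimes A J).filter fun p => p ∣ a i * τ + b i).card +
      ((a i * τ + b i).primeFactors.filter fun p => 2 ^ 2 ^ K ≤ p).card := by
  have hP : ∀ p ∈ sievePrimes A J, p.Prime ∧ ¬ p ∣ A := fun p hp =>
    ⟨(mem_sievePrimes.1 hp).1, (mem_sievePrimes.1 hp).2.2⟩
  have h0 := h.ne_zero hN i τ
  constructor
  · refine Finset.card_le_card fun q hq => ?_
    obtain ⟨hqD, rfl⟩ := Finset.mem_filter.1 hq
    exact Nat.mem_primeFactors.2 ⟨(hP q (hD hqD)).1, hs.1 q hqD, h0⟩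
  · refine le_trans (Finset.card_le_card fun p hp => ?_)
      ((Finset.card_union_le _ _).trans (Nat.add_le_add_right (Finset.card_union_le _ _) _))
    obtain ⟨hpp, hpd, -⟩ := Nat.mem_primeFactors.1 hp
    have hpA := h.not_dvd_of_dvd_value hpp hpd
    simp only [Finset.mem_union, Finset.mem_filter, Finset.mem_sdiff]
    by_cases hpJ : p ∈ sievePrimes A J
    · exact Or.inl (Or.inl ((hs.dvd_iff h hP i hpJ).1 hpd))
    · by_cases hpK : p ∈ sievePrimes A K
      · exact Or.inl (Or.inr ⟨⟨hpK, hpJ⟩, hpd⟩)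
      · refine Or.inr ⟨hp, ?_⟩
        by_contra! hlt
        exact hpK (mem_sievePrimes.2 ⟨hpp, (level_lt_iff hpp.two_le).2 hlt, hpA⟩)

end Collisions

section DoubleCounting

theorem cnt_le_add {X : ℕ} {P Q R : ℕ → Prop} (h : ∀ τ < X, P τ → Q τ ∨ R τ) :
    cnt X P ≤ cnt X Q + cnt X R := by
  classical
  unfold cnt
  rw [← Nat.cast_add]
  refine Nat.cast_le.2 (le_trans (Finset.card_le_card fun τ hτ => ?_) (Finset.card_union_le _ _))
  simp only [Finset.mem_union, Finset.mem_filter, Finset.mem_range] at hτ ⊢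
  rcases h τ hτ.1 hτ.2 with h1 | h1
  · exact Or.inl ⟨hτ.1, h1⟩
  · exact Or.inr ⟨hτ.1, h1⟩

open Classical in
theorem sum_cnt_eq {ι : Type*} (I : Finset ι) (C : ι → ℕ → Prop) (X : ℕ) :
    ∑ x ∈ I, cnt X (C x) = ∑ τ ∈ Finset.range X, ((I.filter fun x => C x τ).card : ℝ) := by
  unfold cnt
  exact_mod_cast Finset.sum_card_bipartiteAbove_eq_sum_card_bipartiteBelow
    (s := I) (t := Finset.range X) C

theorem mul_cnt_le_sum_cnt {ι : Type*} {I : Finset ι} {C : ι → ℕ → Prop} {X m : ℕ}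
    {Q : ℕ → Prop} (h : ∀ τ < X, Q τ → ∃ I' ⊆ I, m ≤ I'.card ∧ ∀ x ∈ I', C x τ) :
    m * cnt X Q ≤ ∑ x ∈ I, cnt X (C x) := by
  classical
  rw [sum_cnt_eq, cnt, mul_comm, ← nsmul_eq_mul]
  refine (Finset.card_nsmul_le_sum _ _ _ fun τ hτ => ?_).trans
    (Finset.sum_le_sum_of_subset_of_nonneg (Finset.filter_subset Q _)
      fun _ _ _ => Nat.cast_nonneg _)
  obtain ⟨h1, h2⟩ := Finset.mem_filter.1 hτ
  obtain ⟨I', hI', hm, hC⟩ := h τ (Finset.mem_range.1 h1) h2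
  exact_mod_cast hm.trans
    (Finset.card_le_card fun x hx => Finset.mem_filter.2 ⟨hI' hx, hC x hx⟩)

theorem sum_cnt_le_mul_cnt {ι : Type*} {I : Finset ι} {C : ι → ℕ → Prop} {X m : ℕ}
    {Q : ℕ → Prop} (hQ : ∀ x ∈ I, ∀ τ < X, C x τ → Q τ)
    (h : ∀ τ < X, ∀ I' ⊆ I, (∀ x ∈ I', C x τ) → I'.card ≤ m) :
    ∑ x ∈ I, cnt X (C x) ≤ m * cnt X Q := by
  classical
  rw [sum_cnt_eq, cnt, mul_comm, ← nsmul_eq_mul, ← Finset.sum_const, Finset.sum_filter]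
  refine Finset.sum_le_sum fun τ hτ => ?_
  have hX := Finset.mem_range.1 hτ
  split_ifs with hq
  · exact_mod_cast h τ hX _ (Finset.filter_subset _ _) fun x hx => (Finset.mem_filter.1 hx).2
  · rw [Finset.filter_false_of_mem fun x hx hc => hq (hQ x hx τ hX hc)]
    simp

end DoubleCounting

section GoodCount

variable {N A : ℕ} {a b : Fin N → ℕ}

theorem AdmissibleForms.sum_card_ge_of_not_collision (h : AdmissibleForms N A a b) (hN : 1 ≤ N)
    {D : Finset ℕ} {β : ℕ → Fin N} {J K τ r : ℕ} (hs : Sifted a b D β (sievePrimes A J) τ)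
    (hD : D ⊆ sievePrimes A J) (hr : ∀ i, (D.filter fun q => β q = i).card = r)
    (hlt : ∀ i, a i * τ + b i < (2 ^ 2 ^ K) ^ 5) (hc : ¬ Collision a b τ) :
    N * (N - 1) ≤ 2 * (∑ i, ((sievePrimes A K \ sievePrimes A J).filter
      fun p => p ∣ a i * τ + b i).card + 4 * N) := by
  have h1 := fun i => card_primeFactors_split (K := K) h hN hs hD i
  simp only [hr] at h1
  have h2 : Function.Injective fun i => (a i * τ + b i).primeFactors.card - r := by
    intro i j hij
    by_contra hne
    refine hc ⟨i, j, hne, ?_⟩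
    have := (h1 i).1
    have := (h1 j).1
    simp only at hij
    omega
  have h3 := sum_range_card_le_sum_of_injective h2
  have h4 : ∑ i : Fin N, ((a i * τ + b i).primeFactors.card - r) ≤
      ∑ i : Fin N, (((sievePrimes A K \ sievePrimes A J).filter
      fun p => p ∣ a i * τ + b i).card + 4) := by
    refine Finset.sum_le_sum fun i _ => ?_
    have h5 := (h1 i).2
    have h6 := card_primeFactors_ge_le (k := 4) (h.ne_zero hN i τ)
      (q := 2 ^ 2 ^ K) (Nat.one_lt_pow (by positivity) (by norm_num)) (hlt i)
    omega
  rw [Finset.sum_add_distrib, Finset.sum_const, Finset.card_univ, Fintype.card_fin,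
    smul_eq_mul] at h4
  have h7 := Finset.sum_range_id_mul_two N
  linarith

theorem AdmissibleForms.good_count (h : AdmissibleForms N A a b) (hN : 1 ≤ N)
    {D : Finset ℕ} {β : ℕ → Fin N} {J w X r : ℕ} (hD : D ⊆ sievePrimes A J)
    (hr : ∀ i, (D.filter fun q => β q = i).card = r) (hw : 2 ^ w = 512 * N)
    (hNw : 64 * w + 9 ≤ N)
    (hX : (2 ^ 2 ^ J) ^ (512 * N) ≤ X) (hX' : X < (2 ^ 2 ^ J) ^ (1024 * N))
    (hΔ : ∏ q ∈ D, q ≤ (2 ^ 2 ^ J) ^ (32 * N))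
    (hy : Real.exp (4 * N * J + 1) ≤ 2 ^ 2 ^ J) (hJ : 4 * (J + 1) ≤ 2 ^ 2 ^ J)
    (hC : ∀ i, a i + b i ≤ 2 ^ 2 ^ J) :
    1 / 4 * (X / (∏ q ∈ D, (q : ℝ)) *
      Real.exp (-(N * ∑ p ∈ sievePrimes A J, (1 / p : ℝ) + 1))) ≤
    cnt X fun τ => Sifted a b D β (sievePrimes A J) τ ∧ Collision a b τ := by
  set P := sievePrimes A J with hP
  have hDm : ∀ p ∈ D, p.Prime ∧ ¬ p ∣ A := fun p hp =>
    ⟨(mem_sievePrimes.1 (hD hp)).1, (mem_sievePrimes.1 (hD hp)).2.2⟩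
  have hV := h.prod_one_sub_ge hN D J
  have hS : ∑ p ∈ P, (1 / p : ℝ) ≤ 4 * J := sum_inv_le_of_level_lt fun p hp =>
    ⟨(mem_sievePrimes.1 hp).1, (mem_sievePrimes.1 hp).2.1⟩
  have hlow := (h.sifted_bounds hN β hDm J X).1
  have hw1 : 1 ≤ w := by
    by_contra! h0
    obtain rfl : w = 0 := by omega
    omega
  obtain ⟨v, rfl⟩ : ∃ v, w = v + 1 := ⟨w - 1, by omega⟩
  have hv : 2 ^ v = 256 * N := by rw [pow_succ] at hw; omega
  have hmid := h.sum_cnt_dvd_le hN (X := X) (K := J + v) β hD (by omega)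
  rw [← hP] at hV hlow hmid
  have hQ : 2 ^ 2 ^ (J + v) = (2 ^ 2 ^ J) ^ (256 * N) := by rw [pow_add, hv, pow_mul]
  set V := ∏ p ∈ P, (1 - badDensity N D p) with hVdef
  set Δ := ∏ q ∈ D, (q : ℝ) with hΔdef
  have hΔ0 : 0 < Δ := Finset.prod_pos fun q hq => by exact_mod_cast (hDm q hq).1.pos
  have hΔ' : Δ ≤ (2 ^ 2 ^ J) ^ (32 * N) := by
    have h1 : ((∏ q ∈ D, q : ℕ) : ℝ) ≤ ((2 ^ 2 ^ J) ^ (32 * N) : ℕ) := Nat.cast_le.2 hΔ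
    push_cast at h1
    exact h1
  set y : ℝ := 2 ^ 2 ^ J with hydef
  have hy1 : 1 ≤ y := one_le_pow₀ (by norm_num)
  have hy0 : 0 < y := by positivity
  set R := X / Δ * V with hR
  have hXr : y ^ (512 * N) ≤ X := by rw [hydef]; exact_mod_cast hX
  have hVy : 1 / y ≤ V := by
    refine le_trans ?_ hV
    rw [Real.exp_neg, one_div]
    refine inv_anti₀ (Real.exp_pos _) (le_trans (Real.exp_le_exp.2 ?_) hy)
    have : (0 : ℝ) ≤ N := Nat.cast_nonneg _
    nlinarith
  have hRy : y ^ (480 * N - 1) ≤ R := by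
    have h1 : y ^ (480 * N) ≤ X / Δ := by
      rw [le_div_iff₀ hΔ0]
      calc y ^ (480 * N) * Δ ≤ y ^ (480 * N) * y ^ (32 * N) := by gcongr
        _ = y ^ (512 * N) := by rw [← pow_add]; congr 1; ring
        _ ≤ X := hXr
    calc y ^ (480 * N - 1) = y ^ (480 * N) * (1 / y) := by
          rw [mul_one_div, eq_div_iff hy0.ne', ← pow_succ]; congr 1; omega
      _ ≤ X / Δ * V := by gcongr
  have h356 : (2 : ℝ) ^ 2 ^ (J + v) * y ^ (100 * N) ≤ R := by
    have : (2 : ℝ) ^ 2 ^ (J + v) = y ^ (256 * N) := by rw [hydef]; exact_mod_cast hQ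
    rw [this, ← pow_add]
    exact (pow_le_pow_right₀ hy1 (by omega)).trans hRy
  have h101 : (J + 1) * y ^ (100 * N) ≤ 1 / 4 * R := by
    have h1 : (4 * (J + 1) : ℝ) ≤ y := by rw [hydef]; exact_mod_cast hJ
    have h2 : y ^ (100 * N + 1) ≤ R := (pow_le_pow_right₀ hy1 (by omega)).trans hRy
    rw [pow_succ] at h2
    nlinarith [pow_pos hy0 (100 * N)]
  have hR0 : 0 ≤ R := (pow_nonneg hy0.le _).trans hRy
  have hmarkov : ((32 * (v + 1) * N : ℕ) : ℝ) *
      cnt X (fun τ => Sifted a b D β P τ ∧ ¬ Collision a b τ) ≤ 8 * (v + 1) * N * R := by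
    have h1 : ((32 * (v + 1) * N : ℕ) : ℝ) *
        cnt X (fun τ => Sifted a b D β P τ ∧ ¬ Collision a b τ) ≤
        ∑ x ∈ Finset.univ ×ˢ (sievePrimes A (J + v) \ P),
          cnt X (fun τ => Sifted a b D β P τ ∧ x.2 ∣ a x.1 * τ + b x.1) := by
      classical
      refine mul_cnt_le_sum_cnt fun τ hτ hs => ?_
      have hlt : ∀ i, a i * τ + b i < (2 ^ 2 ^ (J + v)) ^ 5 := by
        intro i
        rw [hQ, ← pow_mul]
        calc a i * τ + b i ≤ (a i + b i) * X := by nlinarith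
          _ ≤ 2 ^ 2 ^ J * X := by gcongr; exact hC i
          _ < 2 ^ 2 ^ J * (2 ^ 2 ^ J) ^ (1024 * N) := by gcongr
          _ = (2 ^ 2 ^ J) ^ (1024 * N + 1) := by ring
          _ ≤ _ := Nat.pow_le_pow_right (by positivity) (by omega)
      have h2 := h.sum_card_ge_of_not_collision hN (K := J + v) hs.1 hD hr hlt hs.2
      have h3 : ((Finset.univ ×ˢ (sievePrimes A (J + v) \ P)).filter fun x : Fin N × ℕ =>
          Sifted a b D β P τ ∧ x.2 ∣ a x.1 * τ + b x.1).card =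
          ∑ i, ((sievePrimes A (J + v) \ P).filter fun p => p ∣ a i * τ + b i).card := by
        simp only [hs.1, true_and, Finset.card_filter]
        rw [Finset.sum_product]
      have h4 : N * (64 * (v + 1) + 8) ≤ N * (N - 1) := Nat.mul_le_mul_left _ (by omega)
      have h5 : 32 * (v + 1) * N ≤
          ∑ i, ((sievePrimes A (J + v) \ P).filter fun p => p ∣ a i * τ + b i).card := by
        rw [← hP] at h2
        nlinarith
      exact ⟨_, Finset.filter_subset _ _, h5.trans h3.ge, fun x hx => (Finset.mem_filter.1 hx).2⟩
    rw [Finset.sum_product] at h1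
    refine h1.trans (hmid.trans ?_)
    have h5 : ((J + v - J : ℕ) : ℝ) = v := by rw [Nat.add_sub_cancel_left]
    rw [h5]
    have : (0 : ℝ) ≤ N := Nat.cast_nonneg _
    nlinarith [mul_nonneg this hR0]
  have hNC : cnt X (fun τ => Sifted a b D β P τ ∧ ¬ Collision a b τ) ≤ 1 / 4 * R := by
    have h1 : (0 : ℝ) < (v + 1) * N := by
      have : (0 : ℝ) < N := by exact_mod_cast hN
      positivity
    push_cast at hmarkov
    by_contra! h2
    nlinarith [mul_lt_mul_of_pos_left h2 h1]
  have hsplit : cnt X (Sifted a b D β P) ≤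
      cnt X (fun τ => Sifted a b D β P τ ∧ Collision a b τ) +
      cnt X (fun τ => Sifted a b D β P τ ∧ ¬ Collision a b τ) :=
    cnt_le_add fun τ _ hs => by by_cases hc : Collision a b τ <;> simp [hs, hc]
  have hfin : X / Δ * Real.exp (-(N * ∑ p ∈ P, (1 / p : ℝ) + 1)) ≤ R := by
    rw [hR]; gcongr
  linarith

end GoodCount

section Weights

variable {ι : Type*} [Fintype ι] [DecidableEq ι]

theorem sum_piFinset_prod (P : Finset ℕ) (g : ι → ℕ → ℝ) :
    ∑ f ∈ Fintype.piFinset (fun _ : ι => P), ∏ x, g x (f x) = ∏ x, ∑ p ∈ P, g x p :=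
  (Finset.prod_univ_sum _ _).symm

theorem sum_piFinset_prod_eq_pow (P : Finset ℕ) (w : ℕ → ℝ) :
    ∑ f ∈ Fintype.piFinset (fun _ : ι => P), ∏ x, w (f x) = (∑ p ∈ P, w p) ^ Fintype.card ι := by
  rw [sum_piFinset_prod, Finset.prod_const, Finset.card_univ]

theorem sum_piFinset_mul_prod (P : Finset ℕ) (w v : ℕ → ℝ) (x : ι) :
    (∑ p ∈ P, w p) * ∑ f ∈ Fintype.piFinset (fun _ : ι => P), v (f x) * ∏ x, w (f x) =
      (∑ p ∈ P, v p * w p) * (∑ p ∈ P, w p) ^ Fintype.card ι := by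
  have h1 : ∀ f : ι → ℕ, v (f x) * ∏ x, w (f x) =
      ∏ i, (if i = x then v (f i) * w (f i) else w (f i)) := by
    intro f
    rw [← Finset.mul_prod_erase _ _ (Finset.mem_univ x),
      ← Finset.mul_prod_erase _ _ (Finset.mem_univ x), if_pos rfl, mul_assoc]
    congr 2
    exact Finset.prod_congr rfl fun i hi => by rw [if_neg (Finset.ne_of_mem_erase hi)]
  simp only [h1]
  rw [sum_piFinset_prod P fun i p => if i = x then v p * w p else w p,
    ← Finset.mul_prod_erase _ _ (Finset.mem_univ x), ← Finset.card_univ, ← Finset.prod_const,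
    ← Finset.mul_prod_erase _ _ (Finset.mem_univ x)]
  simp only [if_true]
  have h2 : ∏ i ∈ Finset.univ.erase x, ∑ p ∈ P, (if i = x then v p * w p else w p) =
      ∏ i ∈ Finset.univ.erase x, ∑ p ∈ P, w p :=
    Finset.prod_congr rfl fun i hi => by simp only [if_neg (Finset.ne_of_mem_erase hi)]
  rw [h2]
  ring

theorem sum_piFinset_eq_prod (P : Finset ℕ) (w : ℕ → ℝ) {x x' : ι} (hx : x ≠ x') :
    (∑ p ∈ P, w p) ^ 2 * ∑ f ∈ (Fintype.piFinset fun _ : ι => P) with f x = f x', ∏ x, w (f x) =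
      (∑ p ∈ P, w p ^ 2) * (∑ p ∈ P, w p) ^ Fintype.card ι := by
  have h1 : ∀ f ∈ Fintype.piFinset (fun _ : ι => P),
      (if f x = f x' then ∏ x, w (f x) else 0) =
      ∑ q ∈ P, ∏ i, (if i = x ∨ i = x' then (if f i = q then w (f i) else 0) else w (f i)) := by
    intro f hf
    have hfx := Fintype.mem_piFinset.1 hf x
    split_ifs with h
    · rw [Finset.sum_eq_single_of_mem (f x) hfx]
      · refine Finset.prod_congr rfl fun i _ => ?_
        by_cases hi : i = x ∨ i = x'
        · rw [if_pos hi, if_pos]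
          rcases hi with rfl | rfl <;> simp [h]
        · rw [if_neg hi]
      · intro q _ hq
        exact Finset.prod_eq_zero (Finset.mem_univ x) (by simp [hq.symm])
    · symm
      refine Finset.sum_eq_zero fun q _ => ?_
      by_cases hq : f x = q
      · refine Finset.prod_eq_zero (Finset.mem_univ x') ?_
        simp [show f x' ≠ q from fun h' => h (hq.trans h'.symm)]
      · exact Finset.prod_eq_zero (Finset.mem_univ x) (by simp [hq])
  rw [Finset.sum_filter, Finset.sum_congr rfl h1, Finset.sum_comm, Finset.mul_sum, Finset.sum_mul]
  refine Finset.sum_congr rfl fun q hq => ?_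
  rw [sum_piFinset_prod P fun i p =>
    if i = x ∨ i = x' then (if p = q then w p else 0) else w p]
  have hx' : x' ∈ Finset.univ.erase x := Finset.mem_erase.2 ⟨hx.symm, Finset.mem_univ _⟩
  rw [← Finset.mul_prod_erase _ _ (Finset.mem_univ x), ← Finset.mul_prod_erase _ _ hx',
    ← Finset.card_univ, ← Finset.prod_const, ← Finset.mul_prod_erase _ _ (Finset.mem_univ x),
    ← Finset.mul_prod_erase _ _ hx']
  have h2 : ∏ i ∈ (Finset.univ.erase x).erase x',
      ∑ p ∈ P, (if i = x ∨ i = x' then (if p = q then w p else 0) else w p) =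
      ∏ i ∈ (Finset.univ.erase x).erase x', ∑ p ∈ P, w p := by
    refine Finset.prod_congr rfl fun i hi => ?_
    have h3 := Finset.mem_erase.1 hi
    have h4 := Finset.mem_erase.1 h3.2
    simp [h3.1, h4.1]
  rw [h2]
  simp [hq]
  ring

theorem half_pow_le_sum_good {P : Finset ℕ} (hP : ∀ p ∈ P, 0 < p) {N Y : ℕ} (hN : 1 ≤ N)
    (hY : 2 ≤ Y) (hS : 0 < ∑ p ∈ P, (1 / p : ℝ))
    (hm : (Fintype.card ι : ℝ) ≤ N * ∑ p ∈ P, (1 / p : ℝ))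
    (h2 : ∑ p ∈ P, (1 / p : ℝ) ^ 2 ≤ 1 / (4 * N ^ 2))
    (hlog : ∑ p ∈ P, Real.log p * (1 / p : ℝ) ≤ 8 * Real.log Y) :
    1 / 2 * (∑ p ∈ P, (1 / p : ℝ)) ^ Fintype.card ι ≤
      ∑ f ∈ (Fintype.piFinset fun _ : ι => P) with
        Function.Injective f ∧ ∏ x, f x ≤ Y ^ (32 * N), ∏ x, (1 / f x : ℝ) := by
  set S := ∑ p ∈ P, (1 / p : ℝ) with hSdef
  set m := Fintype.card ι with hmdef
  set F := Fintype.piFinset fun _ : ι => P with hF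
  set W : (ι → ℕ) → ℝ := fun f => ∏ x, (1 / f x : ℝ) with hW
  have hW0 : ∀ f, 0 ≤ W f := fun f => Finset.prod_nonneg fun x _ => by positivity
  have hN' : (1 : ℝ) ≤ N := by exact_mod_cast hN
  have hSm : 0 < S ^ m := pow_pos hS _
  have htot : ∑ f ∈ F, W f = S ^ m := sum_piFinset_prod_eq_pow P fun p => (1 / p : ℝ)
  have hlogY : 0 < Real.log Y := Real.log_pos (by exact_mod_cast hY)
  have hinj : ∑ f ∈ F with ¬ Function.Injective f, W f ≤ 1 / 4 * S ^ m := by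
    have h3 : ∑ f ∈ F with ¬ Function.Injective f, W f ≤
        ∑ z : ι × ι, if z.1 ≠ z.2 then ∑ f ∈ F with f z.1 = f z.2, W f else 0 := by
      have h4 : ∀ z : ι × ι, (if z.1 ≠ z.2 then ∑ f ∈ F with f z.1 = f z.2, W f else 0) =
          ∑ f ∈ F, if z.1 ≠ z.2 ∧ f z.1 = f z.2 then W f else 0 := by
        intro z
        by_cases hz : z.1 ≠ z.2
        · simp only [Finset.sum_filter, hz, true_and, ne_eq, not_false_eq_true, if_true]
        · simp only [hz, false_and, if_false, Finset.sum_const_zero]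
      simp only [h4]
      rw [Finset.sum_comm, Finset.sum_filter]
      refine Finset.sum_le_sum fun f _ => ?_
      split_ifs with hf
      · exact Finset.sum_nonneg fun z _ => by split_ifs <;> simp [hW0]
      · rw [Function.Injective] at hf
        push Not at hf
        obtain ⟨x, x', hxx, hne⟩ := hf
        refine le_trans ?_ (Finset.single_le_sum (fun z _ => ?_) (Finset.mem_univ (x, x')))
        · rw [if_pos ⟨hne, hxx⟩]
        · split_ifs <;> simp [hW0]
    have h5 : S ^ 2 * ∑ f ∈ F with ¬ Function.Injective f, W f ≤
        ∑ _z : ι × ι, (1 / (4 * N ^ 2)) * S ^ m := by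
      refine (mul_le_mul_of_nonneg_left h3 (by positivity)).trans ?_
      rw [Finset.mul_sum]
      refine Finset.sum_le_sum fun z _ => ?_
      split_ifs with hz
      · have := sum_piFinset_eq_prod P (fun p => (1 / p : ℝ)) hz
        rw [this]
        gcongr
      · rw [mul_zero]; positivity
    rw [Finset.sum_const, Finset.card_univ, Fintype.card_prod, nsmul_eq_mul, ← hmdef] at h5
    have h6 : (m : ℝ) * m ≤ N ^ 2 * S ^ 2 := by
      have : (0 : ℝ) ≤ m := Nat.cast_nonneg _
      nlinarith
    have h7 : S ^ 2 * ∑ f ∈ F with ¬ Function.Injective f, W f ≤ S ^ 2 * (1 / 4 * S ^ m) := by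
      refine h5.trans ?_
      push_cast
      calc (m : ℝ) * m * (1 / (4 * N ^ 2) * S ^ m) ≤ N ^ 2 * S ^ 2 * (1 / (4 * N ^ 2) * S ^ m) := by
            gcongr
        _ = _ := by field_simp
    exact le_of_mul_le_mul_left h7 (by positivity)
  have hbig : ∑ f ∈ F with ¬ ∏ x, f x ≤ Y ^ (32 * N), W f ≤ 1 / 4 * S ^ m := by
    have h3 : ∑ f ∈ F, (∑ x, Real.log (f x)) * W f ≤ 8 * N * Real.log Y * S ^ m := by
      have h4 : S * ∑ f ∈ F, (∑ x, Real.log (f x)) * W f ≤ ∑ _x : ι, 8 * Real.log Y * S ^ m := by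
        simp only [Finset.sum_mul]
        rw [Finset.sum_comm, Finset.mul_sum]
        refine Finset.sum_le_sum fun x _ => ?_
        have := sum_piFinset_mul_prod P (fun p => (1 / p : ℝ)) (fun p => Real.log p) x
        rw [this]
        gcongr
      rw [Finset.sum_const, Finset.card_univ, nsmul_eq_mul, ← hmdef] at h4
      refine le_of_mul_le_mul_left (h4.trans ?_) hS
      calc (m : ℝ) * (8 * Real.log Y * S ^ m) ≤ (N * S) * (8 * Real.log Y * S ^ m) := by gcongr
        _ = _ := by ring
    have h5 : 32 * N * Real.log Y * ∑ f ∈ F with ¬ ∏ x, f x ≤ Y ^ (32 * N), W f ≤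
        ∑ f ∈ F, (∑ x, Real.log (f x)) * W f := by
      rw [Finset.mul_sum, Finset.sum_filter]
      refine Finset.sum_le_sum fun f hf => ?_
      have hpos : ∀ x, 0 < f x := fun x => hP _ (Fintype.mem_piFinset.1 hf x)
      have hl0 : ∀ x, 0 ≤ Real.log (f x) := fun x => Real.log_nonneg (by exact_mod_cast hpos x)
      split_ifs with hf'
      · exact mul_nonneg (Finset.sum_nonneg fun x _ => hl0 x) (hW0 f)
      · refine mul_le_mul_of_nonneg_right ?_ (hW0 f)
        rw [← Real.log_prod fun x _ => by exact_mod_cast (hpos x).ne']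
        push Not at hf'
        have h6 : ((Y ^ (32 * N) : ℕ) : ℝ) ≤ ∏ x, (f x : ℝ) := by exact_mod_cast hf'.le
        have h7 := Real.log_le_log (by positivity) h6
        push_cast at h7
        rw [Real.log_pow] at h7
        push_cast at h7
        exact h7
    have h8 : (0 : ℝ) < N * Real.log Y := by positivity
    refine le_of_not_gt fun h9 => ?_
    nlinarith [mul_lt_mul_of_pos_left h9 h8]
  have hsplit : ∑ f ∈ F, W f ≤
      ∑ f ∈ F with Function.Injective f ∧ ∏ x, f x ≤ Y ^ (32 * N), W f +
      ∑ f ∈ F with ¬ Function.Injective f, W f + ∑ f ∈ F with ¬ ∏ x, f x ≤ Y ^ (32 * N), W f := by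
    rw [Finset.sum_filter, Finset.sum_filter, Finset.sum_filter, ← Finset.sum_add_distrib,
      ← Finset.sum_add_distrib]
    refine Finset.sum_le_sum fun f _ => ?_
    have := hW0 f
    by_cases h1 : Function.Injective f <;> by_cases h2 : ∏ x, f x ≤ Y ^ (32 * N) <;>
      simp [h1, h2, this]
  rw [htot] at hsplit
  linarith

end Weights

section CollisionCount

theorem factorial_le_pow_mul_exp {r : ℕ} (hr : 1 ≤ r) :
    (r.factorial : ℝ) ≤ r ^ (r + 1) * Real.exp (1 - r) := by
  induction r, hr using Nat.le_induction with
  | base => simp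
  | succ r hr ih =>
    have hr0 : (0 : ℝ) < r := by exact_mod_cast hr
    have h1 : (r / (r + 1) : ℝ) ≤ Real.exp (-(1 / (r + 1))) := by
      have := Real.add_one_le_exp (-(1 / (r + 1) : ℝ))
      refine le_trans (le_of_eq ?_) this
      field_simp
      ring
    have h2 : (r / (r + 1) : ℝ) ^ (r + 1) ≤ Real.exp (-1) := by
      refine (pow_le_pow_left₀ (by positivity) h1 _).trans (le_of_eq ?_)
      rw [← Real.exp_nat_mul]
      congr 1
      push_cast
      field_simp
    rw [div_pow, div_le_iff₀ (by positivity)] at h2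
    rw [Nat.factorial_succ]
    push_cast
    calc ((r : ℝ) + 1) * r.factorial ≤ (r + 1) * (r ^ (r + 1) * Real.exp (1 - r)) := by gcongr
      _ ≤ (r + 1) * ((Real.exp (-1) * (r + 1) ^ (r + 1)) * Real.exp (1 - r)) := by gcongr
      _ = (r + 1) ^ (r + 1 + 1) * (Real.exp (-1) * Real.exp (1 - r)) := by ring
      _ = _ := by rw [← Real.exp_add]; ring_nf

theorem exp_neg_mul_pow_floor_ge {S : ℝ} (hS : 0 ≤ S) :
    Real.exp (-2) / (S + 1) ≤ Real.exp (-S) * (S ^ ⌊S⌋₊ / (⌊S⌋₊).factorial) := by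
  set r := ⌊S⌋₊ with hr
  have h1 : (r : ℝ) ≤ S := Nat.floor_le hS
  have h2 : S < r + 1 := Nat.lt_floor_add_one S
  rcases Nat.eq_zero_or_pos r with h0 | h0
  · rw [h0] at h2 ⊢
    simp only [pow_zero, Nat.factorial_zero, Nat.cast_one, div_one, mul_one]
    norm_num at h2
    refine (div_le_self (Real.exp_pos _).le (by linarith)).trans (Real.exp_le_exp.2 (by linarith))
  · have hr0 : (0 : ℝ) < r := by exact_mod_cast h0
    have h3 := factorial_le_pow_mul_exp h0
    calc Real.exp (-2) / (S + 1) ≤ Real.exp (-2) / r := by gcongr; linarith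
      _ = Real.exp (-(r + 1)) * (r ^ r / (r ^ (r + 1) * Real.exp (1 - r))) := by
          rw [show (-2 : ℝ) = -(r + 1) - (1 - r) by ring, Real.exp_sub, pow_succ]
          field_simp
      _ ≤ Real.exp (-S) * (S ^ r / r.factorial) := by gcongr

theorem card_le_factorial_pow {N r : ℕ} {E : Fin N → Finset ℕ} {G : Finset (Fin N × Fin r → ℕ)}
    (hG : ∀ f ∈ G, Function.Injective f ∧ ∀ i k, f (i, k) ∈ E i) (hE : ∀ i, (E i).card = r) :
    G.card ≤ r.factorial ^ N := by
  have h1 : Fintype.card (∀ i, Fin r ↪ E i) = r.factorial ^ N := by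
    rw [Fintype.card_pi]
    simp [Fintype.card_embedding_eq, hE, Nat.descFactorial_self]
  rw [← h1, ← Fintype.card_coe]
  refine Fintype.card_le_of_injective
    (fun f i => ⟨fun k => ⟨f.1 (i, k), (hG f.1 f.2).2 i k⟩, fun k l hkl => ?_⟩) ?_
  · simpa using (hG f.1 f.2).1 (Subtype.ext_iff.1 hkl)
  · intro f g hfg
    refine Subtype.ext (funext fun x => ?_)
    exact congrArg Subtype.val (DFunLike.congr_fun (congrFun hfg x.1) x.2)

variable {N A : ℕ} {a b : Fin N → ℕ}

theorem AdmissibleForms.cnt_collision_ge (h : AdmissibleForms N A a b) (hN : 1 ≤ N)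
    {J w X : ℕ} (hw : 2 ^ w = 512 * N) (hNw : 64 * w + 9 ≤ N)
    (hX : (2 ^ 2 ^ J) ^ (512 * N) ≤ X) (hX' : X < (2 ^ 2 ^ J) ^ (1024 * N))
    (hy : Real.exp (4 * N * J + 1) ≤ 2 ^ 2 ^ J) (hJ : 4 * (J + 1) ≤ 2 ^ 2 ^ J)
    (hC : ∀ i, a i + b i ≤ 2 ^ 2 ^ J) (hP : (sievePrimes A J).Nonempty) :
    X * (Real.exp (-1) / 8 * (Real.exp (-2) / (4 * J + 1)) ^ N) ≤
    cnt X fun τ => Collision a b τ ∧ ∀ p ∈ sievePrimes A J, ∀ i, ¬ p ^ 2 ∣ a i * τ + b i := by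
  classical
  set P := sievePrimes A J with hPdef
  set S := ∑ p ∈ P, (1 / p : ℝ) with hSdef
  set r := ⌊S⌋₊ with hr
  set E := Real.exp (-(N * S + 1)) with hE
  have hPm : ∀ p ∈ P, p.Prime ∧ level p < J ∧ ¬ p ∣ A := fun p hp => mem_sievePrimes.1 hp
  have hPm' : ∀ p ∈ P, p.Prime ∧ ¬ p ∣ A := fun p hp => ⟨(hPm p hp).1, (hPm p hp).2.2⟩
  have hS0 : 0 < S := Finset.sum_pos (fun p hp => by
    have : (0 : ℝ) < p := by exact_mod_cast (hPm p hp).1.pos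
    positivity) hP
  have hS4 : S ≤ 4 * J := sum_inv_le_of_level_lt fun p hp => ⟨(hPm p hp).1, (hPm p hp).2.1⟩
  have hrS : (r : ℝ) ≤ S := Nat.floor_le hS0.le
  set G := (Fintype.piFinset fun _ : Fin N × Fin r => P).filter fun f =>
    Function.Injective f ∧ ∏ x, f x ≤ (2 ^ 2 ^ J) ^ (32 * N) with hG
  have hweight : 1 / 2 * S ^ (N * r) ≤ ∑ f ∈ G, ∏ x, (1 / f x : ℝ) := by
    have h1 := half_pow_le_sum_good (ι := Fin N × Fin r) (P := P) (Y := 2 ^ 2 ^ J)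
      (fun p hp => (hPm p hp).1.pos) hN ?_ hS0 ?_ ?_ ?_
    · simpa only [Fintype.card_prod, Fintype.card_fin] using h1
    · exact (by norm_num : 2 = 2 ^ 1).le.trans
        (Nat.pow_le_pow_right (by norm_num) Nat.one_le_two_pow)
    · simp only [Fintype.card_prod, Fintype.card_fin]
      push_cast
      gcongr
    · have h2 := sum_inv_sq_le (P := P) (z := 4 * N ^ 2) (by positivity)
        fun p hp => h.lt_of_mem (hPm p hp).1 (hPm p hp).2.2
      push_cast at h2
      simpa using h2
    · have h2 := sum_log_div_le_of_level_lt (P := P) (J := J)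
        fun p hp => ⟨(hPm p hp).1, (hPm p hp).2.1⟩
      simpa [div_eq_mul_inv] using h2
  set D : (Fin N × Fin r → ℕ) → Finset ℕ := fun f => Finset.univ.image f with hD
  set β : (Fin N × Fin r → ℕ) → ℕ → Fin N :=
    fun f => Function.extend f Prod.fst fun _ => ⟨0, hN⟩ with hβ
  have hGf : ∀ f ∈ G, Function.Injective f ∧ D f ⊆ P ∧ ∏ x, f x ≤ (2 ^ 2 ^ J) ^ (32 * N) ∧
      (∀ x, β f (f x) = x.1) ∧ ∀ i, ((D f).filter fun q => β f q = i).card = r := by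
    intro f hf
    obtain ⟨h1, h2, h3⟩ := Finset.mem_filter.1 hf
    have h4 : ∀ x, β f (f x) = x.1 := fun x => h2.extend_apply _ _ _
    refine ⟨h2, ?_, h3, h4, fun i => ?_⟩
    · intro q hq
      obtain ⟨x, -, rfl⟩ := Finset.mem_image.1 hq
      exact Fintype.mem_piFinset.1 h1 x
    · have h5 : (D f).filter (fun q => β f q = i) =
          Finset.univ.image fun k : Fin r => f (i, k) := by
        ext q
        simp only [hD, Finset.mem_filter, Finset.mem_image, Finset.mem_univ, true_and]
        constructor
        · rintro ⟨⟨x, rfl⟩, h6⟩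
          rw [h4] at h6
          exact ⟨x.2, by rw [← h6]⟩
        · rintro ⟨k, rfl⟩
          exact ⟨⟨_, rfl⟩, h4 _⟩
      rw [h5, Finset.card_image_of_injective, Finset.card_univ, Fintype.card_fin]
      intro k l hkl
      simpa using h2 hkl
  set C : (Fin N × Fin r → ℕ) → ℕ → Prop :=
    fun f τ => Sifted a b (D f) (β f) P τ ∧ Collision a b τ with hC'
  have hlow : ∀ f ∈ G, 1 / 4 * (X * E) * ∏ x, (1 / f x : ℝ) ≤ cnt X (C f) := by
    intro f hf
    obtain ⟨h1, h2, h3, h4, h5⟩ := hGf f hf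
    have h6 : ∏ q ∈ D f, q = ∏ x, f x := Finset.prod_image fun x _ y _ hxy => h1 hxy
    have h7 : ∏ q ∈ D f, (q : ℝ) = ∏ x, (f x : ℝ) := Finset.prod_image fun x _ y _ hxy => h1 hxy
    have h8 := h.good_count hN h2 h5 hw hNw hX hX' (by rw [h6]; exact h3) hy hJ hC
    refine le_trans (le_of_eq ?_) h8
    rw [h7, Finset.prod_div_distrib, Finset.prod_const_one]
    ring
  have hup : ∑ f ∈ G, cnt X (C f) ≤ (r.factorial ^ N : ℕ) * cnt X fun τ =>
      Collision a b τ ∧ ∀ p ∈ P, ∀ i, ¬ p ^ 2 ∣ a i * τ + b i := by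
    refine sum_cnt_le_mul_cnt ?_ ?_
    · intro f hf τ _ hc
      exact ⟨hc.2, fun p hp i => hc.1.not_sq_dvd h hPm' i hp⟩
    · intro τ _ G' hG' hGC
      rcases G'.eq_empty_or_nonempty with rfl | ⟨f₀, hf₀⟩
      · simp
      · have hs₀ := (hGC f₀ hf₀).1
        refine card_le_factorial_pow (E := fun i => P.filter fun p => p ∣ a i * τ + b i) ?_ ?_
        · intro f hf
          have hs := (hGC f hf).1
          obtain ⟨h1, h2, h3, h4, h5⟩ := hGf f (hG' hf)
          refine ⟨h1, fun i k => ?_⟩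
          have hmem : f (i, k) ∈ D f := Finset.mem_image_of_mem _ (Finset.mem_univ _)
          have := hs.1 _ hmem
          rw [h4] at this
          exact Finset.mem_filter.2 ⟨h2 hmem, this⟩
        · intro i
          obtain ⟨h1, h2, h3, h4, h5⟩ := hGf f₀ (hG' hf₀)
          rw [← h5 i]
          congr 1
          ext p
          rw [Finset.mem_filter, Finset.mem_filter]
          constructor
          · rintro ⟨hp, hd⟩
            exact (hs₀.dvd_iff h hPm' i hp).1 hd
          · intro hp
            exact ⟨h2 hp.1, (hs₀.dvd_iff h hPm' i (h2 hp.1)).2 hp⟩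
  set Z := cnt X fun τ => Collision a b τ ∧ ∀ p ∈ P, ∀ i, ¬ p ^ 2 ∣ a i * τ + b i with hZ
  have hE' : E = Real.exp (-1) * Real.exp (-S) ^ N := by
    rw [hE, ← Real.exp_nat_mul, ← Real.exp_add]
    congr 1
    ring
  have hfac : (0 : ℝ) < (r.factorial : ℝ) ^ N := by positivity
  have hmain : X * E / 8 * S ^ (N * r) ≤ (r.factorial : ℝ) ^ N * Z := by
    have h1 := (Finset.sum_le_sum hlow).trans hup
    rw [← Finset.mul_sum] at h1
    push_cast at h1
    have h2 : (0 : ℝ) ≤ 1 / 4 * (X * E) := by positivity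
    have h3 := mul_le_mul_of_nonneg_left hweight h2
    linarith
  have hfin : X * (Real.exp (-1) / 8 * (Real.exp (-S) * (S ^ r / r.factorial)) ^ N) ≤ Z := by
    rw [← mul_le_mul_iff_right₀ hfac]
    refine le_trans (le_of_eq ?_) hmain
    rw [hE', mul_pow, div_pow, ← pow_mul, mul_comm r N]
    field_simp
  refine le_trans ?_ hfin
  have h1 := exp_neg_mul_pow_floor_ge hS0.le
  have h2 : Real.exp (-2) / (4 * J + 1) ≤ Real.exp (-2) / (S + 1) := by gcongr
  have h3 := h2.trans h1
  gcongr

end CollisionCount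

open Filter in
theorem eventually_level_conditions {N : ℕ} (hN : 1 ≤ N) : ∀ᶠ J : ℕ in atTop,
    Real.exp (4 * N * J + 1) ≤ 2 ^ 2 ^ J ∧ 4 * (J + 1) ≤ 2 ^ 2 ^ J ∧
    (1 : ℝ) / 2 ^ J + 3 * N / 2 ^ 2 ^ J ≤
      Real.exp (-1) / 8 * (Real.exp (-2) / (4 * J + 1)) ^ N := by
  have hN0 : (0 : ℝ) < N := by exact_mod_cast hN
  have h1 := (tendsto_pow_const_div_const_pow_of_one_lt 1
    (one_lt_two : (1 : ℝ) < 2)).eventually_le_const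
    (show (0 : ℝ) < Real.log 2 / (5 * N) by positivity)
  have h2 := (tendsto_pow_const_div_const_pow_of_one_lt N
    (one_lt_two : (1 : ℝ) < 2)).eventually_le_const
    (show (0 : ℝ) < Real.exp (-1) / 8 * Real.exp (-2) ^ N / ((1 + 3 * N) * 5 ^ N) by positivity)
  filter_upwards [h1, h2, eventually_ge_atTop 2] with J h1 h2 hJ
  have hJ1 : (1 : ℝ) ≤ J := by exact_mod_cast (by omega : 1 ≤ J)
  have h2J : (0 : ℝ) < 2 ^ J := by positivity
  refine ⟨?_, ?_, ?_⟩
  · rw [← Real.exp_log (show (0 : ℝ) < 2 ^ 2 ^ J by positivity), Real.log_pow]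
    refine Real.exp_le_exp.2 ?_
    rw [pow_one, div_le_div_iff₀ h2J (by positivity)] at h1
    push_cast
    have : (1 : ℝ) ≤ N := by exact_mod_cast hN
    nlinarith [mul_le_mul this hJ1 zero_le_one hN0.le]
  · have h3 : J + 1 ≤ 2 ^ J := Nat.lt_two_pow_self
    have h4 : J + 2 ≤ 2 ^ J := by
      obtain ⟨k, rfl⟩ : ∃ k, J = k + 2 := ⟨J - 2, by omega⟩
      have : k + 1 ≤ 2 ^ k := Nat.lt_two_pow_self
      rw [pow_add]
      omega
    calc 4 * (J + 1) ≤ 2 ^ (J + 2) := by rw [pow_add]; omega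
      _ ≤ 2 ^ 2 ^ J := Nat.pow_le_pow_right (by norm_num) h4
  · have h3 : (2 : ℝ) ^ J ≤ 2 ^ 2 ^ J := pow_le_pow_right₀ (by norm_num) Nat.lt_two_pow_self.le
    have h4 : (1 : ℝ) / 2 ^ J + 3 * N / 2 ^ 2 ^ J ≤ (1 + 3 * N) / 2 ^ J := by
      rw [add_div]
      gcongr
    refine h4.trans ?_
    rw [div_le_div_iff₀ h2J (by positivity)] at h2
    rw [div_pow, ← mul_div_assoc, div_le_div_iff₀ h2J (by positivity)]
    calc (1 + 3 * N : ℝ) * (4 * J + 1) ^ N ≤ (1 + 3 * N : ℝ) * (5 * J) ^ N := by gcongr; linarith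
      _ = (J : ℝ) ^ N * ((1 + 3 * N) * 5 ^ N) := by rw [mul_pow]; ring
      _ ≤ _ := h2

section Squarefree

variable {N A : ℕ} {a b : Fin N → ℕ}

theorem AdmissibleForms.cnt_sq_dvd_le (h : AdmissibleForms N A a b) (hN : 1 ≤ N) {J X : ℕ}
    (hX : (2 ^ 2 ^ J) ^ 3 ≤ X) (hC : ∀ i, a i + b i ≤ 2 ^ 2 ^ J) :
    cnt X (fun τ => ∃ i, ∃ p, p.Prime ∧ ¬ p ∣ A ∧ 2 ^ 2 ^ J ≤ p ∧ p ^ 2 ∣ a i * τ + b i) ≤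
      X * (3 * N / 2 ^ 2 ^ J) := by
  classical
  set y : ℕ := 2 ^ 2 ^ J with hy
  have hy2 : 2 ≤ y :=
    (by norm_num : 2 = 2 ^ 1).le.trans
        (Nat.pow_le_pow_right (by norm_num) Nat.one_le_two_pow)
  set E := (Finset.range (X / y + 1)).filter fun p => p.Prime ∧ ¬ p ∣ A ∧ y ≤ p with hE
  have hX0 : 0 < X := lt_of_lt_of_le (by positivity) hX
  have h1 : ((1 : ℕ) : ℝ) * cnt X (fun τ => ∃ i, ∃ p, p.Prime ∧ ¬ p ∣ A ∧ y ≤ p ∧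
      p ^ 2 ∣ a i * τ + b i) ≤
      ∑ x ∈ Finset.univ ×ˢ E, cnt X (fun τ => x.2 ^ 2 ∣ a x.1 * τ + b x.1) := by
    refine mul_cnt_le_sum_cnt ?_
    rintro τ hτ ⟨i, p, hp, hpA, hyp, hd⟩
    have h2 : p ^ 2 ≤ y * X := by
      refine (Nat.le_of_dvd (Nat.pos_of_ne_zero (h.ne_zero hN i τ)) hd).trans ?_
      calc a i * τ + b i ≤ (a i + b i) * X := by nlinarith
        _ ≤ y * X := by gcongr; exact hC i
    have h3 : p * y ≤ X := by
      refine (Nat.pow_le_pow_iff_left two_ne_zero).1 ?_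
      calc (p * y) ^ 2 = p ^ 2 * y ^ 2 := by ring
        _ ≤ y * X * y ^ 2 := by gcongr
        _ = y ^ 3 * X := by ring
        _ ≤ X * X := by gcongr
        _ = X ^ 2 := by ring
    refine ⟨{(i, p)}, Finset.singleton_subset_iff.2 (Finset.mem_product.2 ⟨Finset.mem_univ _,
      Finset.mem_filter.2 ⟨?_, hp, hpA, hyp⟩⟩), le_rfl, by simpa using hd⟩
    exact Finset.mem_range.2 (Nat.lt_succ_of_le ((Nat.le_div_iff_mul_le (by omega)).2 h3))
  rw [Nat.cast_one, one_mul, Finset.sum_product] at h1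
  have hEm : ∀ p ∈ E, p.Prime ∧ ¬ p ∣ A ∧ y ≤ p := fun p hp => (Finset.mem_filter.1 hp).2
  have h4 : ∀ i : Fin N, ∀ p ∈ E, cnt X (fun τ => p ^ 2 ∣ a i * τ + b i) ≤ X * (1 / p ^ 2) + 1 := by
    intro i p hp
    obtain ⟨hpp, hpA, -⟩ := hEm p hp
    have hc : (a i).Coprime (p ^ 2) :=
      (((Nat.Prime.coprime_iff_not_dvd hpp).2 (h.coeff p hpp hpA i)).pow_left 2).symm
    have h5 := _root_.abs_cnt_sub_le (P := fun τ => p ^ 2 ∣ a i * τ + b i) (pow_pos hpp.pos 2)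
      (fun τ => dvd_linear_add_period (p ^ 2) (a i) (b i) τ) X
    rw [cnt_dvd_linear (pow_pos hpp.pos 2) hc] at h5
    push_cast at h5
    linarith [(abs_le.1 h5).2]
  have hy0 : (0 : ℝ) < y := by positivity
  have h6 : ∑ p ∈ E, (1 / p ^ 2 : ℝ) ≤ 2 / y := by
    have h7 := sum_inv_sq_le (P := E) (z := y - 1) (by omega) fun p hp => by
      have := (hEm p hp).2.2
      omega
    refine h7.trans ?_
    have h8 : (2 : ℝ) ≤ y := by exact_mod_cast hy2
    rw [Nat.cast_sub (by omega), Nat.cast_one, div_le_div_iff₀ (by linarith) hy0]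
    linarith
  have h7 : (E.card : ℝ) ≤ X / y := by
    have h8 : E.card ≤ X / y := by
      have h9 : E ⊆ Finset.Icc 1 (X / y) := fun p hp => by
        have h10 := Finset.mem_range.1 (Finset.mem_filter.1 hp).1
        have := (hEm p hp).1.pos
        exact Finset.mem_Icc.2 ⟨this, by omega⟩
      simpa using Finset.card_le_card h9
    exact (Nat.cast_le.2 h8).trans Nat.cast_div_le
  have h8 : ∀ i : Fin N, ∑ p ∈ E, cnt X (fun τ => p ^ 2 ∣ a i * τ + b i) ≤ X * (3 / y) := by
    intro i
    refine (Finset.sum_le_sum (h4 i)).trans ?_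
    rw [Finset.sum_add_distrib, ← Finset.mul_sum, Finset.sum_const, nsmul_eq_mul, mul_one]
    have := mul_le_mul_of_nonneg_left h6 (Nat.cast_nonneg X : (0 : ℝ) ≤ X)
    refine (add_le_add this h7).trans (le_of_eq ?_)
    ring
  refine h1.trans ((Finset.sum_le_card_nsmul _ _ _ fun i _ => h8 i).trans (le_of_eq ?_))
  rw [Finset.card_univ, Fintype.card_fin, nsmul_eq_mul, hy]
  push_cast
  ring

theorem AdmissibleForms.cnt_squarefree_collision_ge (h : AdmissibleForms N A a b) (hN : 1 ≤ N)
    {w : ℕ} (hw : 2 ^ w = 512 * N) (hNw : 64 * w + 9 ≤ N) :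
    ∃ X₀ : ℕ, ∀ X : ℕ, X₀ ≤ X → X / Real.log X ≤ cnt X fun τ => ∃ i j, i ≠ j ∧
      Squarefree (a i * τ + b i) ∧ Squarefree (a j * τ + b j) ∧
      (a i * τ + b i).primeFactors.card = (a j * τ + b j).primeFactors.card := by
  obtain ⟨J₁, hJ₁⟩ := Filter.eventually_atTop.1 (eventually_level_conditions hN)
  obtain ⟨q, hqA, hq⟩ := Nat.exists_infinite_primes (A + 1)
  set J₀ := J₁ + (level q + 1) + ∑ i, (a i + b i) with hJ₀
  refine ⟨2 ^ 2 ^ (J₀ + w), fun X hX => ?_⟩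
  have hX2 : 2 ≤ X := le_trans
    ((by norm_num : 2 = 2 ^ 1).le.trans
        (Nat.pow_le_pow_right (by norm_num) Nat.one_le_two_pow)) hX
  have hlev : J₀ + w ≤ level X := by
    by_contra! h1
    exact absurd ((level_lt_iff hX2).1 h1) (not_lt.2 hX)
  obtain ⟨J, hJ⟩ : ∃ J, level X = J + w := ⟨level X - w, by omega⟩
  have hJJ : J₀ ≤ J := by omega
  obtain ⟨hy, hJ4, hε⟩ := hJ₁ J (by omega)
  have hXl := two_pow_two_pow_level_le hX2
  have hXu := lt_two_pow_two_pow_level_succ X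
  rw [hJ] at hXl hXu
  rw [pow_add, pow_mul, hw] at hXl
  rw [add_assoc, pow_add, pow_succ, hw, pow_mul, show 512 * N * 2 = 1024 * N by ring] at hXu
  have hC : ∀ i, a i + b i ≤ 2 ^ 2 ^ J := by
    intro i
    have h1 : a i + b i ≤ ∑ i, (a i + b i) :=
      Finset.single_le_sum (f := fun i => a i + b i) (fun _ _ => Nat.zero_le _) (Finset.mem_univ i)
    have h2 : J < 2 ^ J := Nat.lt_two_pow_self
    have h3 : 2 ^ J < 2 ^ 2 ^ J := Nat.lt_two_pow_self
    omega
  have hP : (sievePrimes A J).Nonempty := by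
    refine ⟨q, mem_sievePrimes.2 ⟨hq, by omega, fun hd => ?_⟩⟩
    have := Nat.le_of_dvd h.pos hd
    omega
  have h1 := h.cnt_collision_ge hN hw hNw hXl hXu hy hJ4 hC hP
  have h2 := h.cnt_sq_dvd_le hN (J := J) (X := X)
    ((Nat.pow_le_pow_right (by positivity) (by omega)).trans hXl) hC
  have h3 : cnt X (fun τ => Collision a b τ ∧ ∀ p ∈ sievePrimes A J, ∀ i,
      ¬ p ^ 2 ∣ a i * τ + b i) ≤ cnt X (fun τ => ∃ i j, i ≠ j ∧
      Squarefree (a i * τ + b i) ∧ Squarefree (a j * τ + b j) ∧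
      (a i * τ + b i).primeFactors.card = (a j * τ + b j).primeFactors.card) +
      cnt X (fun τ => ∃ i, ∃ p, p.Prime ∧ ¬ p ∣ A ∧ 2 ^ 2 ^ J ≤ p ∧ p ^ 2 ∣ a i * τ + b i) := by
    refine cnt_le_add fun τ _ hτ => or_iff_not_imp_right.2 fun hsq => ?_
    obtain ⟨⟨i, j, hij, hcard⟩, hsmall⟩ := hτ
    have h4 : ∀ i, Squarefree (a i * τ + b i) := by
      intro i
      rw [Nat.squarefree_iff_prime_squarefree]
      intro p hp hd
      have hpA := h.not_dvd_of_dvd_value hp ((dvd_mul_right p p).trans hd)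
      rw [← sq] at hd
      by_cases hlt : p < 2 ^ 2 ^ J
      · exact hsmall p (mem_sievePrimes.2 ⟨hp, (level_lt_iff hp.two_le).2 hlt, hpA⟩) i hd
      · exact hsq ⟨i, p, hp, hpA, not_lt.1 hlt, hd⟩
    exact ⟨i, j, hij, h4 i, h4 j, hcard⟩
  have hX0 : (0 : ℝ) ≤ X := Nat.cast_nonneg X
  have h4 : (X : ℝ) / Real.log X ≤ X * (1 / 2 ^ J) := by
    have h5 : (2 : ℝ) ^ J ≤ Real.log X := by
      have h6 : ((((2 ^ 2 ^ J) ^ (512 * N) : ℕ)) : ℝ) ≤ X := Nat.cast_le.2 hXl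
      have h7 := Real.log_le_log (by positivity) h6
      push_cast at h7
      rw [Real.log_pow, Real.log_pow] at h7
      push_cast at h7
      refine le_trans ?_ h7
      have h8 := Real.log_two_gt_d9
      have h9 : (1 : ℝ) ≤ N := by exact_mod_cast hN
      have h10 : (0 : ℝ) < 2 ^ J := by positivity
      have h11 : (1 : ℝ) ≤ 512 * N * Real.log 2 := by nlinarith
      nlinarith
    rw [mul_one_div]
    gcongr
  have h5 := mul_le_mul_of_nonneg_left hε hX0
  rw [mul_add] at h5
  linarith

end Squarefree

section CoprimeDivisors

theorem dk_mul_of_coprime (k : ℕ) {m n : ℕ} (h : m.Coprime n) :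
    dk k (m * n) = dk k m * dk k n := by
  unfold dk
  rw [← Finset.card_product]
  symm
  refine Finset.card_bij (fun x _ => x.1 * x.2) ?_ ?_ ?_
  · rintro ⟨x, y⟩ hxy
    simp only [Finset.mem_product, Finset.mem_filter, Nat.mem_divisors] at hxy ⊢
    exact ⟨⟨mul_dvd_mul hxy.1.1.1 hxy.2.1.1, mul_ne_zero hxy.1.1.2 hxy.2.1.2⟩,
      Nat.Coprime.mul_left hxy.1.2 hxy.2.2⟩
  · rintro ⟨x, y⟩ hxy ⟨x', y'⟩ hxy' heq
    simp only [Finset.mem_product, Finset.mem_filter, Nat.mem_divisors] at hxy hxy' heq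
    have key : ∀ {x y : ℕ}, x ∣ m → y ∣ n → (x * y).gcd m = x ∧ (x * y).gcd n = y := by
      intro x y hx hy
      constructor
      · rw [Nat.Coprime.gcd_mul_right_cancel x (h.symm.coprime_dvd_left hy)]
        exact Nat.gcd_eq_left hx
      · rw [Nat.Coprime.gcd_mul_left_cancel y (h.coprime_dvd_left hx)]
        exact Nat.gcd_eq_left hy
    have h1 := key hxy.1.1.1 hxy.2.1.1
    have h2 := key hxy'.1.1.1 hxy'.2.1.1
    exact Prod.ext (h1.1.symm.trans (heq ▸ h2.1)) (h1.2.symm.trans (heq ▸ h2.2))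
  · intro d hd
    simp only [Finset.mem_filter, Nat.mem_divisors] at hd
    obtain ⟨⟨hd, h0⟩, hk⟩ := hd
    obtain ⟨x, y, hx, hy, rfl⟩ := (Nat.dvd_mul).1 hd
    have h0' := mul_ne_zero_iff.1 h0
    refine ⟨(x, y), ?_, rfl⟩
    simp only [Finset.mem_product, Finset.mem_filter, Nat.mem_divisors]
    exact ⟨⟨⟨hx, h0'.1⟩, Nat.Coprime.coprime_mul_right hk⟩,
      ⟨hy, h0'.2⟩, Nat.Coprime.coprime_mul_left hk⟩

theorem dk_one (k : ℕ) : dk k 1 = 1 := by simp [dk, Finset.filter_singleton]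

theorem dk_prime_pow (k : ℕ) {p : ℕ} (hp : p.Prime) (e : ℕ) :
    dk k (p ^ e) = if p ∣ k then 1 else e + 1 := by
  unfold dk
  rw [Nat.divisors_prime_pow hp, Finset.filter_map, Finset.card_map]
  split_ifs with h
  · rw [Finset.card_eq_one]
    refine ⟨0, Finset.ext fun i => ?_⟩
    simp only [Finset.mem_filter, Finset.mem_range, Function.comp, Function.Embedding.coeFn_mk,
      Finset.mem_singleton]
    constructor
    · rintro ⟨-, hi⟩
      by_contra h0
      have := Nat.Coprime.coprime_dvd_left (dvd_pow_self p h0) hi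
      exact (Nat.Prime.coprime_iff_not_dvd hp).1 this h
    · rintro rfl
      simp
  · rw [Finset.filter_true_of_mem, Finset.card_range]
    intro i _
    exact ((Nat.Prime.coprime_iff_not_dvd hp).2 h).pow_left i

theorem dk_eq_prod (k : ℕ) {n : ℕ} (hn : n ≠ 0) {S : Finset ℕ} (hS : n.primeFactors ⊆ S) :
    dk k n = ∏ p ∈ S with ¬ p ∣ k, (n.factorization p + 1) := by
  rw [Nat.multiplicative_factorization (dk k) (fun x y h => dk_mul_of_coprime k h) (dk_one k) hn,
    Finsupp.prod, Nat.support_factorization, Finset.prod_filter]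
  rw [← Finset.prod_subset hS]
  · refine Finset.prod_congr rfl fun p hp => ?_
    rw [dk_prime_pow k (Nat.prime_of_mem_primeFactors hp)]
    split_ifs <;> rfl
  · intro p _ hp
    rw [← Nat.support_factorization, Finsupp.notMem_support_iff] at hp
    rw [hp]
    simp

theorem dk_squarefree {k n : ℕ} (hn : Squarefree n) (hk : n.Coprime k) :
    dk k n = 2 ^ n.primeFactors.card := by
  rw [dk_eq_prod k hn.ne_zero subset_rfl, Finset.filter_true_of_mem, ← Finset.prod_const]
  · refine Finset.prod_congr rfl fun p hp => ?_
    rw [Nat.factorization_eq_one_of_squarefree hn (Nat.prime_of_mem_primeFactors hp)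
      (Nat.dvd_of_mem_primeFactors hp)]
  · intro p hp hd
    exact (Nat.Prime.coprime_iff_not_dvd (Nat.prime_of_mem_primeFactors hp)).1
      (hk.coprime_dvd_left (Nat.dvd_of_mem_primeFactors hp)) hd

end CoprimeDivisors

section ConsecutiveDifferences

theorem exists_modEq_prime_pow {S : Finset ℕ} (hS : ∀ p ∈ S, p.Prime) (a f : ℕ → ℕ) :
    ∃ x : ℕ, ∀ p ∈ S, x ≡ a p [MOD p ^ f p] := by
  obtain ⟨x, hx⟩ := Nat.chineseRemainderOfFinset a (fun p => p ^ f p) S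
    (fun p hp => pow_ne_zero _ (hS p hp).ne_zero)
    (fun p hp q hq hpq => Nat.Coprime.pow _ _ ((Nat.coprime_primes (hS p hp) (hS q hq)).2 hpq))
  exact ⟨x, hx⟩

theorem pow_dvd_iff_of_pow_dvd_sub {p x y : ℤ} {b : ℕ} (h : p ^ b ∣ x - y) (hy : ¬ p ^ b ∣ y)
    (k : ℕ) : p ^ k ∣ x ↔ p ^ k ∣ y := by
  rcases le_total k b with hk | hk
  · exact dvd_iff_dvd_of_dvd_sub ((pow_dvd_pow p hk).trans h)
  · have hx : ¬ p ^ b ∣ x := fun hx => hy ((dvd_iff_dvd_of_dvd_sub h).1 hx)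
    exact ⟨fun hd => (hx ((pow_dvd_pow p hk).trans hd)).elim,
      fun hd => (hy ((pow_dvd_pow p hk).trans hd)).elim⟩

theorem exists_residue_notMem {p m : ℕ} (hm : m < p) (θ : ℕ → ℕ) :
    ∃ r, ∀ i < m, ¬ θ i ≡ r [MOD p] := by
  obtain ⟨r, hr, hr'⟩ := Finset.exists_mem_notMem_of_card_lt_card
    (s := (Finset.range m).image fun i => θ i % p) (t := Finset.range p)
    (Finset.card_image_le.trans_lt (by simpa using hm))
  refine ⟨r, fun i hi h => hr' ?_⟩
  rw [Finset.mem_image]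
  exact ⟨i, Finset.mem_range.2 hi, Eq.trans h (Nat.mod_eq_of_lt (Finset.mem_range.1 hr))⟩

/-- A sequence with prescribed residues modulo powers of the primes in `Z`, in which at most one
pair of terms collides modulo any given prime outside `Z`. -/
theorem exists_seq_modEq_of_unique_collision {N : ℕ} {Z : Finset ℕ} (hZ : ∀ p ∈ Z, p.Prime)
    (hN : ∀ p, p.Prime → p ≤ N → p ∈ Z) (h2Z : 2 ∈ Z) {E : ℕ}
    {e : ℕ → ℕ → ℕ} (hE : ∀ p ∈ Z, ∀ i < N, e p i < E)
    (he : ∀ p ∈ Z, ∀ i < N, ∀ j < N, e p i = e p j → i = j) (m : ℕ) (hm : m ≤ N) :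
    ∃ θ : ℕ → ℕ, (∀ i < m, ∀ p ∈ Z, θ i ≡ p ^ e p i [MOD p ^ E]) ∧
      ∀ p, p.Prime → p ∉ Z → ∀ i j l k, i < j → j < m → l < k → k < m →
        θ i ≡ θ j [MOD p] → θ l ≡ θ k [MOD p] → i = l ∧ j = k := by
  induction m with
  | zero => exact ⟨fun _ => 0, by simp, by simp⟩
  | succ m ih =>
    obtain ⟨θ, h1, h2⟩ := ih (by omega)
    set M := ∑ i ∈ Finset.range m, θ i with hM
    have hθM : ∀ i < m, θ i ≤ M := fun i hi =>
      Finset.single_le_sum (f := θ) (fun _ _ => Nat.zero_le _) (Finset.mem_range.2 hi)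
    have hr : ∀ p, ∃ r, p.Prime → p ∉ Z → ∀ i < m, ¬ θ i ≡ r [MOD p] := by
      intro p
      by_cases hp : p.Prime ∧ p ∉ Z
      · have : m < p := by
          by_contra h
          exact hp.2 (hN p hp.1 (by omega))
        obtain ⟨r, hr⟩ := exists_residue_notMem this θ
        exact ⟨r, fun _ _ => hr⟩
      · exact ⟨0, fun h h' => (hp ⟨h, h'⟩).elim⟩
    choose r hr using hr
    obtain ⟨t, ht⟩ := exists_modEq_prime_pow
      (S := Z ∪ (Finset.range (M + 1)).filter Nat.Prime)
      (by
        intro p hp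
        rcases Finset.mem_union.1 hp with hp | hp
        · exact hZ p hp
        · exact (Finset.mem_filter.1 hp).2)
      (fun p => if p ∈ Z then p ^ e p m else r p) (fun p => if p ∈ Z then E else 1)
    have ht1 : ∀ p ∈ Z, t ≡ p ^ e p m [MOD p ^ E] := by
      intro p hp
      simpa [hp] using ht p (Finset.mem_union_left _ hp)
    have ht2 : ∀ p, p.Prime → p ∉ Z → p ≤ M → ∀ i < m, ¬ θ i ≡ t [MOD p] := by
      intro p hp hpZ hpM i hi h
      have := ht p (Finset.mem_union_right _
        (Finset.mem_filter.2 ⟨Finset.mem_range.2 (by omega), hp⟩))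
      simp only [hpZ, if_false, pow_one] at this
      exact hr p hp hpZ i hi (h.trans this)
    have hlarge : ∀ p, M < p → ∀ i < m, ∀ j < m, θ i ≡ θ j [MOD p] → i = j := by
      intro p hpM i hi j hj h
      have h3 : θ i = θ j := by
        rwa [Nat.ModEq, Nat.mod_eq_of_lt ((hθM i hi).trans_lt hpM),
          Nat.mod_eq_of_lt ((hθM j hj).trans_lt hpM)] at h
      refine he 2 h2Z i (by omega) j (by omega) ?_
      have h4 := (h1 i hi 2 h2Z).symm.trans (h3 ▸ h1 j hj 2 h2Z)
      have h5 : ∀ i < N, 2 ^ e 2 i < 2 ^ E := fun i hi =>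
        Nat.pow_lt_pow_right (by norm_num) (hE 2 h2Z i hi)
      rw [Nat.ModEq, Nat.mod_eq_of_lt (h5 i (by omega)), Nat.mod_eq_of_lt (h5 j (by omega))] at h4
      exact Nat.pow_right_injective le_rfl h4
    have hnew : ∀ p, p.Prime → p ∉ Z → ∀ i < m, θ i ≡ t [MOD p] → M < p := by
      intro p hp hpZ i hi h
      by_contra h'
      exact ht2 p hp hpZ (by omega) i hi h
    refine ⟨Function.update θ m t, ?_, ?_⟩
    · intro i hi p hp
      rcases Nat.lt_succ_iff_lt_or_eq.1 hi with hi | rfl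
      · rw [Function.update_of_ne hi.ne]
        exact h1 i hi p hp
      · rw [Function.update_self]
        exact ht1 p hp
    · intro p hp hpZ i j l k hij hj hlk hk h h'
      rw [Function.update_of_ne (by omega)] at h h'
      rcases Nat.lt_succ_iff_lt_or_eq.1 hj with hj | rfl <;>
        rcases Nat.lt_succ_iff_lt_or_eq.1 hk with hk | rfl
      · rw [Function.update_of_ne (by omega)] at h h'
        exact h2 p hp hpZ i j l k hij hj hlk hk h h'
      · rw [Function.update_of_ne (by omega)] at h
        rw [Function.update_self] at h'
        exact (hij.ne (hlarge p (hnew p hp hpZ l hlk h') i (by omega) j hj h)).elim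
      · rw [Function.update_of_ne (by omega)] at h'
        rw [Function.update_self] at h
        exact (hlk.ne (hlarge p (hnew p hp hpZ i hij h) l (by omega) k hk h')).elim
      · rw [Function.update_self] at h h'
        exact ⟨hlarge p (hnew p hp hpZ i hij h) i hij l hlk (h.trans h'.symm), rfl⟩

theorem factorization_eq_of_pow_dvd_iff {p x e : ℕ} (hp : p.Prime) (hx : x ≠ 0)
    (h : ∀ k, p ^ k ∣ x ↔ k ≤ e) : x.factorization p = e := by
  have h' := fun k => (hp.pow_dvd_iff_le_factorization (k := k) hx).symm.trans (h k)
  exact le_antisymm ((h' _).1 le_rfl) ((h' _).2 le_rfl)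

/-- `N` positive integers with prescribed valuations at the primes of `Z`, any difference of which
divides both terms, and taking at most one nonzero valuation at every other prime. -/
theorem exists_seq_sub_dvd {N : ℕ} {Z : Finset ℕ} (hZ : ∀ p ∈ Z, p.Prime)
    (hN : ∀ p, p.Prime → p ≤ N → p ∈ Z) (h2Z : 2 ∈ Z) (e : ℕ → ℕ → ℕ)
    (he : ∀ p ∈ Z, ∀ i < N, ∀ j < N, e p i = e p j → i = j) :
    ∃ n : ℕ → ℕ, (∀ i < N, n i ≠ 0) ∧ (∀ p ∈ Z, ∀ i < N, (n i).factorization p = e p i) ∧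
      (∀ i < N, ∀ j < N, n j < n i → n i - n j ∣ n j) ∧
      ∀ p, p.Prime → p ∉ Z → ∃ v, ∀ i < N, (n i).factorization p = 0 ∨
        (n i).factorization p = v := by
  obtain ⟨E, hE⟩ : ∃ E, ∀ p ∈ Z, ∀ i < N, e p i < E := by
    refine ⟨∑ p ∈ Z, ∑ i ∈ Finset.range N, e p i + 1, fun p hp i hi => Nat.lt_succ_of_le ?_⟩
    exact (Finset.single_le_sum (f := e p) (fun _ _ => Nat.zero_le _)
      (Finset.mem_range.2 hi)).trans
      (Finset.single_le_sum (f := fun p => ∑ i ∈ Finset.range N, e p i)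
        (fun _ _ => Nat.zero_le _) hp)
  obtain ⟨θ, h1, h2⟩ := exists_seq_modEq_of_unique_collision hZ hN h2Z hE he N le_rfl
  set M := ∑ i ∈ Finset.range N, θ i with hM
  have hθM : ∀ i < N, θ i ≤ M := fun i hi =>
    Finset.single_le_sum (f := θ) (fun _ _ => Nat.zero_le _) (Finset.mem_range.2 hi)
  have hr : ∀ p, ∃ r : ℕ, p.Prime → p ∉ Z → ∀ i j, i < j → j < N → θ i ≡ θ j [MOD p] →
      (p : ℤ) ^ (M + 1) ∣ r + θ i - (θ j - θ i) ∧
        (p : ℤ) ^ (M + 1) ∣ r + θ j - 2 * (θ j - θ i) := by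
    intro p
    by_cases hp : p.Prime ∧ ∃ i j, i < j ∧ j < N ∧ θ i ≡ θ j [MOD p]
    · obtain ⟨hp, i, j, hij, hj, h⟩ := hp
      have hp1 : 1 ≤ p ^ (M + 1) := Nat.one_le_pow _ _ hp.pos
      refine ⟨θ j + 2 * θ i * (p ^ (M + 1) - 1), fun _ hpZ i' j' hij' hj' h' => ?_⟩
      obtain ⟨rfl, rfl⟩ := h2 p hp hpZ i' j' i j hij' hj' hij hj h' h
      push_cast [Nat.cast_sub hp1]
      constructor <;> exact ⟨2 * θ i', by ring⟩
    · exact ⟨0, fun h _ i j hij hj h' => (hp ⟨h, i, j, hij, hj, h'⟩).elim⟩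
  choose r hr using hr
  obtain ⟨T, hT⟩ := exists_modEq_prime_pow
    (S := Z ∪ (Finset.range (M + 1)).filter Nat.Prime)
    (by
      intro p hp
      rcases Finset.mem_union.1 hp with hp | hp
      · exact hZ p hp
      · exact (Finset.mem_filter.1 hp).2)
    (fun p => if p ∈ Z then 0 else r p) (fun p => if p ∈ Z then E else M + 1)
  have hinj : ∀ i < N, ∀ j < N, θ i = θ j → i = j := by
    intro i hi j hj h3
    refine he 2 h2Z i hi j hj ?_
    have h4 := (h1 i hi 2 h2Z).symm.trans (h3 ▸ h1 j hj 2 h2Z)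
    have h5 : ∀ i < N, 2 ^ e 2 i < 2 ^ E := fun i hi =>
      Nat.pow_lt_pow_right (by norm_num) (hE 2 h2Z i hi)
    rw [Nat.ModEq, Nat.mod_eq_of_lt (h5 i hi), Nat.mod_eq_of_lt (h5 j hj)] at h4
    exact Nat.pow_right_injective le_rfl h4
  have hplan : ∀ p ∈ Z, ∀ i < N, ∀ k, p ^ k ∣ T + θ i ↔ k ≤ e p i := by
    intro p hp i hi k
    have h3 : T + θ i ≡ p ^ e p i [MOD p ^ E] := by
      have := hT p (Finset.mem_union_left _ hp)
      simp only [hp, if_true] at this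
      simpa using this.add (h1 i hi p hp)
    have h4 := pow_dvd_iff_of_pow_dvd_sub (p := p) (b := E) (x := (T + θ i : ℕ))
      (y := (p ^ e p i : ℕ)) (by exact_mod_cast (Nat.modEq_iff_dvd.1 h3.symm))
      (by
        norm_cast
        rw [Nat.pow_dvd_pow_iff_le_right (hZ p hp).one_lt]
        exact (hE p hp i hi).not_ge) k
    norm_cast at h4
    rw [h4, Nat.pow_dvd_pow_iff_le_right (hZ p hp).one_lt]
  have hne : ∀ i < N, T + θ i ≠ 0 := by
    intro i hi h0
    have := (hplan 2 h2Z i hi (e 2 i + 1)).1 (h0 ▸ dvd_zero _)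
    omega
  have hcol : ∀ p, p.Prime → p ∉ Z → ∀ i j, i < j → j < N → θ i ≡ θ j [MOD p] →
      ∀ k, ((p : ℤ) ^ k ∣ T + θ i ↔ (p : ℤ) ^ k ∣ θ j - θ i) ∧
        ((p : ℤ) ^ k ∣ T + θ j ↔ (p : ℤ) ^ k ∣ θ j - θ i) := by
    intro p hp hpZ i j hij hj h k
    have hg : (θ j - θ i : ℤ) ≠ 0 := by
      intro h0
      have := hinj i (by omega) j hj (by omega)
      omega
    have hgM : |(θ j - θ i : ℤ)| ≤ M := by
      have := hθM i (by omega)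
      have := hθM j hj
      rw [abs_le]
      omega
    have hpM : (M : ℤ) < (p : ℤ) ^ (M + 1) := by
      exact_mod_cast (Nat.lt_succ_self M).trans (Nat.lt_pow_self hp.one_lt)
    have hgb : ¬ (p : ℤ) ^ (M + 1) ∣ θ j - θ i := fun hd =>
      hg (Int.eq_zero_of_abs_lt_dvd hd (hgM.trans_lt hpM))
    have hp2 : ∀ k, (p : ℤ) ^ k ∣ 2 * (θ j - θ i) ↔ (p : ℤ) ^ k ∣ θ j - θ i := by
      intro k
      refine ⟨fun hd => ?_, fun hd => hd.mul_left _⟩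
      refine IsCoprime.dvd_of_dvd_mul_left (IsCoprime.pow_left ?_) hd
      have : Nat.Coprime p 2 := (Nat.coprime_primes hp Nat.prime_two).2
        (fun h => hpZ (h ▸ h2Z))
      exact_mod_cast Nat.isCoprime_iff_coprime.2 this
    have hple : p ≤ M := by
      have := Int.le_of_dvd (abs_pos.2 hg) ((dvd_abs _ _).2 (Nat.modEq_iff_dvd.1 h))
      exact_mod_cast this.trans hgM
    have h3 := hT p (Finset.mem_union_right _
      (Finset.mem_filter.2 ⟨Finset.mem_range.2 (by omega), hp⟩))
    simp only [hpZ, if_false] at h3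
    have h4 := Nat.modEq_iff_dvd.1 h3.symm
    push_cast at h4
    obtain ⟨h5, h6⟩ := hr p hp hpZ i j hij hj h
    refine ⟨pow_dvd_iff_of_pow_dvd_sub ?_ hgb k,
      (pow_dvd_iff_of_pow_dvd_sub ?_ (mt (hp2 _).1 hgb) k).trans (hp2 k)⟩
    · have h7 : (T + θ i - (θ j - θ i) : ℤ) = (T - r p) + (r p + θ i - (θ j - θ i)) := by ring
      exact h7 ▸ dvd_add h4 h5
    · have h7 : (T + θ j - 2 * (θ j - θ i) : ℤ) = (T - r p) + (r p + θ j - 2 * (θ j - θ i)) := by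
        ring
      exact h7 ▸ dvd_add h4 h6
  have hcol' : ∀ p, p.Prime → p ∉ Z → ∀ i < N, ∀ j < N, i ≠ j → θ i ≡ θ j [MOD p] →
      ∀ k, (p ^ k ∣ T + θ i ↔ p ^ k ∣ T + θ j) ∧ ((p : ℤ) ^ k ∣ θ j - θ i → p ^ k ∣ T + θ j) := by
    intro p hp hpZ i hi j hj hij h k
    zify
    rcases hij.lt_or_gt with hlt | hlt
    · obtain ⟨h3, h4⟩ := hcol p hp hpZ i j hlt hj h k
      exact ⟨h3.trans h4.symm, h4.2⟩
    · obtain ⟨h3, h4⟩ := hcol p hp hpZ j i hlt hi h.symm k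
      exact ⟨h4.trans h3.symm, fun hd => h3.2 (by rwa [dvd_sub_comm])⟩
  refine ⟨fun i => T + θ i, hne, fun p hp i hi =>
    factorization_eq_of_pow_dvd_iff (hZ p hp) (hne i hi) (hplan p hp i hi), ?_, ?_⟩
  · intro i hi j hj hlt
    rw [Nat.dvd_iff_prime_pow_dvd_dvd]
    intro p k hp hd
    have hij : i ≠ j := by
      rintro rfl
      exact lt_irrefl _ hlt
    rcases Nat.eq_zero_or_pos k with rfl | hk
    · simp
    by_cases hpZ : p ∈ Z
    · rw [hplan p hpZ j hj]
      by_contra hlt'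
      have hi' : ¬ k ≤ e p i := fun h =>
        hlt' ((hplan p hpZ j hj k).1
          ((Nat.dvd_sub_iff_right hlt.le ((hplan p hpZ i hi k).2 h)).1 hd))
      have hne' : e p i ≠ e p j := fun h => hij (he p hpZ i hi j hj h)
      rcases hne'.lt_or_gt with h | h
      · have h3 := (pow_dvd_pow p (show e p i + 1 ≤ k by omega)).trans hd
        have h4 := (hplan p hpZ j hj (e p i + 1)).2 (by omega)
        have h5 := (hplan p hpZ i hi (e p i + 1)).1
          ((Nat.dvd_sub_iff_left hlt.le h4).1 h3)
        omega
      · have h3 := (pow_dvd_pow p (show e p j + 1 ≤ k by omega)).trans hd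
        have h4 := (hplan p hpZ i hi (e p j + 1)).2 (by omega)
        have h5 := (hplan p hpZ j hj (e p j + 1)).1
          ((Nat.dvd_sub_iff_right hlt.le h4).1 h3)
        omega
    · have h3 : (p : ℤ) ^ k ∣ θ i - θ j := by
        have := Int.natCast_dvd_natCast.2 hd
        rw [Nat.cast_sub hlt.le] at this
        push_cast at this
        convert this using 1
        ring
      have h4 : θ j ≡ θ i [MOD p] :=
        Nat.modEq_iff_dvd.2 ((dvd_pow_self _ hk.ne').trans h3)
      obtain ⟨h5, h6⟩ := hcol' p hp hpZ j hj i hi hij.symm h4 k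
      exact h5.2 (h6 h3)
  · intro p hp hpZ
    by_cases h : ∃ i < N, p ∣ T + θ i
    · obtain ⟨i, hi, hd⟩ := h
      refine ⟨(T + θ i).factorization p, fun j hj => ?_⟩
      by_cases hdj : p ∣ T + θ j
      · right
        by_cases hij : i = j
        · rw [hij]
        have h4 : θ i ≡ θ j [MOD p] :=
          Nat.ModEq.add_left_cancel' T
            ((Nat.modEq_zero_iff_dvd.2 hd).trans (Nat.modEq_zero_iff_dvd.2 hdj).symm)
        refine factorization_eq_of_pow_dvd_iff hp (hne j hj) fun k => ?_
        rw [← (hcol' p hp hpZ i hi j hj hij h4 k).1, hp.pow_dvd_iff_le_factorization (hne i hi)]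
      · exact Or.inl (Nat.factorization_eq_zero_of_not_dvd hdj)
    · refine ⟨0, fun i hi => Or.inl (Nat.factorization_eq_zero_of_not_dvd fun hd => h ⟨i, hi, hd⟩)⟩

end ConsecutiveDifferences

section BalancedRatios

theorem factorization_mul_div_gcd {B m n : ℕ} (hB : B ≠ 0) (hm : m ≠ 0) (hn : n ≠ 0) (p : ℕ) :
    (B * (m / m.gcd n)).factorization p =
      B.factorization p + (m.factorization p - n.factorization p) := by
  have hd := Nat.gcd_dvd_left m n
  have h0 : m / m.gcd n ≠ 0 := (Nat.div_pos (Nat.le_of_dvd (Nat.pos_of_ne_zero hm) hd)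
    (Nat.gcd_pos_of_pos_left _ (Nat.pos_of_ne_zero hm))).ne'
  rw [Nat.factorization_mul hB h0, Nat.factorization_div hd, Nat.factorization_gcd hm hn]
  simp only [Finsupp.add_apply, Finsupp.tsub_apply, Finsupp.inf_apply]
  omega

/-- Integers whose differences divide them and whose reduced ratios, scaled by `B`, have values of
`dk k` in the ratio `w j : w i`. -/
theorem exists_seq_dk_mul_eq (N k B : ℕ) (hk : 0 < k) (hB : 0 < B) :
    ∃ n w : Fin N → ℕ, (∀ i, n i ≠ 0) ∧ Function.Injective n ∧ (∀ i, 2 ≤ w i) ∧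
      (∀ i j, n j < n i → n i - n j ∣ n j) ∧
      ∀ i j, dk k (B * (n i / (n i).gcd (n j))) * w i =
        dk k (B * (n j / (n j).gcd (n i))) * w j := by
  set z := N + k + B + 2 with hz
  set Z₁ := (Finset.range (z + 1)).filter Nat.Prime with hZ₁
  obtain ⟨Z₂, hZ₂, hcard⟩ := Set.Infinite.exists_subset_card_eq
    (s := {p : ℕ | p.Prime ∧ z < p}) (Set.infinite_of_forall_exists_gt fun a => by
      obtain ⟨p, hp, hp'⟩ := Nat.exists_infinite_primes (a + z + 1)
      exact ⟨p, ⟨hp', by omega⟩, by omega⟩) (Z₁.filter fun p => ¬ p ∣ k).card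
  have hmem₁ : ∀ p, p ∈ Z₁ ↔ p.Prime ∧ p ≤ z := fun p => by
    rw [hZ₁, Finset.mem_filter, Finset.mem_range, Nat.lt_succ_iff, and_comm]
  have hmem₂ : ∀ p ∈ Z₂, p.Prime ∧ z < p := fun p hp => hZ₂ hp
  have hdisj : ∀ p ∈ Z₂, p ∉ Z₁ := fun p hp h =>
    (hmem₂ p hp).2.not_ge ((hmem₁ p).1 h).2
  obtain ⟨n, hn0, hplan, hsub, hv⟩ := exists_seq_sub_dvd (N := N) (Z := Z₁ ∪ Z₂)
    (fun p hp => (Finset.mem_union.1 hp).elim (fun h => ((hmem₁ p).1 h).1) fun h => (hmem₂ p h).1)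
    (fun p hp hpN => Finset.mem_union_left _ ((hmem₁ p).2 ⟨hp, by omega⟩))
    (Finset.mem_union_left _ ((hmem₁ 2).2 ⟨Nat.prime_two, by omega⟩))
    (fun p i => if p ∈ Z₁ then (1 + B.factorization p) * i else N - i)
    (by
      intro p _ i hi j hj h
      by_cases hp : p ∈ Z₁
      · simp only [hp, if_true] at h
        exact Nat.eq_of_mul_eq_mul_left (by omega) h
      · simp only [hp, if_false] at h
        omega)
  have hβ : ∀ p, p ∉ Z₁ → B.factorization p = 0 := by
    intro p hp
    by_cases hp' : p.Prime
    · refine Nat.factorization_eq_zero_of_not_dvd fun hd => hp ((hmem₁ p).2 ⟨hp', ?_⟩)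
      have := Nat.le_of_dvd hB hd
      omega
    · exact Nat.factorization_eq_zero_of_not_prime _ hp'
  set S := (Z₁ ∪ Z₂) ∪ (Finset.range N).biUnion fun i => (n i).primeFactors with hS
  set T := S.filter fun p => ¬ p ∣ k with hT
  have hdk : ∀ i < N, ∀ j < N, dk k (B * (n i / (n i).gcd (n j))) = ∏ p ∈ T,
      (B.factorization p + ((n i).factorization p - (n j).factorization p) + 1) := by
    intro i hi j hj
    have h0 : n i / (n i).gcd (n j) ∣ n i := Nat.div_dvd_of_dvd (Nat.gcd_dvd_left _ _)
    have h1 : n i / (n i).gcd (n j) ≠ 0 := ne_zero_of_dvd_ne_zero (hn0 i hi) h0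
    rw [dk_eq_prod k (S := S) (mul_ne_zero hB.ne' h1)]
    · exact Finset.prod_congr rfl fun p _ => by
        rw [factorization_mul_div_gcd hB.ne' (hn0 i hi) (hn0 j hj)]
    · rw [Nat.primeFactors_mul hB.ne' h1]
      refine Finset.union_subset (fun p hp => ?_) (fun p hp => ?_)
      · have h2 := Nat.le_of_dvd hB (Nat.dvd_of_mem_primeFactors hp)
        exact Finset.mem_union_left _ (Finset.mem_union_left _
          ((hmem₁ p).2 ⟨Nat.prime_of_mem_primeFactors hp, by omega⟩))
      · exact Finset.mem_union_right _ (Finset.mem_biUnion.2 ⟨i, Finset.mem_range.2 hi,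
          Nat.primeFactors_mono h0 (hn0 i hi) hp⟩)
  set u : ℕ → ℕ := fun i => ∏ p ∈ T with p ∉ Z₁ ∪ Z₂, ((n i).factorization p + 1) with hu
  have hTZ : (T.filter fun p => p ∈ Z₁ ∪ Z₂) = (Z₁.filter fun p => ¬ p ∣ k) ∪ Z₂ := by
    ext p
    simp only [hT, hS, Finset.mem_filter, Finset.mem_union]
    constructor
    · rintro ⟨⟨-, h⟩, h' | h'⟩
      · exact Or.inl ⟨h', h⟩
      · exact Or.inr h'
    · rintro (⟨h, h'⟩ | h)
      · exact ⟨⟨Or.inl (Or.inl h), h'⟩, Or.inl h⟩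
      · refine ⟨⟨Or.inl (Or.inr h), fun hd => ?_⟩, Or.inr h⟩
        have := Nat.le_of_dvd hk hd
        have := (hmem₂ p h).2
        omega
  have hplanned : ∀ i < N, ∀ j < N, (∏ p ∈ T with p ∈ Z₁ ∪ Z₂,
      (B.factorization p + ((n i).factorization p - (n j).factorization p) + 1)) =
      (∏ p ∈ Z₁ with ¬ p ∣ k, (1 + B.factorization p)) *
        ((1 + (i - j)) * (1 + (j - i))) ^ (Z₁.filter fun p => ¬ p ∣ k).card := by
    intro i hi j hj
    rw [hTZ, Finset.prod_union (Finset.disjoint_left.2 fun p hp hp' =>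
      hdisj p hp' (Finset.mem_filter.1 hp).1), mul_pow, ← mul_assoc]
    congr 1
    · rw [← Finset.prod_const, ← Finset.prod_mul_distrib]
      refine Finset.prod_congr rfl fun p hp => ?_
      have hp := (Finset.mem_filter.1 hp).1
      rw [hplan p (Finset.mem_union_left _ hp) i hi, hplan p (Finset.mem_union_left _ hp) j hj]
      simp only [hp, if_true]
      rw [← Nat.mul_sub]
      ring
    · rw [← hcard, ← Finset.prod_const]
      refine Finset.prod_congr rfl fun p hp => ?_
      rw [hplan p (Finset.mem_union_right _ hp) i hi, hplan p (Finset.mem_union_right _ hp) j hj,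
        hβ p (hdisj p hp)]
      simp only [hdisj p hp, if_false]
      omega
  have hratio : ∀ i < N, ∀ j < N, dk k (B * (n i / (n i).gcd (n j))) * u j =
      dk k (B * (n j / (n j).gcd (n i))) * u i := by
    intro i hi j hj
    rw [hdk i hi j hj, hdk j hj i hi,
      ← Finset.prod_filter_mul_prod_filter_not T (fun p => p ∈ Z₁ ∪ Z₂),
      ← Finset.prod_filter_mul_prod_filter_not T (fun p => p ∈ Z₁ ∪ Z₂),
      hplanned i hi j hj, hplanned j hj i hi, mul_comm (1 + (i - j)), mul_assoc (_ * _ ^ _),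
      mul_assoc (_ * _ ^ _)]
    congr 1
    rw [hu, ← Finset.prod_mul_distrib, ← Finset.prod_mul_distrib]
    refine Finset.prod_congr rfl fun p hp => ?_
    have hpZ := (Finset.mem_filter.1 hp).2
    rw [hβ p fun h => hpZ (Finset.mem_union_left _ h)]
    by_cases hp' : p.Prime
    · obtain ⟨v, h⟩ := hv p hp' hpZ
      rcases h i hi with h1 | h1 <;> rcases h j hj with h2 | h2 <;> rw [h1, h2] <;> simp
    · simp [Nat.factorization_eq_zero_of_not_prime _ hp']
  have hupos : ∀ i, 0 < u i := fun i => Finset.prod_pos fun _ _ => Nat.succ_pos _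
  refine ⟨fun i => n i, fun i => 2 * ∏ l ∈ Finset.univ.erase i, u l, fun i => hn0 i i.2, ?_, ?_,
    fun i j h => hsub i i.2 j j.2 h, ?_⟩
  · intro i j hij
    have h2 : 2 ∈ Z₁ := (hmem₁ 2).2 ⟨Nat.prime_two, by omega⟩
    have h3 := hplan 2 (Finset.mem_union_left _ h2) i i.2
    have h4 := hplan 2 (Finset.mem_union_left _ h2) j j.2
    simp only [h2, if_true] at h3 h4 hij
    rw [hij, h4] at h3
    exact Fin.ext (Nat.eq_of_mul_eq_mul_left (by omega) h3).symm
  · intro i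
    have : 0 < ∏ l ∈ Finset.univ.erase i, u l := Finset.prod_pos fun l _ => hupos l
    simp only
    omega
  · intro i j
    by_cases hij : i = j
    · rw [hij]
    simp only
    rw [← Finset.mul_prod_erase (Finset.univ.erase i) (fun l : Fin N => u l) (a := j)
        (by simp [Ne.symm hij]),
      ← Finset.mul_prod_erase (Finset.univ.erase j) (fun l : Fin N => u l) (a := i) (by simp [hij]),
      Finset.erase_right_comm]
    have := hratio i i.2 j j.2
    linear_combination (2 * ∏ l ∈ (Finset.univ.erase j).erase i, u l) * this

end BalancedRatios

section PatternForms

theorem exists_injective_primes_gt (N A : ℕ) :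
    ∃ h : Fin N → ℕ, Function.Injective h ∧ ∀ i, (h i).Prime ∧ A < h i := by
  refine ⟨fun i => Nat.nth Nat.Prime (A + 1 + i), fun i j hij => ?_, fun i =>
    ⟨Nat.prime_nth_prime _, ?_⟩⟩
  · have := Nat.nth_injective Nat.infinite_setOfPred_prime hij
    exact Fin.ext (by omega)
  · exact lt_of_lt_of_le (by omega : A < A + 1 + (i : ℕ))
      ((Nat.nth_strictMono Nat.infinite_setOfPred_prime).le_apply (x := A + 1 + i))

theorem exists_one_add_mul_modEq {N : ℕ} {a h w : Fin N → ℕ} (hinj : Function.Injective h)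
    (hp : ∀ i, (h i).Prime) (ha : ∀ i, ¬ h i ∣ a i) (hw : ∀ i, 2 ≤ w i) :
    ∃ t, ∀ i, 1 + a i * t ≡ h i ^ (w i - 1) [MOD h i ^ w i] := by
  have hy : ∀ i, ∃ y, 1 + a i * y ≡ h i ^ (w i - 1) [MOD h i ^ w i] := by
    intro i
    have h1 : 1 < h i ^ w i := Nat.one_lt_pow (by have := hw i; omega) (hp i).one_lt
    obtain ⟨m, -, hm⟩ := Nat.exists_mul_mod_eq_one_of_coprime
      (((Nat.Prime.coprime_iff_not_dvd (hp i)).2 (ha i)).symm.pow_right (w i)) h1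
    refine ⟨m * (h i ^ (w i - 1) + (h i ^ w i - 1)), ?_⟩
    have h2 : a i * m ≡ 1 [MOD h i ^ w i] := by
      rw [Nat.ModEq, hm, Nat.mod_eq_of_lt h1]
    have h3 := (h2.mul_right (h i ^ (w i - 1) + (h i ^ w i - 1))).add_left 1
    rw [mul_assoc, one_mul, show 1 + (h i ^ (w i - 1) + (h i ^ w i - 1)) =
      h i ^ (w i - 1) + h i ^ w i by omega] at h3
    exact h3.trans (by simp [Nat.ModEq])
  choose y hy using hy
  obtain ⟨t, ht⟩ := Nat.chineseRemainderOfFinset y (fun i => h i ^ w i) Finset.univ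
    (fun i _ => pow_ne_zero _ (hp i).ne_zero)
    (fun i _ j _ hij => Nat.Coprime.pow _ _
      ((Nat.coprime_primes (hp i) (hp j)).2 fun e => hij (hinj e)))
  exact ⟨t, fun i => (((ht i (Finset.mem_univ i)).mul_left (a i)).add_left 1).trans (hy i)⟩

theorem exists_admissibleForms_dk_eq {N k B : ℕ} (hk : 0 < k) (hB : 0 < B) {n w : Fin N → ℕ}
    (hn0 : ∀ i, n i ≠ 0) (hn : Function.Injective n) (hw : ∀ i, 2 ≤ w i)
    (hsub : ∀ i j, n j < n i → n i - n j ∣ n j)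
    (hdk : ∀ i j, dk k (B * (n i / (n i).gcd (n j))) * w i =
      dk k (B * (n j / (n j).gcd (n i))) * w j) :
    ∃ (A : ℕ) (a b : Fin N → ℕ) (s : Fin N → Fin N → ℕ), AdmissibleForms N A a b ∧ k ∣ A ∧
      (∀ i, 0 < a i) ∧ ∀ i j, 0 < s i j ∧ (∀ p, p.Prime → p ∣ s i j → p ∣ A) ∧
        dk k (s i j) = dk k (s j i) ∧
        (n j < n i → ∀ τ, s i j * (a i * τ + b i) = s j i * (a j * τ + b j) + B) := by
  set A₀ := (4 * N ^ 2).factorial * k * B * ∏ j, n j with hA₀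
  have hA₀pos : 0 < A₀ := by
    have := Finset.prod_pos fun j (_ : j ∈ Finset.univ) => Nat.pos_of_ne_zero (hn0 j)
    have := Nat.factorial_pos (4 * N ^ 2)
    positivity
  have hndvd : ∀ j, n j ∣ A₀ := fun j =>
    (Finset.dvd_prod_of_mem n (Finset.mem_univ j)).trans (dvd_mul_left _ _)
  have hkdvd : k ∣ A₀ := ((dvd_mul_left k _).mul_right _).mul_right _
  have hBdvd : B ∣ A₀ := (dvd_mul_left B _).mul_right _
  set a₀ : Fin N → ℕ := fun i => A₀ * ∏ j ∈ Finset.univ.erase i, n j with ha₀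
  have hna : ∀ i, n i * a₀ i = A₀ * ∏ j, n j := fun i => by
    rw [← Finset.mul_prod_erase _ _ (Finset.mem_univ i)]
    ring
  have ha₀dvd : ∀ p, p.Prime → ∀ i, p ∣ a₀ i → p ∣ A₀ := by
    intro p hp i hd
    rcases hp.dvd_mul.1 hd with h | h
    · exact h
    · obtain ⟨j, -, hj⟩ := (hp.prime.dvd_finsetProd_iff _).1 h
      exact hj.trans (hndvd j)
  have hpair : ∀ p, p.Prime → ∀ i j t, i ≠ j → p ∣ 1 + a₀ i * t → p ∣ 1 + a₀ j * t →
      p ∣ A₀ := by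
    intro p hp i j t hij hi hj
    wlog hlt : n j < n i generalizing i j
    · exact this j i hij.symm hj hi
        (lt_of_le_of_ne (not_lt.1 hlt) fun h => hij (hn h))
    · refine Dvd.dvd.trans ?_ ((hsub i j hlt).trans (hndvd j))
      have h1 : n i - n j = n i * (1 + a₀ i * t) - n j * (1 + a₀ j * t) := by
        rw [mul_add, mul_add, ← mul_assoc (n i), ← mul_assoc (n j), hna, hna, mul_one, mul_one,
          Nat.add_sub_add_right]
      rw [h1]
      exact Nat.dvd_sub (hi.mul_left _) (hj.mul_left _)
  obtain ⟨h, hinj, hh⟩ := exists_injective_primes_gt N A₀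
  have hhp : ∀ i, (h i).Prime := fun i => (hh i).1
  have hhA : ∀ i, ¬ h i ∣ A₀ := fun i hd => (hh i).2.not_ge (Nat.le_of_dvd hA₀pos hd)
  obtain ⟨t, ht⟩ := exists_one_add_mul_modEq (a := a₀) (w := w) hinj hhp
    (fun i hd => hhA i (ha₀dvd _ (hhp i) i hd)) hw
  have hPw : ∀ i, h i * h i ^ (w i - 1) = h i ^ w i := fun i => by
    rw [← pow_succ', Nat.sub_add_cancel (by have := hw i; omega)]
  have hPpos : ∀ i, 0 < h i ^ (w i - 1) := fun i => pow_pos (hhp i).pos _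
  have hb : ∀ i, ∃ b, h i ^ (w i - 1) * b = 1 + a₀ i * t ∧ ¬ h i ∣ b := by
    intro i
    have h1 : h i ^ (w i - 1) ∣ 1 + a₀ i * t :=
      ((ht i).of_dvd (pow_dvd_pow _ (Nat.sub_le _ _))).dvd_iff dvd_rfl |>.2 dvd_rfl
    obtain ⟨b, hb⟩ := h1
    refine ⟨b, hb.symm, fun hd => ?_⟩
    have h2 : h i ^ w i ∣ 1 + a₀ i * t := by
      rw [hb, ← hPw, mul_comm (h i)]
      exact mul_dvd_mul_left _ hd
    have h3 := ((ht i).dvd_iff dvd_rfl).1 h2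
    rw [Nat.pow_dvd_pow_iff_le_right (hhp i).one_lt] at h3
    have := hw i
    omega
  choose b hb hhb using hb
  set a : Fin N → ℕ := fun i => a₀ i * (h i * ∏ j ∈ Finset.univ.erase i, h j ^ w j) with ha
  have hkey : ∀ i τ, h i ^ (w i - 1) * (a i * τ + b i) =
      1 + a₀ i * (t + (∏ j, h j ^ w j) * τ) := by
    intro i τ
    rw [← Finset.mul_prod_erase _ _ (Finset.mem_univ i), ← hPw, mul_add, hb, ha]
    ring
  have hdvd : ∀ p i τ, p ∣ a i * τ + b i → p ∣ 1 + a₀ i * (t + (∏ j, h j ^ w j) * τ) :=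
    fun p i τ hd => hkey i τ ▸ hd.mul_left _
  have hhdvd : ∀ j, h j ∣ ∏ j, h j := fun j => Finset.dvd_prod_of_mem h (Finset.mem_univ j)
  have hRpos : ∀ i j, 0 < B * (n i / (n i).gcd (n j)) := fun i j =>
    Nat.mul_pos hB (Nat.div_pos (Nat.le_of_dvd (Nat.pos_of_ne_zero (hn0 i))
      (Nat.gcd_dvd_left _ _)) (Nat.gcd_pos_of_pos_left _ (Nat.pos_of_ne_zero (hn0 i))))
  have hRdvd : ∀ p, p.Prime → ∀ i j, p ∣ B * (n i / (n i).gcd (n j)) → p ∣ A₀ := by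
    intro p hp i j hd
    rcases hp.dvd_mul.1 hd with hd | hd
    · exact hd.trans hBdvd
    · exact (hd.trans (Nat.div_dvd_of_dvd (Nat.gcd_dvd_left _ _))).trans (hndvd i)
  have hdks : ∀ i j, dk k (B * (n i / (n i).gcd (n j)) * h i ^ (w i - 1)) =
      dk k (B * (n i / (n i).gcd (n j))) * w i := by
    intro i j
    rw [dk_mul_of_coprime k (Nat.Coprime.pow_right _ (Nat.Coprime.symm
      ((Nat.Prime.coprime_iff_not_dvd (hhp i)).2 fun hd => hhA i (hRdvd _ (hhp i) i j hd)))),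
      dk_prime_pow k (hhp i), if_neg fun hd => hhA i (hd.trans hkdvd),
      Nat.sub_add_cancel (by have := hw i; omega)]
  refine ⟨A₀ * ∏ j, h j, a, b, fun i j => B * (n i / (n i).gcd (n j)) * h i ^ (w i - 1),
    ⟨?_, ?_, ?_, ?_, ?_⟩, hkdvd.mul_right _, fun i => ?_, fun i j => ⟨?_, ?_, ?_, ?_⟩⟩
  · exact Nat.mul_pos hA₀pos (Finset.prod_pos fun j _ => (hhp j).pos)
  · intro p hp hpA i τ hd
    have hd' := hdvd p i τ hd
    rcases hp.dvd_mul.1 hpA with hpA | hpA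
    · have h1 : p ∣ a₀ i := hpA.mul_right _
      exact hp.one_lt.ne' (Nat.dvd_one.1 ((Nat.dvd_add_left (h1.mul_right _)).1 hd'))
    · obtain ⟨j, -, hj⟩ := (hp.prime.dvd_finsetProd_iff _).1 hpA
      obtain rfl := (Nat.prime_dvd_prime_iff_eq hp (hhp j)).1 hj
      by_cases hij : i = j
      · subst hij
        refine hhb i ((Nat.dvd_add_right (Dvd.dvd.mul_right ?_ _)).1 hd)
        exact (dvd_mul_right _ _).mul_left _
      · refine hhA j (hpair _ hp i j _ hij hd' ?_)
        rw [← hkey]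
        exact (dvd_pow_self _ (by have := hw j; omega)).mul_right _
  · intro p hp hpA i hd
    rcases hp.dvd_mul.1 hd with hd | hd
    · exact hpA ((ha₀dvd p hp i hd).mul_right _)
    · refine hpA (Dvd.dvd.mul_left ?_ _)
      rcases hp.dvd_mul.1 hd with hd | hd
      · exact hd.trans (hhdvd i)
      · obtain ⟨j, -, hj⟩ := (hp.prime.dvd_finsetProd_iff _).1 hd
        exact (hp.dvd_of_dvd_pow hj).trans (hhdvd j)
  · intro p hp hpA i j τ hij hi hj
    exact hpA ((hpair p hp i j _ hij (hdvd p i τ hi) (hdvd p j τ hj)).mul_right _)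
  · intro p hp hpN
    refine Dvd.dvd.mul_right ?_ _
    rw [hA₀]
    exact (((hp.dvd_factorial.2 hpN).mul_right _).mul_right _).mul_right _
  · have h1 : ∀ s : Finset (Fin N), 0 < ∏ j ∈ s, n j := fun s =>
      Finset.prod_pos fun j _ => Nat.pos_of_ne_zero (hn0 j)
    have h2 : ∀ s : Finset (Fin N), 0 < ∏ j ∈ s, h j ^ w j := fun s =>
      Finset.prod_pos fun j _ => pow_pos (hhp j).pos _
    exact Nat.mul_pos (Nat.mul_pos hA₀pos (h1 _)) (Nat.mul_pos (hhp i).pos (h2 _))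
  · exact Nat.mul_pos (hRpos i j) (hPpos i)
  · intro p hp hd
    rcases hp.dvd_mul.1 hd with hd | hd
    · exact (hRdvd p hp i j hd).mul_right _
    · exact ((hp.dvd_of_dvd_pow hd).trans (hhdvd i)).mul_left _
  · simp only [hdks, hdk i j]
  · intro hlt τ
    have hd : (n i).gcd (n j) = n i - n j := by
      refine Nat.dvd_antisymm (Nat.dvd_sub (Nat.gcd_dvd_left _ _) (Nat.gcd_dvd_right _ _))
        (Nat.dvd_gcd ?_ (hsub i j hlt))
      exact (Nat.dvd_sub_iff_left hlt.le (hsub i j hlt)).1 dvd_rfl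
    set d := n i - n j with hdd
    have hdpos : 0 < d := Nat.sub_pos_of_lt hlt
    have hi : d * (n i / d) = n i := Nat.mul_div_cancel' (hd ▸ Nat.gcd_dvd_left _ _)
    have hj : d * (n j / d) = n j := Nat.mul_div_cancel' (hd ▸ Nat.gcd_dvd_right _ _)
    have hnij : n i = n j + d := by omega
    simp only
    rw [Nat.gcd_comm (n j), hd, mul_assoc, hkey, mul_assoc (B * (n j / d)), hkey]
    refine Nat.eq_of_mul_eq_mul_left hdpos ?_
    have h1 := hna i
    have h2 := hna j
    set X := t + (∏ j, h j ^ w j) * τ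
    calc d * (B * (n i / d) * (1 + a₀ i * X)) =
          B * (d * (n i / d)) + B * (d * (n i / d) * a₀ i) * X := by ring
      _ = B * (d * (n j / d)) + B * (d * (n j / d) * a₀ j) * X + B * d := by
        rw [hi, hj, h1, h2, hnij]
        ring
      _ = _ := by ring

end PatternForms

section Assembly

open Classical in
theorem AdmissibleForms.exists_le_card_dk_eq {N k B : ℕ} {A : ℕ} {a b : Fin N → ℕ}
    {s : Fin N → Fin N → ℕ} {n : Fin N → ℕ} (h : AdmissibleForms N A a b)
    (hkA : k ∣ A) (hn : Function.Injective n) (ha : ∀ i, 0 < a i) (hs : ∀ i j, 0 < s i j ∧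
      (∀ p, p.Prime → p ∣ s i j → p ∣ A) ∧ dk k (s i j) = dk k (s j i) ∧
        (n j < n i → ∀ τ, s i j * (a i * τ + b i) = s j i * (a j * τ + b j) + B)) :
    ∃ C : ℕ, 0 < C ∧ ∀ X : ℕ, (cnt X fun τ => ∃ i j, i ≠ j ∧ Squarefree (a i * τ + b i) ∧
        Squarefree (a j * τ + b j) ∧
        (a i * τ + b i).primeFactors.card = (a j * τ + b j).primeFactors.card) ≤
      ((N ^ 2 : ℕ) : ℝ) *
        (((Finset.Icc 1 (C * X)).filter fun m => dk k m = dk k (m + B)).card : ℝ) := by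
  refine ⟨∑ i, ∑ j, s i j * (a i + b i) + 1, Nat.succ_pos _, fun X => ?_⟩
  set C := ∑ i, ∑ j, s i j * (a i + b i) + 1 with hC
  set S := (Finset.Icc 1 (C * X)).filter fun m => dk k m = dk k (m + B) with hS
  have hdk : ∀ i j τ, Squarefree (a i * τ + b i) →
      dk k (s i j * (a i * τ + b i)) = dk k (s i j) * 2 ^ (a i * τ + b i).primeFactors.card := by
    intro i j τ hsq
    rw [dk_mul_of_coprime k (Nat.coprime_of_dvd fun p hp hd hd' =>
        h.not_dvd p hp ((hs i j).2.1 p hp hd) i τ hd'),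
      dk_squarefree hsq (Nat.coprime_of_dvd fun p hp hd hd' =>
        h.not_dvd p hp (hd'.trans hkA) i τ hd)]
  have hmem : ∀ i j τ, τ < X → n j < n i → Squarefree (a i * τ + b i) →
      Squarefree (a j * τ + b j) →
      (a i * τ + b i).primeFactors.card = (a j * τ + b j).primeFactors.card →
      s j i * (a j * τ + b j) ∈ S := by
    intro i j τ hτ hlt hi hj hij
    rw [hS, Finset.mem_filter, Finset.mem_Icc]
    refine ⟨⟨Nat.mul_pos (hs j i).1 (Nat.pos_of_ne_zero hj.ne_zero), ?_⟩, ?_⟩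
    · have h1 : s j i * (a j + b j) ≤ C := by
        refine le_trans ?_ (Nat.le_succ _)
        exact (Finset.single_le_sum (f := fun i => s j i * (a j + b j))
          (fun _ _ => Nat.zero_le _) (Finset.mem_univ i)).trans
          (Finset.single_le_sum (f := fun j => ∑ i, s j i * (a j + b j))
            (fun _ _ => Nat.zero_le _) (Finset.mem_univ j))
      calc s j i * (a j * τ + b j) ≤ s j i * (a j * X + b j * X) := by
            gcongr
            exact Nat.le_mul_of_pos_right _ (by omega)
        _ = s j i * (a j + b j) * X := by ring
        _ ≤ C * X := by gcongr
    · rw [← (hs i j).2.2.2 hlt τ, hdk j i τ hj, hdk i j τ hi, hij, (hs i j).2.2.1]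
  have hsub : (Finset.range X).filter (fun τ => ∃ i j, i ≠ j ∧ Squarefree (a i * τ + b i) ∧
        Squarefree (a j * τ + b j) ∧
        (a i * τ + b i).primeFactors.card = (a j * τ + b j).primeFactors.card) ⊆
      (Finset.univ : Finset (Fin N × Fin N)).biUnion fun x =>
        (Finset.range X).filter fun τ => s x.1 x.2 * (a x.1 * τ + b x.1) ∈ S := by
    intro τ hτ
    obtain ⟨hτ, i, j, hij, hi, hj, hc⟩ := Finset.mem_filter.1 hτ
    rw [Finset.mem_biUnion]
    rcases (hn.ne hij).lt_or_gt with hlt | hlt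
    · exact ⟨(i, j), Finset.mem_univ _, Finset.mem_filter.2
        ⟨hτ, hmem j i τ (Finset.mem_range.1 hτ) hlt hj hi hc.symm⟩⟩
    · exact ⟨(j, i), Finset.mem_univ _, Finset.mem_filter.2
        ⟨hτ, hmem i j τ (Finset.mem_range.1 hτ) hlt hi hj hc⟩⟩
  have hfib : ∀ x : Fin N × Fin N, ((Finset.range X).filter fun τ =>
      s x.1 x.2 * (a x.1 * τ + b x.1) ∈ S).card ≤ S.card := by
    intro x
    refine Finset.card_le_card_of_injOn (fun τ => s x.1 x.2 * (a x.1 * τ + b x.1))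
      (fun τ hτ => (Finset.mem_filter.1 hτ).2) (fun τ _ σ _ hστ => ?_)
    have := Nat.eq_of_mul_eq_mul_left (hs x.1 x.2).1 hστ
    exact Nat.eq_of_mul_eq_mul_left (ha x.1) (Nat.add_right_cancel this)
  have hcard := (Finset.card_le_card hsub).trans (Finset.card_biUnion_le.trans
    (Finset.sum_le_card_nsmul _ _ _ fun x _ => hfib x))
  rw [Finset.card_univ, Fintype.card_prod, Fintype.card_fin, smul_eq_mul, ← sq] at hcard
  unfold cnt
  exact_mod_cast hcard

theorem exists_mul_div_log_pow_le {f : ℕ → ℝ} (hf : Monotone f) {C D X₀ : ℕ} (hC : 0 < C)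
    (hD : 0 < D) (h : ∀ X, X₀ ≤ X → X / Real.log X ≤ D * f (C * X)) :
    ∃ c : ℝ, 0 < c ∧ ∃ x₀ : ℝ, ∀ x : ℝ, x₀ ≤ x → c * x / (Real.log x) ^ 7 ≤ f ⌊x⌋₊ := by
  have hC' : (1 : ℝ) ≤ C := by exact_mod_cast hC
  have hD' : (0 : ℝ) < D := by exact_mod_cast hD
  refine ⟨1 / (2 * C * D), by positivity, 4 * C * (X₀ + 3), fun x hx => ?_⟩
  have hX₀ : (0 : ℝ) ≤ X₀ := X₀.cast_nonneg
  have hx12 : 4 * (C : ℝ) * 3 ≤ x := by nlinarith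
  have hx1 : 12 ≤ x := by linarith
  set X := ⌊x⌋₊ / C with hX
  have hCX : C * X ≤ ⌊x⌋₊ := Nat.mul_div_le _ _
  have hXx : (C * X : ℝ) ≤ x := by
    exact_mod_cast (Nat.le_floor_iff (by linarith)).1 hCX
  have hxX : x < C * X + C + 1 := by
    have h1 := Nat.lt_floor_add_one x
    have h2 : ⌊x⌋₊ < C * X + C := by
      have := Nat.lt_mul_div_succ ⌊x⌋₊ hC
      rw [mul_add, mul_one] at this
      exact this
    have h3 : (⌊x⌋₊ : ℝ) + 1 ≤ C * X + C := by exact_mod_cast h2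
    linarith
  have hhalf : x ≤ 2 * C * X := by linarith
  have hXlarge : (X₀ + 3 : ℝ) ≤ X := by
    have : 4 * (C : ℝ) * (X₀ + 3) ≤ 2 * C * X := hx.trans hhalf
    nlinarith
  have hXpos : (0 : ℝ) < X := by linarith
  have hlogX : 0 < Real.log X := Real.log_pos (by linarith)
  have hlog : Real.log X ≤ Real.log x := Real.log_le_log hXpos (by nlinarith)
  have hlog1 : 1 ≤ Real.log x := by
    rw [Real.le_log_iff_exp_le (by linarith)]
    linarith [Real.exp_one_lt_d9]
  have hmain := (h X (by exact_mod_cast (by linarith : (X₀ : ℝ) ≤ X))).trans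
    (mul_le_mul_of_nonneg_left (hf hCX) hD'.le)
  calc 1 / (2 * C * D) * x / Real.log x ^ 7 ≤ 1 / (2 * C * D) * x / Real.log x := by
        gcongr
        exact le_self_pow₀ hlog1 (by norm_num)
    _ ≤ 1 / (2 * C * D) * (2 * C * X) / Real.log X := by gcongr
    _ = X / Real.log X / D := by field_simp
    _ ≤ f ⌊x⌋₊ := by
        rw [div_le_iff₀ hD']
        linarith

end Assembly

theorem dk_eq_dk_add_lower_bound (k B : ℕ) (hk : 0 < k) (hB : 0 < B) :
    ∃ c : ℝ, 0 < c ∧ ∃ x₀ : ℝ, ∀ x : ℝ, x₀ ≤ x →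
      c * x / (Real.log x) ^ 7 ≤
        (((Finset.Icc 1 ⌊x⌋₊).filter fun n => dk k n = dk k (n + B)).card : ℝ) := by
  obtain ⟨n, w, hn0, hn, hw, hsub, hdk⟩ := exists_seq_dk_mul_eq 2048 k B hk hB
  obtain ⟨A, a, b, s, hadm, hkA, ha, hs⟩ := exists_admissibleForms_dk_eq hk hB hn0 hn hw hsub hdk
  obtain ⟨C, hC, h⟩ := hadm.exists_le_card_dk_eq hkA hn ha hs
  obtain ⟨X₀, hX₀⟩ := hadm.cnt_squarefree_collision_ge (w := 20) (by norm_num) (by norm_num)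
    (by norm_num)
  refine exists_mul_div_log_pow_le (D := 2048 ^ 2) (X₀ := X₀)
    (f := fun m => (((Finset.Icc 1 m).filter fun n => dk k n = dk k (n + B)).card : ℝ))
    (fun m m' hm => Nat.cast_le.2 (Finset.card_le_card
      (Finset.filter_subset_filter _ (Finset.Icc_subset_Icc_right hm)))) hC (by norm_num)
    fun X hX => (hX₀ X hX).trans ((h X).trans_eq ?_)
  congr!
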